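/- arXiv:1712.06218 — 2 statements merged into one kernel-verified Lean document; each statement's English description precedes it below -/
import Mathlib

section
/- Dyson-type upper bound (Neumann): for every α ∈ [0,1] and every integer N ≥ 1 with 2 π α N < 1, the Neumann energy on the unit square satisfies E^N_N(α) ≤ 2 π N (N−1) α · (1 + (20/3) π (N−2) α) / (1 − 2 π α N)². -/
noncomputable section

open MeasureTheory Real Set
open scoped BigOperators Topology

/-- The plane `ℝ²`, with points written as pairs. -/
abbrev Plane : Type := ℝ × ℝ

/-- Configuration space of `N` particles in the plane. -/
abbrev Config (N : ℕ) : Type := Fin N → Plane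

/-- `x^{-⊥} := (-y, x)/(x² + y²)` for `x = (x, y) ∈ ℝ²`. -/
def perpInv (v : Plane) : Plane :=
  (-v.2 / (v.1 ^ 2 + v.2 ^ 2), v.1 / (v.1 ^ 2 + v.2 ^ 2))

/-- The Aharonov–Bohm potential `A_j(x) = ∑_{k ≠ j} (x_j - x_k)^{-⊥}`. -/
def abPot (N : ℕ) (j : Fin N) (x : Config N) : Plane :=
  ∑ k ∈ Finset.univ.erase j, perpInv (x j - x k)

/-- Partial derivative of `Ψ` at `x` in direction `v` of the `j`-th particle. -/
def pder (N : ℕ) (j : Fin N) (v : Plane) (Ψ : Config N → ℂ) (x : Config N) : ℂ :=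
  fderiv ℝ Ψ x (Pi.single j v)

/-- The two components of `D_j Ψ = -i ∇_{x_j} Ψ + α A_j Ψ` at `x`. -/
def DOp (N : ℕ) (α : ℝ) (j : Fin N) (Ψ : Config N → ℂ) (x : Config N) : ℂ × ℂ :=
  (-Complex.I * pder N j (1, 0) Ψ x + Complex.ofReal (α * (abPot N j x).1) * Ψ x,
   -Complex.I * pder N j (0, 1) Ψ x + Complex.ofReal (α * (abPot N j x).2) * Ψ x)

/-- `|D_j Ψ(x)|²`, the squared Euclidean norm of the vector `D_j Ψ(x) ∈ ℂ²`. -/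
def DSq (N : ℕ) (α : ℝ) (j : Fin N) (Ψ : Config N → ℂ) (x : Config N) : ℝ :=
  ‖(DOp N α j Ψ x).1‖ ^ 2 + ‖(DOp N α j Ψ x).2‖ ^ 2

/-- The diagonal set `{x : x_j = x_k for some j ≠ k}`. -/
def diagSet (N : ℕ) : Set (Config N) := {x | ∃ j k : Fin N, j ≠ k ∧ x j = x k}

/-- Admissible wave functions: smooth, symmetric, vanishing on a neighbourhood of
the diagonal set. -/
structure Admissible (N : ℕ) (Ψ : Config N → ℂ) : Prop where
  smooth : ContDiff ℝ (⊤ : ℕ∞) Ψ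
  symm : ∀ (σ : Equiv.Perm (Fin N)) (x : Config N), Ψ (x ∘ σ) = Ψ x
  vanishes : ∃ U : Set (Config N), IsOpen U ∧ diagSet N ⊆ U ∧ ∀ x ∈ U, Ψ x = 0

/-- `Ω^N` as a subset of configuration space. -/
def cube (N : ℕ) (Ω : Set Plane) : Set (Config N) := Set.univ.pi fun _ => Ω

/-- Total kinetic energy `∑_j ∫_{Ω^N} |D_j Ψ|²`. -/
def kinE (N : ℕ) (α : ℝ) (Ω : Set Plane) (Ψ : Config N → ℂ) : ℝ :=
  ∑ j, ∫ x in cube N Ω, DSq N α j Ψ x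

/-- `∫_{Ω^N} |Ψ|²`. -/
def normSq (N : ℕ) (Ω : Set Plane) (Ψ : Config N → ℂ) : ℝ :=
  ∫ x in cube N Ω, ‖Ψ x‖ ^ 2

/-- Neumann ground-state energy of `N` anyons with statistics parameter `α` on `Ω`,
with the convention that it is `0` for `N = 0`. -/
def neumannE (N : ℕ) (α : ℝ) (Ω : Set Plane) : ℝ :=
  if N = 0 then 0 else
    sInf {E | ∃ Ψ : Config N → ℂ, Admissible N Ψ ∧ normSq N Ω Ψ = 1 ∧ E = kinE N α Ω Ψ}

/-- Dirichlet ground-state energy of `N` anyons with statistics parameter `α` on `Ω`. -/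
def dirichletE (N : ℕ) (α : ℝ) (Ω : Set Plane) : ℝ :=
  sInf {E | ∃ Ψ : Config N → ℂ, Admissible N Ψ ∧ IsCompact (tsupport Ψ) ∧
    tsupport Ψ ⊆ cube N Ω ∧ normSq N Ω Ψ = 1 ∧ E = kinE N α Ω Ψ}

/-- The open unit square `Q₀ = (0,1)²`. -/
def Q0 : Set Plane := Set.Ioo (0 : ℝ) 1 ×ˢ Set.Ioo (0 : ℝ) 1

/-- `E^N_N(α)`, the Neumann energy on the unit square. -/
def EN (N : ℕ) (α : ℝ) : ℝ := neumannE N α Q0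

/-- `E^D_N(α)`, the Dirichlet energy on the unit square. -/
def ED (N : ℕ) (α : ℝ) : ℝ := dirichletE N α Q0

/-- One-particle density `ρ_Ψ` of a wave function of `n+1` particles. -/
def density (n : ℕ) (Ψ : Config (n + 1) → ℂ) (y : Plane) : ℝ :=
  (n + 1) * ∫ z : Config n, ‖Ψ (Fin.cons y z)‖ ^ 2

/-- squared Euclidean norm -/
def dyR (v : Plane) : ℝ := v.1 ^ 2 + v.2 ^ 2

/-- `(r²/2)^{β/4}` -/
def dyT (β : ℝ) (v : Plane) : ℝ := (dyR v / 2) ^ (β / 4)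

/-- smooth cutoff -/
def dyG (ε t : ℝ) : ℝ := ∫ u in (0:ℝ)..t, Real.smoothTransition (u / ε - 1)

/-- half of the pair factor -/
def dyH (β ε : ℝ) (v : Plane) : ℝ := dyG ε (dyT β v)

/-- pair factor -/
def dyF (β ε : ℝ) (v : Plane) : ℝ := dyH β ε v ^ 2

/-- bounding function -/
def dyg (β : ℝ) (v : Plane) : ℝ := dyT β v ^ 2 / √(dyR v)

/-- the trial function -/
def dyPhi (β ε : ℝ) (n : ℕ) (x : Config n) : ℝ :=
  ∏ i, ∏ j, if i = j then 1 else dyH β ε (x i - x j)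

lemma dyR_nonneg (v : Plane) : 0 ≤ dyR v := by unfold dyR; positivity

lemma dyR_neg (v : Plane) : dyR (-v) = dyR v := by simp [dyR]

lemma dyR_sub (v w : Plane) : dyR (v - w) = dyR (w - v) := by
  rw [← dyR_neg, neg_sub]

lemma dyT_nonneg (β : ℝ) (v : Plane) : 0 ≤ dyT β v :=
  Real.rpow_nonneg (div_nonneg (dyR_nonneg v) (by norm_num)) _

lemma dyH_sub (β ε : ℝ) (v w : Plane) : dyH β ε (v - w) = dyH β ε (w - v) := by
  simp only [dyH, dyT, dyR_sub v w]

lemma dyF_sub (β ε : ℝ) (v w : Plane) : dyF β ε (v - w) = dyF β ε (w - v) := by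
  simp only [dyF, dyH_sub β ε v w]

lemma dyg_sub (β : ℝ) (v w : Plane) : dyg β (v - w) = dyg β (w - v) := by
  simp only [dyg, dyT, dyR_sub v w]

lemma dyg_nonneg (β : ℝ) (v : Plane) : 0 ≤ dyg β v := by unfold dyg; positivity

lemma dyR_continuous : Continuous dyR := by unfold dyR; fun_prop

lemma dyT_continuous {β : ℝ} (hβ : 0 < β) : Continuous (dyT β) := by
  unfold dyT
  exact (dyR_continuous.div_const 2).rpow_const (fun _ => Or.inr (by positivity))

lemma dyg_measurable {β : ℝ} (hβ : 0 < β) : Measurable (dyg β) := by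
  unfold dyg
  exact ((dyT_continuous hβ).measurable.pow_const 2).div dyR_continuous.measurable.sqrt

lemma dyG_integrand_cont (ε : ℝ) : Continuous (fun u : ℝ => Real.smoothTransition (u / ε - 1)) :=
  Real.smoothTransition.continuous.comp (by fun_prop)

lemma dyG_hasDerivAt (ε t : ℝ) :
    HasDerivAt (dyG ε) (Real.smoothTransition (t / ε - 1)) t := by
  unfold dyG
  exact intervalIntegral.integral_hasDerivAt_right
    ((dyG_integrand_cont ε).intervalIntegrable _ _)
    ((dyG_integrand_cont ε).stronglyMeasurableAtFilter _ _) (dyG_integrand_cont ε).continuousAt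

lemma dyG_contDiff (ε : ℝ) : ContDiff ℝ (⊤ : ℕ∞) (dyG ε) := by
  rw [contDiff_infty_iff_deriv]
  refine ⟨fun t => (dyG_hasDerivAt ε t).differentiableAt, ?_⟩
  have : deriv (dyG ε) = fun t => Real.smoothTransition (t / ε - 1) :=
    funext fun t => (dyG_hasDerivAt ε t).deriv
  rw [this]
  exact Real.smoothTransition.contDiff.comp (by fun_prop)

lemma dyG_zero {ε t : ℝ} (hε : 0 < ε) (ht0 : 0 ≤ t) (ht : t ≤ ε) : dyG ε t = 0 := by
  unfold dyG
  rw [intervalIntegral.integral_congr (g := fun _ => (0:ℝ))]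
  · simp
  · intro u hu
    rw [uIcc_of_le ht0] at hu
    have : u / ε ≤ 1 := by rw [div_le_one hε]; exact hu.2.trans ht
    exact Real.smoothTransition.zero_of_nonpos (by linarith)

lemma dyG_nonneg {ε t : ℝ} (ht0 : 0 ≤ t) : 0 ≤ dyG ε t :=
  intervalIntegral.integral_nonneg ht0 fun _ _ => Real.smoothTransition.nonneg _

lemma dyG_le {ε t : ℝ} (ht0 : 0 ≤ t) : dyG ε t ≤ t := by
  unfold dyG
  calc _ ≤ ∫ u in (0:ℝ)..t, (1:ℝ) := by
        apply intervalIntegral.integral_mono_on ht0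
          ((dyG_integrand_cont ε).intervalIntegrable _ _) (by simp)
        intro x _
        exact Real.smoothTransition.le_one _
    _ = t := by simp

lemma dyG_ge {ε t : ℝ} (hε : 0 < ε) (ht0 : 0 ≤ t) : t - 2 * ε ≤ dyG ε t := by
  rcases le_total t (2 * ε) with h | h
  · have := dyG_nonneg (ε := ε) ht0; linarith
  · have h0 := dyG_nonneg (ε := ε) (t := 2 * ε) (by positivity)
    have : dyG ε t = dyG ε (2 * ε) + ∫ u in (2 * ε)..t, Real.smoothTransition (u / ε - 1) := by
      unfold dyG
      rw [intervalIntegral.integral_add_adjacent_intervals] <;>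
        exact (dyG_integrand_cont ε).intervalIntegrable _ _
    rw [this, intervalIntegral.integral_congr (g := fun _ => (1:ℝ))]
    · simp; linarith
    · intro u hu
      rw [uIcc_of_le h] at hu
      have : 2 ≤ u / ε := by rw [le_div_iff₀ hε]; exact hu.1
      exact Real.smoothTransition.one_of_one_le (by linarith)

lemma dyH_contDiff {β ε : ℝ} (hβ : 0 < β) (hε : 0 < ε) : ContDiff ℝ (⊤ : ℕ∞) (dyH β ε) := by
  rw [contDiff_iff_contDiffAt]
  intro v
  by_cases hv : dyR v = 0
  · have h0 : dyT β v < ε := by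
      simp only [dyT, hv, zero_div]
      rw [Real.zero_rpow (by positivity)]; exact hε
    have : dyH β ε =ᶠ[𝓝 v] fun _ => (0:ℝ) := by
      filter_upwards [(dyT_continuous hβ).continuousAt.eventually_lt
        (continuousAt_const (y := ε)) h0] with w hw
      exact dyG_zero hε (dyT_nonneg β w) hw.le
    exact contDiffAt_const.congr_of_eventuallyEq this
  · refine (dyG_contDiff ε).contDiffAt.comp v ?_
    unfold dyT
    apply ContDiffAt.rpow_const_of_ne
    · unfold dyR; fun_prop
    · simpa using hv

lemma dyF_contDiff {β ε : ℝ} (hβ : 0 < β) (hε : 0 < ε) : ContDiff ℝ (⊤ : ℕ∞) (dyF β ε) :=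
  (dyH_contDiff hβ hε).pow 2

/-- radial coefficient of the gradient -/
def dyq (β ε : ℝ) (v : Plane) : ℝ :=
  β * dyG ε (dyT β v) * Real.smoothTransition (dyT β v / ε - 1) * dyT β v / dyR v

lemma dyF_hasLine {β ε : ℝ} (hβ : 0 < β) (hε : 0 < ε) (v w : Plane) :
    HasDerivAt (fun s : ℝ => dyF β ε (v + s • w)) (dyq β ε v * (v.1 * w.1 + v.2 * w.2)) 0 := by
  by_cases hv : dyR v = 0
  · have h0 : dyT β (v + (0:ℝ) • w) < ε := by
      simp only [dyT, hv, zero_div, zero_smul, add_zero]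
      rw [Real.zero_rpow (by positivity)]; exact hε
    have hc : Continuous fun s : ℝ => dyT β (v + s • w) :=
      (dyT_continuous hβ).comp (by fun_prop)
    have : (fun s : ℝ => dyF β ε (v + s • w)) =ᶠ[𝓝 0] fun _ => (0:ℝ) := by
      filter_upwards [hc.continuousAt.eventually_lt (continuousAt_const (y := ε)) h0] with s hs
      simp [dyF, dyH, dyG_zero hε (dyT_nonneg β _) hs.le]
    have hq : dyq β ε v = 0 := by simp [dyq, hv]
    rw [hq, zero_mul]
    exact (hasDerivAt_const (0:ℝ) (0:ℝ)).congr_of_eventuallyEq this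
  · have hpos : 0 < dyR v := lt_of_le_of_ne (dyR_nonneg v) (Ne.symm hv)
    have hR : HasDerivAt (fun s : ℝ => dyR (v + s • w) / 2) (v.1 * w.1 + v.2 * w.2) 0 := by
      have h1 : HasDerivAt (fun s : ℝ => (v.1 + s * w.1)) (w.1) 0 := by
        simpa using ((hasDerivAt_id (0:ℝ)).mul_const w.1).const_add v.1
      have h2 : HasDerivAt (fun s : ℝ => (v.2 + s * w.2)) (w.2) 0 := by
        simpa using ((hasDerivAt_id (0:ℝ)).mul_const w.2).const_add v.2
      have := ((h1.pow 2).add (h2.pow 2)).div_const 2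
      refine HasDerivAt.congr_deriv (f := fun s : ℝ => dyR (v + s • w) / 2) this ?_
      simp; ring
    have hT : HasDerivAt (fun s : ℝ => dyT β (v + s • w))
        ((v.1 * w.1 + v.2 * w.2) * (β / 4) * (dyR v / 2) ^ (β / 4 - 1)) 0 := by
      have := hR.rpow_const (p := β / 4) (Or.inl (by simpa using hv))
      simpa [dyT] using this
    have hG := ((dyG_hasDerivAt ε (dyT β (v + (0:ℝ) • w))).comp (0:ℝ) hT).pow 2
    refine HasDerivAt.congr_deriv (f := fun s : ℝ => dyF β ε (v + s • w)) hG ?_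
    simp only [zero_smul, add_zero, dyq, Function.comp]
    rw [Real.rpow_sub_one (by positivity)]
    simp [dyT]
    field_simp
    ring

lemma dyq_nonneg {β ε : ℝ} (hβ : 0 < β) (v : Plane) : 0 ≤ dyq β ε v := by
  unfold dyq
  have := dyG_nonneg (ε := ε) (dyT_nonneg β v)
  have := dyT_nonneg β v
  have := dyR_nonneg v
  have := Real.smoothTransition.nonneg (dyT β v / ε - 1)
  positivity

lemma dyq_le {β ε : ℝ} (hβ : 0 < β) (v : Plane) : dyq β ε v * √(dyR v) ≤ β * dyg β v := by
  have h1 := dyG_nonneg (ε := ε) (dyT_nonneg β v)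
  have h2 := dyT_nonneg β v
  have h3 := dyG_le (ε := ε) (dyT_nonneg β v)
  have h4 := Real.smoothTransition.le_one (dyT β v / ε - 1)
  have h4' := Real.smoothTransition.nonneg (dyT β v / ε - 1)
  rcases (dyR_nonneg v).eq_or_lt with h5 | h5
  · simp [dyg, ← h5]
  · have e : dyq β ε v * √(dyR v) =
      β * (dyG ε (dyT β v) * Real.smoothTransition (dyT β v / ε - 1) * dyT β v) / √(dyR v) := by
      unfold dyq
      have : dyR v = √(dyR v) * √(dyR v) := (Real.mul_self_sqrt h5.le).symm
      have h6 : 0 < √(dyR v) := Real.sqrt_pos.2 h5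
      rw [div_mul_eq_mul_div, div_eq_div_iff h5.ne' h6.ne']
      nth_rw 3 [this]; ring
    rw [e, dyg, ← mul_div_assoc]
    gcongr
    calc _ ≤ dyT β v * 1 * dyT β v := by gcongr
      _ = _ := by ring

lemma dyF_nonneg (β ε : ℝ) (v : Plane) : 0 ≤ dyF β ε v := sq_nonneg _

lemma dyF_le (β ε : ℝ) (v : Plane) : dyF β ε v ≤ dyT β v ^ 2 := by
  have h1 := dyG_nonneg (ε := ε) (dyT_nonneg β v)
  have h3 := dyG_le (ε := ε) (dyT_nonneg β v)
  unfold dyF dyH; gcongr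

lemma dyT_le_one {β : ℝ} (hβ : 0 < β) {v : Plane} (hv : dyR v ≤ 2) : dyT β v ≤ 1 :=
  Real.rpow_le_one (div_nonneg (dyR_nonneg v) (by norm_num)) (by linarith) (by positivity)

lemma dyF_le_one {β : ℝ} (hβ : 0 < β) (ε : ℝ) {v : Plane} (hv : dyR v ≤ 2) : dyF β ε v ≤ 1 :=
  (dyF_le β ε v).trans (pow_le_one₀ (dyT_nonneg β v) (dyT_le_one hβ hv))

lemma dyF_def_le {β ε : ℝ} (hβ : 0 < β) (hε : 0 < ε) {v : Plane} (hv : dyR v ≤ 2) :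
    1 - dyF β ε v ^ 2 ≤ (1 - (dyR v / 2) ^ β) + 8 * ε := by
  have h0 := dyT_nonneg β v
  have h1 := dyG_nonneg (ε := ε) h0
  have h2 := dyT_le_one hβ hv
  have h3 := dyG_le (ε := ε) h0
  have h4 := dyG_ge hε h0
  have e : (dyR v / 2) ^ β = dyT β v ^ 4 := by
    unfold dyT
    rw [← Real.rpow_natCast, ← Real.rpow_mul (div_nonneg (dyR_nonneg v) (by norm_num))]
    congr 1; push_cast; ring
  rw [e]; unfold dyF dyH
  set a := dyT β v
  set b := dyG ε a
  have : a ^ 4 - b ^ 4 = (a - b) * ((a + b) * (a ^ 2 + b ^ 2)) := by ring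
  have h5 : (a + b) * (a ^ 2 + b ^ 2) ≤ 2 * 2 := by
    have : a ^ 2 ≤ 1 := pow_le_one₀ h0 h2
    have : b ^ 2 ≤ 1 := pow_le_one₀ h1 (h3.trans h2)
    gcongr <;> linarith
  have h6 : (a - b) * ((a + b) * (a ^ 2 + b ^ 2)) ≤ (2 * ε) * (2 * 2) := by
    gcongr; linarith
  nlinarith

lemma dyR_Q0 {x y : Plane} (hx : x ∈ Q0) (hy : y ∈ Q0) : dyR (x - y) < 2 := by
  obtain ⟨⟨a, b⟩, c, d⟩ := hx
  obtain ⟨⟨a', b'⟩, c', d'⟩ := hy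
  simp only [dyR, Prod.fst_sub, Prod.snd_sub]
  have : (x.1 - y.1) ^ 2 < 1 := by rw [sq_lt_one_iff_abs_lt_one, abs_lt]; constructor <;> linarith
  have : (x.2 - y.2) ^ 2 < 1 := by rw [sq_lt_one_iff_abs_lt_one, abs_lt]; constructor <;> linarith
  linarith

lemma dy_polar (φ : ℝ → ENNReal) (hφ : Measurable φ) :
    ∫⁻ v : Plane, φ (dyR v) = ENNReal.ofReal (2 * π) *
      ∫⁻ r in Set.Ioi (0:ℝ), ENNReal.ofReal r * φ (r ^ 2) := by
  rw [← lintegral_comp_polarCoord_symm (fun v => φ (dyR v))]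
  have e : ∀ p : ℝ × ℝ, dyR (polarCoord.symm p) = p.1 ^ 2 := by
    intro p
    simp only [dyR, polarCoord_symm_apply]
    nlinarith [Real.sin_sq_add_cos_sq p.2]
  simp only [e, smul_eq_mul]
  have ht : polarCoord.target = Set.Ioi (0:ℝ) ×ˢ Set.Ioo (-π) π := rfl
  rw [ht, Measure.volume_eq_prod, ← Measure.prod_restrict, lintegral_prod]
  · simp only [lintegral_const, Measure.restrict_apply MeasurableSet.univ, Set.univ_inter,
      Real.volume_Ioo]
    rw [lintegral_mul_const, mul_comm]
    · congr 2; ring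
    · fun_prop
  · fun_prop

lemma dy_translate (y : Plane) (hy : y ∈ Q0) (φ : ℝ → ENNReal) :
    ∫⁻ x in Q0, φ (dyR (x - y)) ≤ ∫⁻ v : Plane, (Set.Iio 2).indicator φ (dyR v) := by
  rw [← lintegral_sub_right_eq_self (μ := (volume : Measure Plane))
    (fun v => (Set.Iio (2:ℝ)).indicator φ (dyR v)) y]
  refine (setLIntegral_mono' ?_ ?_).trans (setLIntegral_le_lintegral Q0 _)
  · exact measurableSet_Ioo.prod measurableSet_Ioo
  · intro x hx
    rw [Set.indicator_of_mem]
    exact dyR_Q0 hx hy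

/-- Conclusion: reduce to a one-dimensional integral. -/
lemma dy_radial (y : Plane) (hy : y ∈ Q0) (φ : ℝ → ℝ) (hφ : Measurable φ) (ψ : ℝ → ℝ)
    (h : ∀ r ∈ Set.Ioo (0:ℝ) √2, r * φ (r ^ 2) = ψ r)
    (hnn : ∀ r ∈ Set.Ioo (0:ℝ) √2, 0 ≤ ψ r)
    (hInt : IntervalIntegrable ψ volume 0 √2) :
    ∫⁻ x in Q0, ENNReal.ofReal (φ (dyR (x - y))) ≤
      ENNReal.ofReal (2 * π * ∫ r in (0:ℝ)..√2, ψ r) := by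
  refine (dy_translate y hy (fun s => ENNReal.ofReal (φ s))).trans ?_
  rw [dy_polar _ ((by fun_prop : Measurable fun s => ENNReal.ofReal (φ s)).indicator
    measurableSet_Iio), ENNReal.ofReal_mul (p := 2 * π) (by positivity)]
  gcongr
  rw [intervalIntegral.integral_of_le (by positivity), integral_Ioc_eq_integral_Ioo]
  rw [intervalIntegrable_iff_integrableOn_Ioo_of_le (by positivity)] at hInt
  rw [ofReal_integral_eq_lintegral_ofReal hInt
    (by filter_upwards [ae_restrict_mem measurableSet_Ioo] with r hr using hnn r hr)]
  rw [← lintegral_indicator measurableSet_Ioi, ← lintegral_indicator measurableSet_Ioo]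
  apply lintegral_mono
  intro r
  by_cases h0 : 0 < r
  · rw [Set.indicator_of_mem (show r ∈ Set.Ioi (0:ℝ) from h0)]
    by_cases h2 : r ^ 2 < 2
    · have hr : r ∈ Set.Ioo (0:ℝ) √2 := ⟨h0, Real.lt_sqrt_of_sq_lt h2⟩
      rw [Set.indicator_of_mem (show r ^ 2 ∈ Set.Iio (2:ℝ) from h2), Set.indicator_of_mem hr,
        ← ENNReal.ofReal_mul h0.le, h r hr]
    · rw [Set.indicator_of_notMem (show r ^ 2 ∉ Set.Iio (2:ℝ) from h2)]
      simp
  · rw [Set.indicator_of_notMem (show r ∉ Set.Ioi (0:ℝ) from h0)]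
    exact bot_le

lemma dy_Q0_meas : MeasurableSet Q0 := measurableSet_Ioo.prod measurableSet_Ioo

lemma dy_vol_Q0 : (volume : Measure Plane) Q0 = 1 := by
  rw [Q0, Measure.volume_eq_prod, Measure.prod_prod]; simp

lemma dy_sqrt2_rpow (c : ℝ) : (√2 : ℝ) ^ (2 * c) = 2 ^ c := by
  rw [Real.rpow_mul (by positivity)]; norm_num

lemma dy_I1 {β : ℝ} (hβ : 0 < β) (y : Plane) (hy : y ∈ Q0) :
    ∫⁻ x in Q0, ENNReal.ofReal (dyg β (x - y) ^ 2) ≤ ENNReal.ofReal (π / β) := by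
  have key := dy_radial y hy (fun s => (s / 2) ^ β / s) (by fun_prop)
    (fun r => (2:ℝ)⁻¹ ^ β * r ^ (2 * β - 1)) ?_ ?_ ?_
  · refine le_trans (le_of_eq ?_) (key.trans (le_of_eq ?_))
    · congr 1; ext x; congr 1
      unfold dyg
      rw [div_pow, Real.sq_sqrt (dyR_nonneg _), ← pow_mul, dyT, ← Real.rpow_natCast,
        ← Real.rpow_mul (div_nonneg (dyR_nonneg _) (by norm_num))]
      congr 2; push_cast; ring
    · rw [intervalIntegral.integral_const_mul, integral_rpow (Or.inl (by linarith))]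
      rw [sub_add_cancel, dy_sqrt2_rpow, Real.zero_rpow (by positivity), sub_zero,
        Real.inv_rpow (by norm_num)]
      congr 1
      have : (0:ℝ) < 2 ^ β := by positivity
      field_simp
  · intro r hr
    have h0 : 0 < r := hr.1
    rw [div_eq_mul_inv (r ^ 2), Real.mul_rpow (by positivity) (by positivity),
      Real.rpow_sub_one h0.ne', Real.rpow_mul h0.le]
    norm_num
    field_simp
  · intro r hr
    have h0 : 0 < r := hr.1
    positivity
  · exact (intervalIntegral.intervalIntegrable_rpow' (by linarith)).const_mul _

lemma dy_I2 {β : ℝ} (hβ : 0 < β) (y : Plane) (hy : y ∈ Q0) :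
    ∫⁻ x in Q0, ENNReal.ofReal (dyg β (x - y)) ≤ ENNReal.ofReal (2 * π + 1) := by
  have key : ∫⁻ x in Q0, ENNReal.ofReal ((Set.Iio (1:ℝ)).indicator (fun s => 1 / √s) (dyR (x - y)))
      ≤ ENNReal.ofReal (2 * π) := by
    refine (dy_translate y hy (fun s =>
      ENNReal.ofReal ((Set.Iio (1:ℝ)).indicator (fun s => 1 / √s) s))).trans ?_
    have hm : Measurable ((Set.Iio (1:ℝ)).indicator (fun s => 1 / √s)) :=
      (by fun_prop : Measurable fun s : ℝ => 1 / √s).indicator measurableSet_Iio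
    rw [dy_polar _ (hm.ennreal_ofReal.indicator measurableSet_Iio)]
    conv_rhs => rw [← mul_one (ENNReal.ofReal (2 * π))]
    gcongr
    have : (1 : ENNReal) = ∫⁻ r, (Set.Ioo (0:ℝ) 1).indicator (fun _ => (1:ENNReal)) r := by
      rw [lintegral_indicator measurableSet_Ioo]; simp
    rw [this, ← lintegral_indicator measurableSet_Ioi]
    apply lintegral_mono
    intro r
    by_cases h0 : 0 < r
    · rw [Set.indicator_of_mem (show r ∈ Set.Ioi (0:ℝ) from h0)]
      by_cases h1 : r ^ 2 < 1
      · have hr : r ∈ Set.Ioo (0:ℝ) 1 := ⟨h0, by nlinarith⟩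
        rw [Set.indicator_of_mem hr, Set.indicator_of_mem (show r ^ 2 ∈ Set.Iio (2:ℝ) by
          simp only [Set.mem_Iio]; linarith),
          Set.indicator_of_mem (show r ^ 2 ∈ Set.Iio (1:ℝ) from h1),
          ← ENNReal.ofReal_mul h0.le, Real.sqrt_sq h0.le, mul_one_div_cancel h0.ne']
        simp
      · have : (Set.Iio (2:ℝ)).indicator (fun s =>
          ENNReal.ofReal ((Set.Iio (1:ℝ)).indicator (fun s => 1 / √s) s)) (r ^ 2) = 0 := by
          simp only [Set.indicator, Set.mem_Iio, h1]; simp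
        rw [this]; simp
    · rw [Set.indicator_of_notMem (show r ∉ Set.Ioi (0:ℝ) from h0)]
      exact bot_le
  calc _ ≤ ∫⁻ x in Q0, (ENNReal.ofReal ((Set.Iio (1:ℝ)).indicator (fun s => 1 / √s)
          (dyR (x - y))) + 1) := by
        refine setLIntegral_mono' dy_Q0_meas ?_
        intro x hx
        have h2 := (dyR_Q0 hx hy).le
        have hT := pow_le_one₀ (n := 2) (dyT_nonneg β (x - y)) (dyT_le_one hβ h2)
        have hR := dyR_nonneg (x - y)
        by_cases h1 : dyR (x - y) < 1
        · refine le_trans ?_ le_self_add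
          apply ENNReal.ofReal_le_ofReal
          rw [Set.indicator_of_mem (show dyR (x - y) ∈ Set.Iio (1:ℝ) from h1)]
          unfold dyg; gcongr
        · refine le_trans ?_ le_add_self
          rw [ENNReal.ofReal_le_one]
          unfold dyg
          have : 1 ≤ √(dyR (x - y)) := by rw [Real.one_le_sqrt]; linarith
          exact div_le_one_of_le₀ (hT.trans this) (by positivity)
    _ ≤ _ := by
        rw [lintegral_add_right _ measurable_const, ENNReal.ofReal_add (by positivity) (by norm_num)]
        gcongr
        simp [dy_vol_Q0]

lemma dy_I3 {β ε : ℝ} (hβ : 0 < β) (hε : 0 < ε) (hε2 : 8 * ε ≤ 2 * π * (β - β / (1 + β)))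
    (y : Plane) (hy : y ∈ Q0) :
    ∫⁻ x in Q0, ENNReal.ofReal (1 - dyF β ε (x - y) ^ 2) ≤ ENNReal.ofReal (2 * π * β) := by
  have key := dy_radial y hy (fun s => 1 - (s / 2) ^ β) (by fun_prop)
    (fun r => r - (2:ℝ)⁻¹ ^ β * r ^ (2 * β + 1)) ?_ ?_ ?_
  · have e : ∫ r in (0:ℝ)..√2, (r - (2:ℝ)⁻¹ ^ β * r ^ (2 * β + 1)) = β / (1 + β) := by
      rw [intervalIntegral.integral_sub (by simp)
        ((intervalIntegral.intervalIntegrable_rpow' (by linarith)).const_mul _),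
        intervalIntegral.integral_const_mul, integral_rpow (Or.inl (by linarith)), integral_id]
      rw [show 2 * β + 1 + 1 = 2 * (β + 1) by ring, dy_sqrt2_rpow,
        Real.zero_rpow (by positivity), sub_zero,
        Real.inv_rpow (by norm_num), Real.rpow_add_one (by norm_num)]
      have : (0:ℝ) < 2 ^ β := by positivity
      norm_num
      field_simp
      ring
    rw [e] at key
    calc _ ≤ ∫⁻ x in Q0, (ENNReal.ofReal (1 - (dyR (x - y) / 2) ^ β) + ENNReal.ofReal (8 * ε)) := by
          refine setLIntegral_mono' dy_Q0_meas ?_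
          intro x hx
          exact (ENNReal.ofReal_le_ofReal (dyF_def_le hβ hε (dyR_Q0 hx hy).le)).trans
            ENNReal.ofReal_add_le
      _ ≤ ENNReal.ofReal (2 * π * (β / (1 + β))) + ENNReal.ofReal (8 * ε) := by
          rw [lintegral_add_right _ measurable_const]
          gcongr
          simp [dy_vol_Q0]
      _ ≤ _ := by
          rw [← ENNReal.ofReal_add (by positivity) (by positivity)]
          apply ENNReal.ofReal_le_ofReal
          linarith
  · intro r hr
    have h0 : 0 < r := hr.1
    rw [div_eq_mul_inv (r ^ 2), Real.mul_rpow (by positivity) (by positivity),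
      Real.rpow_add_one h0.ne', Real.rpow_mul h0.le]
    norm_num
    ring
  · intro r hr
    have h0 : 0 < r := hr.1
    have h2 : r ^ 2 ≤ 2 := by
      have := hr.2
      have h3 := Real.sq_sqrt (show (0:ℝ) ≤ 2 by norm_num)
      nlinarith [Real.sqrt_nonneg 2]
    have : (2:ℝ)⁻¹ ^ β * r ^ (2 * β) ≤ 1 := by
      rw [Real.rpow_mul h0.le, ← Real.mul_rpow (by positivity) (by positivity)]
      apply Real.rpow_le_one (by positivity) _ hβ.le
      norm_num; linarith
    rw [Real.rpow_add_one h0.ne', ← mul_assoc]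
    nlinarith
  · exact intervalIntegral.intervalIntegrable_id.sub
      ((intervalIntegral.intervalIntegrable_rpow' (by linarith)).const_mul _)

/-- Lebesgue measure on the unit cube of configurations -/
def dyMu (n : ℕ) : Measure (Config n) := volume.restrict (cube n Q0)

lemma dyMu_eq (n : ℕ) :
    dyMu n = Measure.pi (fun _ : Fin n => (volume : Measure Plane).restrict Q0) := by
  unfold dyMu cube
  rw [volume_pi, Measure.restrict_pi_pi]

lemma dy_cube_meas (n : ℕ) : MeasurableSet (cube n Q0) :=
  MeasurableSet.univ_pi fun _ => dy_Q0_meas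

lemma dyMu_ae (n : ℕ) : ∀ᵐ y ∂dyMu n, ∀ k, y k ∈ Q0 := by
  unfold dyMu
  filter_upwards [ae_restrict_mem (dy_cube_meas n)] with y hy k
  exact hy k (Set.mem_univ k)

lemma dyMu_univ (n : ℕ) : dyMu n Set.univ = 1 := by
  rw [dyMu_eq, Measure.pi_univ]; simp [dy_vol_Q0]

lemma dy_fubini {n : ℕ} (j : Fin (n + 1)) (F : Config (n + 1) → ENNReal) (hF : Measurable F) :
    ∫⁻ x, F x ∂dyMu (n + 1) = ∫⁻ y, (∫⁻ a in Q0, F (j.insertNth a y)) ∂dyMu n := by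
  rw [dyMu_eq, dyMu_eq]
  have h := measurePreserving_piFinSuccAbove
    (fun _ : Fin (n + 1) => (volume : Measure Plane).restrict Q0) j
  have h2 := (h.symm _).lintegral_comp hF
  rw [← h2, lintegral_prod_symm]
  · rfl
  · exact (hF.comp (MeasurableEquiv.measurable _)).aemeasurable

lemma dyPhi_contDiff {β ε : ℝ} (hβ : 0 < β) (hε : 0 < ε) (n : ℕ) :
    ContDiff ℝ (⊤ : ℕ∞) (dyPhi β ε n) := by
  unfold dyPhi
  refine contDiff_prod fun i _ => contDiff_prod fun j _ => ?_
  by_cases h : i = j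
  · simp only [h, if_true]; exact contDiff_const
  · simp only [h, if_false]
    exact (dyH_contDiff hβ hε).comp (by fun_prop)

lemma dyPhi_meas {β ε : ℝ} (hβ : 0 < β) (hε : 0 < ε) (n : ℕ) : Measurable (dyPhi β ε n) :=
  (dyPhi_contDiff hβ hε n).continuous.measurable

lemma dyPhi_symm (β ε : ℝ) (n : ℕ) (σ : Equiv.Perm (Fin n)) (x : Config n) :
    dyPhi β ε n (x ∘ σ) = dyPhi β ε n x := by
  unfold dyPhi
  rw [← Equiv.prod_comp σ (fun i => ∏ j, if i = j then 1 else dyH β ε (x i - x j))]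
  refine Finset.prod_congr rfl fun i _ => ?_
  rw [← Equiv.prod_comp σ (fun j => if σ i = j then 1 else dyH β ε (x (σ i) - x j))]
  refine Finset.prod_congr rfl fun j _ => ?_
  simp

lemma dyPhi_peel (β ε : ℝ) {n : ℕ} (j : Fin (n + 1)) (a : Plane) (y : Config n) :
    dyPhi β ε (n + 1) (j.insertNth a y) = dyPhi β ε n y * ∏ k, dyF β ε (a - y k) := by
  unfold dyPhi
  rw [Fin.prod_univ_succAbove _ j, Fin.prod_univ_succAbove _ j]
  simp only [if_true, Fin.insertNth_apply_same, Fin.insertNth_apply_succAbove, one_mul]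
  have e1 : ∀ i : Fin n, (∏ l : Fin (n + 1), if j.succAbove i = l then (1:ℝ)
      else dyH β ε (y i - j.insertNth (α := fun _ => Plane) a y l)) =
      dyH β ε (a - y i) * ∏ l, if i = l then 1 else dyH β ε (y i - y l) := by
    intro i
    rw [Fin.prod_univ_succAbove _ j]
    simp [Fin.succAbove_ne, dyH_sub β ε a (y i)]
  simp only [e1, Finset.prod_mul_distrib, dyF]
  simp [Fin.ne_succAbove, Finset.prod_pow]
  ring

/-- squared norms -/
def dyZ (β ε : ℝ) (n : ℕ) : ENNReal := ∫⁻ y, ENNReal.ofReal (dyPhi β ε n y ^ 2) ∂dyMu n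

lemma dy_one_le {ι : Type*} (s : Finset ι) (c : ι → ℝ) (h0 : ∀ k ∈ s, 0 ≤ c k)
    (h1 : ∀ k ∈ s, c k ≤ 1) : 1 ≤ ∏ k ∈ s, c k + ∑ k ∈ s, (1 - c k) := by
  classical
  induction s using Finset.induction_on with
  | empty => simp
  | insert a s ha ih =>
    rw [Finset.prod_insert ha, Finset.sum_insert ha]
    have ih' := ih (fun k hk => h0 k (Finset.mem_insert_of_mem hk))
      (fun k hk => h1 k (Finset.mem_insert_of_mem hk))
    have hp : ∏ k ∈ s, c k ≤ 1 := Finset.prod_le_one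
      (fun k hk => h0 k (Finset.mem_insert_of_mem hk))
      (fun k hk => h1 k (Finset.mem_insert_of_mem hk))
    have := h1 a (Finset.mem_insert_self _ _)
    nlinarith

lemma dyZ_step {β ε : ℝ} (hβ : 0 < β) (hε : 0 < ε) (hε2 : 8 * ε ≤ 2 * π * (β - β / (1 + β)))
    (n : ℕ) : dyZ β ε n ≤ dyZ β ε (n + 1) + n * ENNReal.ofReal (2 * π * β) * dyZ β ε n := by
  have hP := dyPhi_meas hβ hε
  have hF : Measurable (dyF β ε) := (dyF_contDiff hβ hε).continuous.measurable
  have key : ∀ᵐ y ∂dyMu n, ENNReal.ofReal (dyPhi β ε n y ^ 2) ≤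
      (∫⁻ a in Q0, ENNReal.ofReal (dyPhi β ε (n + 1) ((0 : Fin (n + 1)).insertNth a y) ^ 2)) +
      n * ENNReal.ofReal (2 * π * β) * ENNReal.ofReal (dyPhi β ε n y ^ 2) := by
    filter_upwards [dyMu_ae n] with y hy
    calc ENNReal.ofReal (dyPhi β ε n y ^ 2)
        = ∫⁻ a in Q0, ENNReal.ofReal (dyPhi β ε n y ^ 2) := by simp [dy_vol_Q0]
      _ ≤ ∫⁻ a in Q0, (ENNReal.ofReal (dyPhi β ε n y ^ 2) *
            (∑ k, ENNReal.ofReal (1 - dyF β ε (a - y k) ^ 2)) +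
            ENNReal.ofReal (dyPhi β ε (n + 1) ((0 : Fin (n + 1)).insertNth a y) ^ 2)) := by
          refine setLIntegral_mono' dy_Q0_meas ?_
          intro a ha
          have hc : ∀ k, dyF β ε (a - y k) ^ 2 ≤ 1 := fun k =>
            pow_le_one₀ (dyF_nonneg _ _ _) (dyF_le_one hβ ε (dyR_Q0 ha (hy k)).le)
          rw [← ENNReal.ofReal_sum_of_nonneg (fun k _ => by linarith [hc k]),
            ← ENNReal.ofReal_mul (by positivity), ← ENNReal.ofReal_add
              (mul_nonneg (by positivity) (Finset.sum_nonneg fun k _ => by linarith [hc k]))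
              (by positivity)]
          apply ENNReal.ofReal_le_ofReal
          rw [dyPhi_peel, mul_pow, ← Finset.prod_pow, ← mul_add]
          apply le_mul_of_one_le_right (by positivity)
          rw [add_comm]
          exact dy_one_le _ _ (fun k _ => by positivity) (fun k _ => hc k)
      _ ≤ _ := by
          rw [lintegral_add_left (by fun_prop), lintegral_const_mul _ (by fun_prop),
            lintegral_finsetSum _ (fun k _ => by fun_prop), add_comm]
          refine add_le_add le_rfl ?_
          rw [mul_comm]
          refine mul_le_mul_left ?_ _
          calc _ ≤ ∑ k : Fin n, ENNReal.ofReal (2 * π * β) :=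
                Finset.sum_le_sum fun k _ => dy_I3 hβ hε hε2 (y k) (hy k)
            _ = _ := by simp
  have hm : Measurable fun x => ENNReal.ofReal (dyPhi β ε (n + 1) x ^ 2) := by
    have := hP (n + 1); fun_prop
  have hm0 : Measurable fun x => ENNReal.ofReal (dyPhi β ε n x ^ 2) := by
    have := hP n; fun_prop
  calc dyZ β ε n ≤ _ := lintegral_mono_ae key
    _ = _ := by
      rw [lintegral_add_right _ (hm0.const_mul _), lintegral_const_mul _ hm0]
      unfold dyZ
      rw [dy_fubini 0 _ hm]

lemma dyPhi_nonneg (β ε : ℝ) (n : ℕ) (x : Config n) : 0 ≤ dyPhi β ε n x := by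
  unfold dyPhi
  refine Finset.prod_nonneg fun i _ => Finset.prod_nonneg fun j _ => ?_
  split_ifs
  · norm_num
  · exact dyG_nonneg (dyT_nonneg _ _)

lemma dyPhi_le_one {β : ℝ} (hβ : 0 < β) (ε : ℝ) (n : ℕ) (x : Config n) (hx : ∀ k, x k ∈ Q0) :
    dyPhi β ε n x ≤ 1 := by
  have hnn : ∀ v, 0 ≤ dyH β ε v := fun v => dyG_nonneg (dyT_nonneg _ _)
  unfold dyPhi
  refine Finset.prod_le_one (fun i _ => Finset.prod_nonneg fun j _ => ?_)
    fun i _ => Finset.prod_le_one (fun j _ => ?_) fun j _ => ?_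
  · split_ifs
    · norm_num
    · exact hnn _
  · split_ifs
    · norm_num
    · exact hnn _
  · split_ifs
    · norm_num
    · exact (dyG_le (dyT_nonneg _ _)).trans (dyT_le_one hβ (dyR_Q0 (hx i) (hx j)).le)

lemma dyZ_le_one {β : ℝ} (hβ : 0 < β) (ε : ℝ) (n : ℕ) : dyZ β ε n ≤ 1 := by
  rw [← dyMu_univ n, ← lintegral_one]
  refine lintegral_mono_ae ?_
  filter_upwards [dyMu_ae n] with y hy
  rw [ENNReal.ofReal_le_one]
  exact pow_le_one₀ (dyPhi_nonneg _ _ _ _) (dyPhi_le_one hβ ε n y hy)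

lemma dyZ_zero (β ε : ℝ) : dyZ β ε 0 = 1 := by
  have : ∀ y : Config 0, dyPhi β ε 0 y = 1 := fun y => by simp [dyPhi]
  simp [dyZ, this, dyMu_univ]

/-- two-body overlap -/
def dyJ (β : ℝ) (b c : Plane) : ENNReal :=
  ∫⁻ a in Q0, ENNReal.ofReal (dyg β (a - b)) * ENNReal.ofReal (dyg β (a - c))

lemma dyJ_meas {β : ℝ} (hβ : 0 < β) : Measurable fun p : Plane × Plane => dyJ β p.1 p.2 := by
  have := dyg_measurable hβ
  unfold dyJ
  apply Measurable.lintegral_prod_right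
  fun_prop

lemma dyJ_diag {β : ℝ} (hβ : 0 < β) (b : Plane) (hb : b ∈ Q0) :
    dyJ β b b ≤ ENNReal.ofReal (π / β) := by
  refine le_trans (le_of_eq ?_) (dy_I1 hβ b hb)
  unfold dyJ
  congr 1; ext a
  rw [← ENNReal.ofReal_mul (dyg_nonneg _ _), sq]

lemma dyJ_int {β : ℝ} (hβ : 0 < β) (c : Plane) (hc : c ∈ Q0) :
    ∫⁻ b in Q0, dyJ β b c ≤ ENNReal.ofReal (2 * π + 1) ^ 2 := by
  have hg := dyg_measurable hβ
  unfold dyJ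
  rw [lintegral_lintegral_swap (by fun_prop)]
  calc _ ≤ ∫⁻ a in Q0, ENNReal.ofReal (2 * π + 1) * ENNReal.ofReal (dyg β (a - c)) := by
        refine setLIntegral_mono' dy_Q0_meas ?_
        intro a ha
        rw [lintegral_mul_const _ (by fun_prop)]
        gcongr
        have := dy_I2 hβ a ha
        simpa only [dyg_sub β _ a] using this
    _ ≤ _ := by
        rw [lintegral_const_mul _ (by fun_prop), sq]
        gcongr
        exact dy_I2 hβ c hc

lemma dyJ_meas2 {β : ℝ} (hβ : 0 < β) {n : ℕ} (k l : Fin n) :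
    Measurable fun y : Config n => dyJ β (y k) (y l) := by
  have h1 : Measurable fun y : Config n => (y k, y l) :=
    (measurable_pi_apply k).prodMk (measurable_pi_apply l)
  have h := Measurable.comp (dyJ_meas hβ) h1
  rw [Function.comp_def] at h
  exact h

lemma dyPhi_meas2 {β ε : ℝ} (hβ : 0 < β) (hε : 0 < ε) (n : ℕ) :
    Measurable fun y : Config n => ENNReal.ofReal (dyPhi β ε n y ^ 2) :=
  ((dyPhi_meas hβ hε n).pow_const 2).ennreal_ofReal

lemma dyPhi_sq_le {β : ℝ} (hβ : 0 < β) (ε : ℝ) {m : ℕ} (k : Fin (m + 1)) (b : Plane) (hb : b ∈ Q0)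
    (z : Config m) (hz : ∀ k, z k ∈ Q0) :
    dyPhi β ε (m + 1) (k.insertNth b z) ^ 2 ≤ dyPhi β ε m z ^ 2 := by
  rw [dyPhi_peel, mul_pow]
  apply mul_le_of_le_one_right (sq_nonneg _)
  apply pow_le_one₀
  · exact Finset.prod_nonneg fun _ _ => dyF_nonneg _ _ _
  · exact Finset.prod_le_one (fun _ _ => dyF_nonneg _ _ _)
      (fun k _ => dyF_le_one hβ ε (dyR_Q0 hb (hz k)).le)

lemma dy_pair_diag {β ε : ℝ} (hβ : 0 < β) (hε : 0 < ε) (n : ℕ) (k : Fin n) :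
    ∫⁻ y, ENNReal.ofReal (dyPhi β ε n y ^ 2) * dyJ β (y k) (y k) ∂dyMu n ≤
      ENNReal.ofReal (π / β) * dyZ β ε n := by
  unfold dyZ
  rw [← lintegral_const_mul _ (dyPhi_meas2 hβ hε n)]
  refine lintegral_mono_ae ?_
  filter_upwards [dyMu_ae n] with y hy
  rw [mul_comm]
  exact mul_le_mul_left (dyJ_diag hβ _ (hy k)) _

lemma dy_pair_off {β ε : ℝ} (hβ : 0 < β) (hε : 0 < ε) (m : ℕ) (k : Fin (m + 1)) (l : Fin m) :
    ∫⁻ y, ENNReal.ofReal (dyPhi β ε (m + 1) y ^ 2) * dyJ β (y k) (y (k.succAbove l))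
      ∂dyMu (m + 1) ≤ ENNReal.ofReal (2 * π + 1) ^ 2 * dyZ β ε m := by
  rw [dy_fubini k (fun y => ENNReal.ofReal (dyPhi β ε (m + 1) y ^ 2) *
    dyJ β (y k) (y (k.succAbove l)))
    ((dyPhi_meas2 hβ hε (m + 1)).mul (dyJ_meas2 hβ k (k.succAbove l)))]
  unfold dyZ
  rw [← lintegral_const_mul _ (dyPhi_meas2 hβ hε m)]
  refine lintegral_mono_ae ?_
  filter_upwards [dyMu_ae m] with z hz
  simp only [Fin.insertNth_apply_same, Fin.insertNth_apply_succAbove]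
  calc _ ≤ ∫⁻ b in Q0, ENNReal.ofReal (dyPhi β ε m z ^ 2) * dyJ β b (z l) := by
        refine setLIntegral_mono' dy_Q0_meas ?_
        intro b hb
        exact mul_le_mul_left (ENNReal.ofReal_le_ofReal (dyPhi_sq_le hβ ε k b hb z hz)) _
    _ ≤ _ := by
        have hmb : Measurable fun b : Plane => dyJ β b (z l) := by
          have h := Measurable.comp (dyJ_meas hβ)
            (measurable_id.prodMk measurable_const : Measurable fun b : Plane => (b, z l))
          rw [Function.comp_def] at h
          exact h
        rw [lintegral_const_mul _ hmb, mul_comm]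
        exact mul_le_mul_left (dyJ_int hβ _ (hz l)) _

lemma dy_pair_bound {β ε : ℝ} (hβ : 0 < β) (hε : 0 < ε) (m : ℕ) :
    ∫⁻ y, ENNReal.ofReal (dyPhi β ε (m + 1) y ^ 2) * ∑ k, ∑ l, dyJ β (y k) (y l) ∂dyMu (m + 1) ≤
    (m + 1 : ℕ) * (ENNReal.ofReal (π / β) * dyZ β ε (m + 1) +
      m * (ENNReal.ofReal (2 * π + 1) ^ 2 * dyZ β ε m)) := by
  have hm : ∀ k l : Fin (m + 1), Measurable fun y : Config (m + 1) =>
      ENNReal.ofReal (dyPhi β ε (m + 1) y ^ 2) * dyJ β (y k) (y l) := fun k l =>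
    (dyPhi_meas2 hβ hε (m + 1)).mul (dyJ_meas2 hβ k l)
  simp only [Finset.mul_sum]
  rw [lintegral_finsetSum _ (fun k _ => Finset.measurable_fun_sum _ fun l _ => hm k l)]
  have hk : ∀ k : Fin (m + 1),
      ∫⁻ y, ∑ l, ENNReal.ofReal (dyPhi β ε (m + 1) y ^ 2) * dyJ β (y k) (y l) ∂dyMu (m + 1) ≤
      ENNReal.ofReal (π / β) * dyZ β ε (m + 1) +
      m * (ENNReal.ofReal (2 * π + 1) ^ 2 * dyZ β ε m) := by
    intro k
    rw [lintegral_finsetSum _ (fun l _ => hm k l), Fin.sum_univ_succAbove _ k]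
    apply add_le_add
    · exact dy_pair_diag hβ hε (m + 1) k
    · refine (Finset.sum_le_sum fun l _ => dy_pair_off hβ hε m k l).trans (le_of_eq ?_)
      rw [Finset.sum_const, Finset.card_univ, Fintype.card_fin, nsmul_eq_mul]
  refine (Finset.sum_le_sum fun k _ => hk k).trans (le_of_eq ?_)
  rw [Finset.sum_const, Finset.card_univ, Fintype.card_fin, nsmul_eq_mul]

/-- complex-valued trial function -/
def dyPsi (β ε : ℝ) (n : ℕ) (x : Config n) : ℂ := ((dyPhi β ε n x : ℝ) : ℂ)

lemma dyPsi_contDiff {β ε : ℝ} (hβ : 0 < β) (hε : 0 < ε) (n : ℕ) :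
    ContDiff ℝ (⊤ : ℕ∞) (dyPsi β ε n) :=
  Complex.ofRealCLM.contDiff.comp (dyPhi_contDiff hβ hε n)

lemma dyPsi_admissible {β ε : ℝ} (hβ : 0 < β) (hε : 0 < ε) (n : ℕ) :
    Admissible n (dyPsi β ε n) where
  smooth := dyPsi_contDiff hβ hε n
  symm σ x := by simp only [dyPsi, dyPhi_symm]
  vanishes := by
    refine ⟨⋃ j : Fin n, ⋃ k : Fin n, ⋃ _ : j ≠ k, {x | dyT β (x j - x k) < ε}, ?_, ?_, ?_⟩
    · refine isOpen_iUnion fun j => isOpen_iUnion fun k => isOpen_iUnion fun _ => ?_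
      exact isOpen_lt ((dyT_continuous hβ).comp (by fun_prop)) continuous_const
    · rintro x ⟨j, k, hjk, h⟩
      simp only [Set.mem_iUnion]
      refine ⟨j, k, hjk, ?_⟩
      simp only [Set.mem_ofPred_eq, h, sub_self, dyT, dyR]
      norm_num
      rw [Real.zero_rpow (by positivity)]; exact hε
    · intro x hx
      simp only [Set.mem_iUnion] at hx
      obtain ⟨j, k, hjk, h⟩ := hx
      have : dyPhi β ε n x = 0 := by
        unfold dyPhi
        refine Finset.prod_eq_zero (Finset.mem_univ j) (Finset.prod_eq_zero (Finset.mem_univ k) ?_)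
        rw [if_neg hjk]
        exact dyG_zero hε (dyT_nonneg _ _) (le_of_lt h)
      simp [dyPsi, this]

lemma dy_insert_line {n : ℕ} (j : Fin (n + 1)) (a v : Plane) (y : Config n) (s : ℝ) :
    (j.insertNth a y : Config (n + 1)) + s • (Pi.single j v : Config (n + 1)) =
      j.insertNth (a + s • v) y := by
  funext i
  rcases Fin.eq_self_or_eq_succAbove j i with h | ⟨l, h⟩
  · subst h; simp
  · subst h; simp [Fin.succAbove_ne]

/-- coefficient of the gradient of the product -/
def dyc (β ε : ℝ) {n : ℕ} (a : Plane) (y : Config n) (k : Fin n) : ℝ :=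
  (∏ l ∈ Finset.univ.erase k, dyF β ε (a - y l)) * dyq β ε (a - y k)

lemma dy_pder {β ε : ℝ} (hβ : 0 < β) (hε : 0 < ε) {n : ℕ} (j : Fin (n + 1)) (a v : Plane)
    (y : Config n) :
    pder (n + 1) j v (dyPsi β ε (n + 1)) (j.insertNth a y) =
      ((dyPhi β ε n y * ∑ k, dyc β ε a y k * ((a - y k).1 * v.1 + (a - y k).2 * v.2) : ℝ) : ℂ) := by
  unfold pder
  have hd : DifferentiableAt ℝ (dyPsi β ε (n + 1)) (j.insertNth a y) :=
    ((dyPsi_contDiff hβ hε (n + 1)).differentiable (by simp)).differentiableAt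
  rw [← hd.lineDeriv_eq_fderiv, lineDeriv]
  simp only [dy_insert_line, dyPsi, dyPhi_peel]
  apply HasDerivAt.deriv
  apply HasDerivAt.ofReal_comp
  apply HasDerivAt.const_mul
  have h : ∀ k ∈ (Finset.univ : Finset (Fin n)),
      HasDerivAt (fun s : ℝ => dyF β ε (a + s • v - y k))
      (dyq β ε (a - y k) * ((a - y k).1 * v.1 + (a - y k).2 * v.2)) 0 := by
    intro k _
    have := dyF_hasLine hβ hε (a - y k) v
    simpa only [sub_add_eq_add_sub] using this
  refine (HasDerivAt.fun_finsetProd h).congr_deriv ?_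
  refine Finset.sum_congr rfl fun k _ => ?_
  simp [dyc, mul_assoc]

lemma dy_abPot {n : ℕ} (j : Fin (n + 1)) (a : Plane) (y : Config n) :
    abPot (n + 1) j (j.insertNth a y) = ∑ k, perpInv (a - y k) := by
  unfold abPot
  have h : ∀ F : Fin (n + 1) → Plane, ∑ k ∈ Finset.univ.erase j, F k = ∑ k, F (j.succAbove k) := by
    intro F
    have := Finset.add_sum_erase Finset.univ F (Finset.mem_univ j)
    rw [Fin.sum_univ_succAbove _ j] at this
    exact add_left_cancel this
  rw [h]
  simp

lemma dy_vec_bound {ι : Type*} (s : Finset ι) (c : ι → ℝ) (v : ι → Plane) (b : ι → ℝ)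
    (h : ∀ k ∈ s, |c k| * √(dyR (v k)) ≤ b k) :
    (∑ k ∈ s, c k * (v k).1) ^ 2 + (∑ k ∈ s, c k * (v k).2) ^ 2 ≤ (∑ k ∈ s, b k) ^ 2 := by
  have e : (∑ k ∈ s, c k * (v k).1) ^ 2 + (∑ k ∈ s, c k * (v k).2) ^ 2 =
      ‖∑ k ∈ s, (⟨c k * (v k).1, c k * (v k).2⟩ : ℂ)‖ ^ 2 := by
    rw [Complex.sq_norm, Complex.normSq_apply]
    simp [sq]
  rw [e]
  gcongr
  refine (norm_sum_le _ _).trans (Finset.sum_le_sum fun k hk => ?_)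
  refine le_trans (le_of_eq ?_) (h k hk)
  rw [Complex.norm_def, Complex.normSq_apply, ← Real.sqrt_sq_eq_abs, ← Real.sqrt_mul (sq_nonneg _)]
  congr 1
  simp only [dyR]; ring

lemma dy_norm_I (a b : ℝ) : ‖-Complex.I * (a : ℂ) + (b : ℂ)‖ ^ 2 = a ^ 2 + b ^ 2 := by
  rw [Complex.sq_norm, Complex.normSq_apply]
  simp; ring

lemma dy_DSq {α β ε : ℝ} (hα : 0 ≤ α) (hαβ : α ≤ β) (hβ : 0 < β) (hε : 0 < ε) {n : ℕ}
    (j : Fin (n + 1)) (a : Plane)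
    (ha : a ∈ Q0) (y : Config n) (hy : ∀ k, y k ∈ Q0) :
    DSq (n + 1) α j (dyPsi β ε (n + 1)) (j.insertNth a y) ≤
      dyPhi β ε n y ^ 2 * (2 * β ^ 2 * (∑ k, dyg β (a - y k)) ^ 2) := by
  have hF1 : ∀ l, dyF β ε (a - y l) ≤ 1 := fun l => dyF_le_one hβ ε (dyR_Q0 ha (hy l)).le
  have hF0 : ∀ l, 0 ≤ dyF β ε (a - y l) := fun l => dyF_nonneg _ _ _
  set P := ∏ k, dyF β ε (a - y k) with hP
  have hPk : ∀ k, P ≤ dyF β ε (a - y k) := by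
    intro k
    rw [hP, ← Finset.mul_prod_erase _ _ (Finset.mem_univ k)]
    exact mul_le_of_le_one_right (hF0 k) (Finset.prod_le_one (fun _ _ => hF0 _) (fun _ _ => hF1 _))
  have hP0 : 0 ≤ P := Finset.prod_nonneg fun _ _ => hF0 _
  have b1 := dy_vec_bound Finset.univ (dyc β ε a y) (fun k => a - y k)
    (fun k => β * dyg β (a - y k)) (by
      intro k _
      have h1 : ∏ l ∈ Finset.univ.erase k, dyF β ε (a - y l) ≤ 1 :=
        Finset.prod_le_one (fun _ _ => hF0 _) (fun _ _ => hF1 _)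
      have h0 : 0 ≤ ∏ l ∈ Finset.univ.erase k, dyF β ε (a - y l) :=
        Finset.prod_nonneg fun _ _ => hF0 _
      have hq := dyq_nonneg (ε := ε) hβ (a - y k)
      rw [dyc, abs_of_nonneg (by positivity), mul_assoc]
      refine (mul_le_of_le_one_left (by positivity) h1).trans (dyq_le hβ _))
  have b2 := dy_vec_bound Finset.univ (fun k => P * (1 / dyR (a - y k))) (fun k => a - y k)
    (fun k => dyg β (a - y k)) (by
      intro k _
      have hR := dyR_nonneg (a - y k)
      rw [abs_of_nonneg (by positivity)]
      calc P * (1 / dyR (a - y k)) * √(dyR (a - y k))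
          = P * (√(dyR (a - y k)) / dyR (a - y k)) := by ring
        _ = P * (1 / √(dyR (a - y k))) := by rw [Real.sqrt_div_self']
        _ ≤ dyT β (a - y k) ^ 2 * (1 / √(dyR (a - y k))) := by
            gcongr
            exact (hPk k).trans (dyF_le _ _ _)
        _ = _ := by rw [dyg]; ring)
  have e1 : (abPot (n + 1) j (j.insertNth a y)).1 = -∑ k, 1 / dyR (a - y k) * (a - y k).2 := by
    rw [dy_abPot, Prod.fst_sum, ← Finset.sum_neg_distrib]
    refine Finset.sum_congr rfl fun k _ => ?_
    simp only [perpInv, dyR]; ring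
  have e2 : (abPot (n + 1) j (j.insertNth a y)).2 = ∑ k, 1 / dyR (a - y k) * (a - y k).1 := by
    rw [dy_abPot, Prod.snd_sum]
    refine Finset.sum_congr rfl fun k _ => ?_
    simp only [perpInv, dyR]; ring
  have e : DSq (n + 1) α j (dyPsi β ε (n + 1)) (j.insertNth a y) = dyPhi β ε n y ^ 2 *
      (((∑ k, dyc β ε a y k * (a - y k).1) ^ 2 + (∑ k, dyc β ε a y k * (a - y k).2) ^ 2) +
      α ^ 2 * ((∑ k, P * (1 / dyR (a - y k)) * (a - y k).1) ^ 2 +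
        (∑ k, P * (1 / dyR (a - y k)) * (a - y k).2) ^ 2)) := by
    simp only [DSq, DOp, dy_pder hβ hε, e1, e2]
    simp only [dyPsi, dyPhi_peel, ← hP, ← Complex.ofReal_mul, dy_norm_I, mul_assoc P,
      ← Finset.mul_sum]
    simp only [mul_one, mul_zero, add_zero, zero_add]
    ring
  rw [e]
  apply mul_le_mul_of_nonneg_left _ (sq_nonneg _)
  rw [← Finset.mul_sum, mul_pow] at b1
  have hα2 : α ^ 2 ≤ β ^ 2 := by gcongr
  have h3 : 0 ≤ (∑ k, dyg β (a - y k)) ^ 2 := sq_nonneg _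
  have := mul_le_mul hα2 b2 (by positivity) (by positivity)
  linarith

lemma dy_kin_j {α β ε : ℝ} (hα : 0 ≤ α) (hαβ : α ≤ β) (hβ : 0 < β) (hε : 0 < ε) (m : ℕ)
    (j : Fin (m + 1 + 1)) :
    ∫⁻ x, ENNReal.ofReal (DSq (m + 1 + 1) α j (dyPsi β ε (m + 1 + 1)) x) ∂dyMu (m + 1 + 1) ≤
    ENNReal.ofReal (2 * β ^ 2) * ((m + 1 : ℕ) * (ENNReal.ofReal (π / β) * dyZ β ε (m + 1) +
      m * (ENNReal.ofReal (2 * π + 1) ^ 2 * dyZ β ε m))) := by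
  have hg := dyg_measurable hβ
  have hP1 := dyPhi_meas2 hβ hε (m + 1)
  -- measurable majorant
  set B : Config (m + 1 + 1) → ENNReal := fun x =>
    ENNReal.ofReal (dyPhi β ε (m + 1) (fun l => x (j.succAbove l)) ^ 2) *
      (ENNReal.ofReal (2 * β ^ 2) * ∑ k, ∑ l, (ENNReal.ofReal (dyg β (x j - x (j.succAbove k))) *
        ENNReal.ofReal (dyg β (x j - x (j.succAbove l))))) with hB
  have hBm : Measurable B := by
    have h1 : Measurable fun x : Config (m + 1 + 1) =>
        ENNReal.ofReal (dyPhi β ε (m + 1) (fun l => x (j.succAbove l)) ^ 2) :=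
      hP1.comp (measurable_pi_iff.2 fun l => measurable_pi_apply _)
    have h2 : ∀ k : Fin (m + 1), Measurable fun x : Config (m + 1 + 1) =>
        ENNReal.ofReal (dyg β (x j - x (j.succAbove k))) := fun k =>
      (hg.comp (by fun_prop : Measurable fun x : Config (m + 1 + 1) =>
        x j - x (j.succAbove k))).ennreal_ofReal
    exact h1.mul ((Finset.measurable_fun_sum _ fun k _ =>
      Finset.measurable_fun_sum _ fun l _ => (h2 k).mul (h2 l)).const_mul _)
  have hle : ∀ᵐ x ∂dyMu (m + 1 + 1),
      ENNReal.ofReal (DSq (m + 1 + 1) α j (dyPsi β ε (m + 1 + 1)) x) ≤ B x := by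
    filter_upwards [dyMu_ae (m + 1 + 1)] with x hx
    have hxe : x = j.insertNth (x j) (fun l => x (j.succAbove l)) := by
      rw [eq_comm, Fin.insertNth_eq_iff]; exact ⟨rfl, rfl⟩
    have hD := dy_DSq hα hαβ hβ hε j (x j) (hx j) (fun l => x (j.succAbove l)) (fun l => hx _)
    rw [← hxe] at hD
    refine (ENNReal.ofReal_le_ofReal hD).trans (le_of_eq ?_)
    rw [hB, ENNReal.ofReal_mul (sq_nonneg _), ENNReal.ofReal_mul (by positivity),
      ENNReal.ofReal_pow (Finset.sum_nonneg fun _ _ => dyg_nonneg _ _),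
      ENNReal.ofReal_sum_of_nonneg (fun _ _ => dyg_nonneg _ _), sq (∑ k, _), Finset.sum_mul_sum]
  refine (lintegral_mono_ae hle).trans ?_
  rw [dy_fubini j B hBm]
  have e : ∀ y : Config (m + 1), ∫⁻ a in Q0, B (j.insertNth a y) =
      ENNReal.ofReal (2 * β ^ 2) * (ENNReal.ofReal (dyPhi β ε (m + 1) y ^ 2) *
        ∑ k, ∑ l, dyJ β (y k) (y l)) := by
    intro y
    simp only [hB, Fin.insertNth_apply_same, Fin.insertNth_apply_succAbove]
    have h2 : ∀ k : Fin (m + 1), Measurable fun a : Plane =>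
        ENNReal.ofReal (dyg β (a - y k)) := fun k =>
      (hg.comp (measurable_id.sub_const _)).ennreal_ofReal
    have h3 : ∀ k l : Fin (m + 1), Measurable fun a : Plane =>
        ENNReal.ofReal (dyg β (a - y k)) * ENNReal.ofReal (dyg β (a - y l)) := fun k l =>
      (h2 k).mul (h2 l)
    have h4 : ∀ k : Fin (m + 1), Measurable fun a : Plane =>
        ∑ l, ENNReal.ofReal (dyg β (a - y k)) * ENNReal.ofReal (dyg β (a - y l)) := fun k =>
      Finset.measurable_fun_sum _ fun l _ => h3 k l
    have h5 : Measurable fun a : Plane =>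
        ∑ k, ∑ l, ENNReal.ofReal (dyg β (a - y k)) * ENNReal.ofReal (dyg β (a - y l)) :=
      Finset.measurable_fun_sum _ fun k _ => h4 k
    rw [lintegral_const_mul _ (h5.const_mul _), lintegral_const_mul _ h5,
      lintegral_finsetSum _ (fun k _ => h4 k)]
    simp only [lintegral_finsetSum _ (fun l _ => h3 _ l), dyJ]
    ring
  simp only [e]
  rw [lintegral_const_mul']
  · exact mul_le_mul_right (dy_pair_bound hβ hε m) _
  · exact ENNReal.ofReal_ne_top

lemma dy_DSq_nonneg (n : ℕ) (α : ℝ) (j : Fin n) (Ψ : Config n → ℂ) (x : Config n) :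
    0 ≤ DSq n α j Ψ x := by unfold DSq; positivity

/-- total energy bound in terms of real norms -/
lemma dy_kin {α β ε : ℝ} (hα : 0 ≤ α) (hαβ : α ≤ β) (hβ : 0 < β) (hε : 0 < ε) (m : ℕ) :
    kinE (m + 1 + 1) α Q0 (dyPsi β ε (m + 1 + 1)) ≤
    (m + 2 : ℝ) * (2 * β ^ 2 * ((m + 1) * (π / β * (dyZ β ε (m + 1)).toReal +
      m * ((2 * π + 1) ^ 2 * (dyZ β ε m).toReal)))) := by
  unfold kinE
  have hj : ∀ j : Fin (m + 1 + 1), ∫ x in cube (m + 1 + 1) Q0,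
      DSq (m + 1 + 1) α j (dyPsi β ε (m + 1 + 1)) x ≤
      2 * β ^ 2 * ((m + 1) * (π / β * (dyZ β ε (m + 1)).toReal +
      m * ((2 * π + 1) ^ 2 * (dyZ β ε m).toReal))) := by
    intro j
    have h1 := norm_integral_le_lintegral_norm (μ := dyMu (m + 1 + 1))
      (fun x => DSq (m + 1 + 1) α j (dyPsi β ε (m + 1 + 1)) x)
    refine (le_abs_self _).trans (h1.trans ?_)
    simp only [Real.norm_eq_abs, abs_of_nonneg (dy_DSq_nonneg _ _ _ _ _)]
    have hZ1 : dyZ β ε (m + 1) ≠ ⊤ := ((dyZ_le_one hβ ε _).trans_lt ENNReal.one_lt_top).ne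
    have hZ0 : dyZ β ε m ≠ ⊤ := ((dyZ_le_one hβ ε _).trans_lt ENNReal.one_lt_top).ne
    apply ENNReal.toReal_le_of_le_ofReal (by positivity)
    refine (dy_kin_j hα hαβ hβ hε m j).trans (le_of_eq ?_)
    rw [ENNReal.ofReal_mul (p := 2 * β ^ 2) (by positivity),
      ENNReal.ofReal_mul (p := (m : ℝ) + 1) (by positivity),
      ENNReal.ofReal_add (p := π / β * (dyZ β ε (m + 1)).toReal) (by positivity) (by positivity),
      ENNReal.ofReal_mul (p := π / β) (by positivity),
      ENNReal.ofReal_mul (p := (m : ℝ)) (by positivity),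
      ENNReal.ofReal_mul (p := (2 * π + 1) ^ 2) (by positivity),
      ENNReal.ofReal_toReal hZ1, ENNReal.ofReal_toReal hZ0,
      ENNReal.ofReal_pow (by positivity), ENNReal.ofReal_natCast,
      show (m : ℝ) + 1 = ((m + 1 : ℕ) : ℝ) by push_cast; ring, ENNReal.ofReal_natCast]
  refine (Finset.sum_le_sum fun j _ => hj j).trans (le_of_eq ?_)
  rw [Finset.sum_const, Finset.card_univ, Fintype.card_fin, nsmul_eq_mul]
  push_cast; ring

lemma dy_normSq {β ε : ℝ} (hβ : 0 < β) (hε : 0 < ε) (n : ℕ) :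
    normSq n Q0 (dyPsi β ε n) = (dyZ β ε n).toReal := by
  unfold normSq dyZ
  have : ∀ x : Config n, ‖dyPsi β ε n x‖ ^ 2 = dyPhi β ε n x ^ 2 := by
    intro x; simp [dyPsi]
  simp only [this]
  have := integral_eq_lintegral_of_nonneg_ae (μ := dyMu n) (f := fun x => dyPhi β ε n x ^ 2)
    (Filter.Eventually.of_forall fun x => sq_nonneg _)
    ((dyPhi_meas hβ hε n).pow_const 2).aestronglyMeasurable
  exact this

lemma dyZ_step_real {β ε : ℝ} (hβ : 0 < β) (hε : 0 < ε)
    (hε2 : 8 * ε ≤ 2 * π * (β - β / (1 + β))) (n : ℕ) :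
    (1 - n * (2 * π * β)) * (dyZ β ε n).toReal ≤ (dyZ β ε (n + 1)).toReal := by
  have h := dyZ_step hβ hε hε2 n
  have hZ1 : dyZ β ε (n + 1) ≠ ⊤ := ((dyZ_le_one hβ ε _).trans_lt ENNReal.one_lt_top).ne
  have hZ0 : dyZ β ε n ≠ ⊤ := ((dyZ_le_one hβ ε _).trans_lt ENNReal.one_lt_top).ne
  have h3 : (n : ENNReal) * ENNReal.ofReal (2 * π * β) * dyZ β ε n ≠ ⊤ :=
    ENNReal.mul_ne_top (ENNReal.mul_ne_top (ENNReal.natCast_ne_top n) ENNReal.ofReal_ne_top) hZ0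
  have h2 := ENNReal.toReal_mono (ENNReal.add_ne_top.2 ⟨hZ1, h3⟩) h
  rw [ENNReal.toReal_add hZ1 h3, ENNReal.toReal_mul, ENNReal.toReal_mul, ENNReal.toReal_natCast,
    ENNReal.toReal_ofReal (by positivity)] at h2
  linarith

lemma dy_EN_le (n : ℕ) (α : ℝ) (Ψ : Config (n + 1) → ℂ) (hΨ : Admissible (n + 1) Ψ) (Z : ℝ)
    (hZ : 0 < Z) (hN : normSq (n + 1) Q0 Ψ = Z) :
    EN (n + 1) α ≤ kinE (n + 1) α Q0 Ψ / Z := by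
  unfold EN neumannE
  rw [if_neg (by omega)]
  set c : ℂ := (((√Z)⁻¹ : ℝ) : ℂ) with hc
  have hc2 : ‖c‖ ^ 2 = Z⁻¹ := by
    rw [hc, Complex.norm_real, Real.norm_eq_abs, sq_abs, inv_pow, Real.sq_sqrt hZ.le]
  have hd := hΨ.smooth.differentiable (by simp)
  have hp : ∀ j v x, pder (n + 1) j v (fun x => c * Ψ x) x = c * pder (n + 1) j v Ψ x := by
    intro j v x
    unfold pder
    rw [fderiv_const_mul (hd x)]
    rfl
  apply csInf_le
  · refine ⟨0, ?_⟩
    rintro E ⟨Φ, -, -, rfl⟩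
    exact Finset.sum_nonneg fun j _ => integral_nonneg fun x => dy_DSq_nonneg _ _ _ _ _
  · refine ⟨fun x => c * Ψ x, ⟨contDiff_const.mul hΨ.smooth, ?_, ?_⟩, ?_, ?_⟩
    · intro σ x; simp only [hΨ.symm σ x]
    · obtain ⟨U, hU, hd, h0⟩ := hΨ.vanishes
      exact ⟨U, hU, hd, fun x hx => by simp [h0 x hx]⟩
    · unfold normSq at hN ⊢
      simp only [norm_mul, mul_pow, hc2, integral_const_mul, hN]
      exact inv_mul_cancel₀ hZ.ne'
    · unfold kinE
      rw [Finset.sum_div]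
      refine Finset.sum_congr rfl fun j _ => ?_
      rw [div_eq_inv_mul, ← integral_const_mul]
      congr 1; ext x
      have h1 : ∀ p q A : ℂ, ‖-Complex.I * (c * p) + A * (c * q)‖ ^ 2 =
          Z⁻¹ * ‖-Complex.I * p + A * q‖ ^ 2 := by
        intro p q A
        rw [show -Complex.I * (c * p) + A * (c * q) = c * (-Complex.I * p + A * q) by ring,
          norm_mul, mul_pow, hc2]
      simp only [DSq, DOp, hp, h1]
      ring

lemma dyZ_pos {β ε : ℝ} (hβ : 0 < β) (hε : 0 < ε)
    (hε2 : 8 * ε ≤ 2 * π * (β - β / (1 + β))) (k : ℕ) (hk : 2 * π * β * k < 1) :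
    0 < (dyZ β ε k).toReal := by
  induction k with
  | zero => simp [dyZ_zero]
  | succ k ih =>
    have hpos : 0 < 2 * π * β := by positivity
    push_cast at hk
    have h1 := ih (by nlinarith)
    have h2 := dyZ_step_real hβ hε hε2 k
    have h3 : 0 < 1 - k * (2 * π * β) := by nlinarith
    exact (mul_pos h3 h1).trans_le h2

lemma dy_bound {α β : ℝ} (hα : 0 ≤ α) (hαβ : α ≤ β) (hβ : 0 < β) (m : ℕ)
    (h : 2 * π * β * ((m : ℝ) + 2) < 1) :
    EN (m + 1 + 1) α ≤ 2 * π * ((m : ℝ) + 2) * ((m : ℝ) + 1) * β *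
      (1 + (20 / 3) * π * m * β) / (1 - 2 * π * β * ((m : ℝ) + 2)) ^ 2 := by
  obtain ⟨ε, hε, hε2⟩ : ∃ ε : ℝ, 0 < ε ∧ 8 * ε ≤ 2 * π * (β - β / (1 + β)) := by
    refine ⟨2 * π * (β - β / (1 + β)) / 8, ?_, by linarith⟩
    have : β / (1 + β) < β := div_lt_self hβ (by linarith)
    have : 0 < β - β / (1 + β) := by linarith
    positivity
  have hp : 0 < 2 * π * β := by positivity
  have hm : (0:ℝ) ≤ m := Nat.cast_nonneg m
  have hZ2 := dyZ_pos hβ hε hε2 (m + 1 + 1) (by push_cast; linarith)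
  have s1 := dyZ_step_real hβ hε hε2 (m + 1)
  have s0 := dyZ_step_real hβ hε hε2 m
  have hE := dy_EN_le (m + 1) α _ (dyPsi_admissible hβ hε (m + 1 + 1)) _ hZ2 (dy_normSq hβ hε _)
  have hK := dy_kin hα hαβ hβ hε m
  have n1 : 0 ≤ (dyZ β ε (m + 1)).toReal := ENNReal.toReal_nonneg
  have n0 : 0 ≤ (dyZ β ε m).toReal := ENNReal.toReal_nonneg
  set Z2 := (dyZ β ε (m + 1 + 1)).toReal
  set Z1 := (dyZ β ε (m + 1)).toReal
  set Z0 := (dyZ β ε m).toReal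
  set u := 1 - 2 * π * β * ((m : ℝ) + 2) with hu
  have u0 : 0 < u := by linarith
  have u1 : u ≤ 1 := by nlinarith
  have t1 : u * Z1 ≤ Z2 := by
    refine le_trans (mul_le_mul_of_nonneg_right ?_ n1) s1
    push_cast; rw [hu]; nlinarith
  have t0 : u * Z0 ≤ Z1 := by
    refine le_trans (mul_le_mul_of_nonneg_right ?_ n0) s0
    rw [hu]; nlinarith
  have q1 : u ^ 2 * Z1 ≤ Z2 := by nlinarith [mul_nonneg u0.le n1]
  have q0 : u ^ 2 * Z0 ≤ Z2 := by nlinarith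
  refine hE.trans ?_
  rw [div_le_div_iff₀ hZ2 (by positivity)]
  have hπ : (2 * π + 1) ^ 2 ≤ 20 / 3 * π ^ 2 := by nlinarith [Real.pi_gt_three]
  calc kinE (m + 1 + 1) α Q0 (dyPsi β ε (m + 1 + 1)) * u ^ 2
      ≤ (m + 2 : ℝ) * (2 * β ^ 2 * ((m + 1) * (π / β * Z1 + m * ((2 * π + 1) ^ 2 * Z0)))) * u ^ 2 := by
        gcongr
    _ ≤ (m + 2 : ℝ) * (2 * β ^ 2 * ((m + 1) * (π / β * Z1 + m * ((20 / 3 * π ^ 2) * Z0)))) * u ^ 2 := by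
        gcongr
    _ = (m + 2 : ℝ) * (2 * β ^ 2 * ((m + 1) * (π / β * (u ^ 2 * Z1) +
          m * ((20 / 3 * π ^ 2) * (u ^ 2 * Z0))))) := by ring
    _ ≤ (m + 2 : ℝ) * (2 * β ^ 2 * ((m + 1) * (π / β * Z2 + m * ((20 / 3 * π ^ 2) * Z2)))) := by
        gcongr
    _ = _ := by field_simp

lemma dy_one (α : ℝ) : EN 1 α ≤ 0 := by
  have hA : Admissible 1 (fun _ => (1:ℂ)) := by
    refine ⟨contDiff_const, fun _ _ => rfl, ∅, isOpen_empty, ?_, fun x hx => hx.elim⟩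
    rintro x ⟨j, k, hjk, -⟩
    exact (hjk (Subsingleton.elim j k)).elim
  have hN : normSq 1 Q0 (fun _ => (1:ℂ)) = 1 := by
    unfold normSq
    have : (volume : Measure (Config 1)).restrict (cube 1 Q0) = dyMu 1 := rfl
    rw [this]
    simp [Measure.real, dyMu_univ]
  refine (dy_EN_le 0 α _ hA 1 one_pos hN).trans (le_of_eq ?_)
  have hab : ∀ (j : Fin 1) (x : Config 1), abPot 1 j x = 0 := by
    intro j x
    unfold abPot
    have : Finset.univ.erase j = ∅ := by
      ext k; simp [Subsingleton.elim k j]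
    rw [this]; simp
  simp [kinE, DSq, DOp, pder, hab]

/-- Dyson-type upper bound, Neumann: for every `α ∈ [0,1]` and `N ≥ 1`
with `2παN < 1`, `E^N_N(α) ≤ 2πN(N−1)α (1 + (20/3)π(N−2)α)/(1−2παN)²`. -/
theorem dyson_upper_bound_neumann (α : ℝ) (hα : α ∈ Set.Icc (0 : ℝ) 1)
    (N : ℕ) (hN : 1 ≤ N) (h : 2 * π * α * (N : ℝ) < 1) :
    EN N α ≤ 2 * π * (N : ℝ) * ((N : ℝ) - 1) * α *
      (1 + (20 / 3) * π * ((N : ℝ) - 2) * α) / (1 - 2 * π * α * (N : ℝ)) ^ 2 := by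
  obtain ⟨h0, -⟩ := hα
  rcases Nat.lt_or_ge N 2 with h2 | h2
  · obtain rfl : N = 1 := by omega
    refine (dy_one α).trans (le_of_eq ?_)
    simp
  · obtain ⟨m, rfl⟩ : ∃ m, N = m + 1 + 1 := ⟨N - 2, by omega⟩
    have e1 : ((m + 1 + 1 : ℕ) : ℝ) = (m : ℝ) + 2 := by push_cast; ring
    rw [e1] at h ⊢
    rw [show (m : ℝ) + 2 - 1 = m + 1 by ring, show (m : ℝ) + 2 - 2 = m by ring]
    have hc : ContinuousAt (fun β : ℝ => 2 * π * ((m : ℝ) + 2) * ((m : ℝ) + 1) * β *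
      (1 + (20 / 3) * π * m * β) / (1 - 2 * π * β * ((m : ℝ) + 2)) ^ 2) α := by
      apply ContinuousAt.div
      · fun_prop
      · fun_prop
      · have : 0 < 1 - 2 * π * α * ((m : ℝ) + 2) := by linarith
        positivity
    refine ge_of_tendsto (hc.tendsto.mono_left (nhdsWithin_le_nhds (s := Set.Ioi α))) ?_
    have hev : ∀ᶠ β in 𝓝 α, 2 * π * β * ((m : ℝ) + 2) < 1 :=
      ContinuousAt.eventually_lt (f := fun β : ℝ => 2 * π * β * ((m : ℝ) + 2))
        (g := fun _ => (1:ℝ)) (by fun_prop) continuousAt_const h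
    filter_upwards [nhdsWithin_le_nhds hev, self_mem_nhdsWithin] with β hβ hαβ
    exact dy_bound h0 (le_of_lt hαβ) (lt_of_le_of_lt h0 hαβ) m hβ
end
end

section
/- A priori bound in terms of the two-particle energy: for every α ∈ [0,1] and every integer N ≥ 3, writing e₂ := E^N_2(α) and b_N := binom(N,2) · (3/4)^{N−2}, one has E^N_N(α) ≥ π² b_N e₂ / ( (π + 4√e₂)² + e₂ b_N ). -/
noncomputable section

open MeasureTheory Real Set
open scoped BigOperators Topology

lemma ab_dirichlet_wirtinger (k : ℝ) (hk0 : 0 ≤ k) (hk : k < π) (g g' : ℝ → ℝ)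
    (hg : ∀ t, HasDerivAt g (g' t) t) (hg' : Continuous g') (h0 : g 0 = 0) (h1 : g 1 = 0) :
    k ^ 2 * ∫ t in (0:ℝ)..1, g t ^ 2 ≤ ∫ t in (0:ℝ)..1, g' t ^ 2 := by
  have hgc : Continuous g := continuous_iff_continuousAt.2 fun t => (hg t).continuousAt
  have hcos : ∀ t ∈ Set.uIcc (0:ℝ) 1, 0 < cos (k * (t - 1/2)) := by
    intro t ht
    rw [Set.uIcc_of_le zero_le_one] at ht
    apply Real.cos_pos_of_mem_Ioo
    constructor <;> nlinarith [ht.1, ht.2, Real.pi_pos]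
  let F : ℝ → ℝ := fun t => k * (sin (k * (t - 1/2)) / cos (k * (t - 1/2))) * g t ^ 2
  let F' : ℝ → ℝ := fun t => k * (k / cos (k * (t - 1/2)) ^ 2) * g t ^ 2
    + k * (sin (k * (t - 1/2)) / cos (k * (t - 1/2))) * (2 * g t * g' t)
  have hlin : ∀ t : ℝ, HasDerivAt (fun t : ℝ => k * (t - 1/2)) k t := by
    intro t
    simpa only [mul_one, id] using ((hasDerivAt_id t).sub_const (1/2)).const_mul k
  have hF : ∀ t ∈ Set.uIcc (0:ℝ) 1, HasDerivAt F (F' t) t := by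
    intro t ht
    have hc := hcos t ht
    have e1 := (hlin t).sin
    have e2 := (hlin t).cos
    have e3 := (e1.div e2 hc.ne').const_mul k
    have e4 := e3.mul ((hg t).pow 2)
    refine e4.congr_deriv ?_
    have := Real.sin_sq_add_cos_sq (k * (t - 1/2))
    have h3 : k / cos (k * (t - 1/2)) ^ 2 = (cos (k * (t - 1 / 2)) * k * cos (k * (t - 1 / 2)) -
            sin (k * (t - 1 / 2)) * (-sin (k * (t - 1 / 2)) * k)) / cos (k * (t - 1 / 2)) ^ 2 := by
      congr 1
      linear_combination (-k) * this
    simp only [F']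
    rw [h3]
    simp
  have hcc : ContinuousOn (fun t => cos (k * (t - 1/2))) (Set.uIcc (0:ℝ) 1) := by fun_prop
  have hne : ∀ t ∈ Set.uIcc (0:ℝ) 1, cos (k * (t - 1/2)) ≠ 0 := fun t ht => (hcos t ht).ne'
  have hF'c : ContinuousOn F' (Set.uIcc (0:ℝ) 1) := by
    have hne2 : ∀ t ∈ Set.uIcc (0:ℝ) 1, cos (k * (t - 1/2)) ^ 2 ≠ 0 :=
      fun t ht => pow_ne_zero 2 (hne t ht)
    apply ContinuousOn.add
    · exact (continuousOn_const.mul (continuousOn_const.div (hcc.pow 2) hne2)).mul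
        (hgc.continuousOn.pow 2)
    · refine (continuousOn_const.mul (ContinuousOn.div (by fun_prop) hcc hne)).mul ?_
      fun_prop
  have hFi : IntervalIntegrable F' volume 0 1 := hF'c.intervalIntegrable
  have hIntF := intervalIntegral.integral_eq_sub_of_hasDerivAt hF hFi
  have hF0 : F 0 = 0 := by simp [F, h0]
  have hF1 : F 1 = 0 := by simp [F, h1]
  rw [hF0, hF1, sub_zero] at hIntF
  have i1 : IntervalIntegrable (fun t => g' t ^ 2) volume 0 1 :=
    (hg'.pow 2).intervalIntegrable _ _
  have i2 : IntervalIntegrable (fun t => k ^ 2 * g t ^ 2) volume 0 1 :=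
    (continuous_const.mul (hgc.pow 2)).intervalIntegrable _ _
  rw [← intervalIntegral.integral_const_mul]
  have : ∫ t in (0:ℝ)..1, k ^ 2 * g t ^ 2 ≤ ∫ t in (0:ℝ)..1, (g' t ^ 2 + F' t) := by
    apply intervalIntegral.integral_mono_on zero_le_one i2 (i1.add hFi)
    intro t ht
    have ht' : t ∈ Set.uIcc (0:ℝ) 1 := by rwa [Set.uIcc_of_le zero_le_one]
    have hc := hne t ht'
    have e := Real.sin_sq_add_cos_sq (k * (t - 1/2))
    have key : g' t ^ 2 + F' t - k ^ 2 * g t ^ 2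
        = (g' t + k * (sin (k * (t - 1/2)) / cos (k * (t - 1/2))) * g t) ^ 2 := by
      simp only [F']
      generalize sin (k * (t - 1/2)) = a at *
      generalize cos (k * (t - 1/2)) = b at *
      field_simp
      linear_combination (-(k^2 * g t ^ 2)) * e
    nlinarith [sq_nonneg (g' t + k * (sin (k * (t - 1/2)) / cos (k * (t - 1/2))) * g t)]
  rw [intervalIntegral.integral_add i1 hFi, hIntF, add_zero] at this
  exact this

lemma ab_wirtinger (f f' : ℝ → ℝ)
    (hf : ∀ t, HasDerivAt f (f' t) t) (hf' : Continuous f') :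
    π ^ 2 * ((∫ t in (0:ℝ)..1, f t ^ 2) - (∫ t in (0:ℝ)..1, f t) ^ 2)
      ≤ ∫ t in (0:ℝ)..1, f' t ^ 2 := by
  have hfc : Continuous f := continuous_iff_continuousAt.2 fun t => (hf t).continuousAt
  set m := ∫ t in (0:ℝ)..1, f t with hm
  let h : ℝ → ℝ := fun t => f t - m
  have hhc : Continuous h := hfc.sub continuous_const
  let g : ℝ → ℝ := fun t => ∫ s in (0:ℝ)..t, h s
  have hg : ∀ t, HasDerivAt g (h t) t := fun t =>
    intervalIntegral.integral_hasDerivAt_right (hhc.intervalIntegrable _ _)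
      hhc.stronglyMeasurable.stronglyMeasurableAtFilter hhc.continuousAt
  have hgc : Continuous g := continuous_iff_continuousAt.2 fun t => (hg t).continuousAt
  have hh : ∀ t, HasDerivAt h (f' t) t := fun t => (hf t).sub_const m
  have g0 : g 0 = 0 := by simp [g]
  have g1 : g 1 = 0 := by
    simp only [g, h]
    rw [intervalIntegral.integral_sub (hfc.intervalIntegrable _ _) (by simp)]
    simp [hm]
  have hv : (∫ t in (0:ℝ)..1, f t ^ 2) - m ^ 2 = ∫ t in (0:ℝ)..1, h t ^ 2 := by
    have : ∀ t, h t ^ 2 = f t ^ 2 - (2 * m) * f t + m ^ 2 := fun t => by simp only [h]; ring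
    simp_rw [this]
    rw [intervalIntegral.integral_add, intervalIntegral.integral_sub,
      intervalIntegral.integral_const_mul, ← hm]
    · simp; ring
    all_goals apply Continuous.intervalIntegrable; fun_prop
  rw [hv]
  have main : ∀ k : ℝ, 0 ≤ k → k < π →
      k ^ 2 * ∫ t in (0:ℝ)..1, h t ^ 2 ≤ ∫ t in (0:ℝ)..1, f' t ^ 2 := by
    intro k hk0 hk
    have hw := ab_dirichlet_wirtinger k hk0 hk g h hg hhc g0 g1
    have hp := intervalIntegral.integral_mul_deriv_eq_deriv_mul (a := 0) (b := 1)
      (u := g) (v := h) (u' := h) (v' := f') (fun t _ => hg t) (fun t _ => hh t)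
      (hhc.intervalIntegrable _ _) (hf'.intervalIntegrable _ _)
    rw [g0, g1] at hp
    have hp2 : ∫ t in (0:ℝ)..1, g t * f' t = - ∫ t in (0:ℝ)..1, h t ^ 2 := by
      rw [hp]; simp [pow_two]
    have hpos : 0 ≤ ∫ t in (0:ℝ)..1, (f' t + k^2 * g t) ^ 2 :=
      intervalIntegral.integral_nonneg zero_le_one (fun t _ => sq_nonneg _)
    have : ∀ t, (f' t + k^2 * g t) ^ 2 = f' t ^ 2 + (2 * k^2) * (g t * f' t) + k^4 * g t ^ 2 :=
      fun t => by ring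
    simp_rw [this] at hpos
    rw [intervalIntegral.integral_add, intervalIntegral.integral_add,
      intervalIntegral.integral_const_mul, intervalIntegral.integral_const_mul, hp2] at hpos
    · nlinarith [mul_le_mul_of_nonneg_left hw (sq_nonneg k)]
    all_goals apply Continuous.intervalIntegrable; fun_prop
  have hcont : Filter.Tendsto (fun k : ℝ => k ^ 2 * ∫ t in (0:ℝ)..1, h t ^ 2)
      (nhdsWithin π (Set.Iio π)) (nhds (π ^ 2 * ∫ t in (0:ℝ)..1, h t ^ 2)) := by
    apply Filter.Tendsto.mono_left _ nhdsWithin_le_nhds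
    apply Continuous.tendsto (f := fun k : ℝ => k ^ 2 * ∫ t in (0:ℝ)..1, h t ^ 2)
    fun_prop
  refine le_of_tendsto hcont ?_
  filter_upwards [Ioo_mem_nhdsLT Real.pi_pos] with k hk
  exact main k hk.1.le hk.2

noncomputable def abVar {X : Type*} [MeasurableSpace X] (μ : Measure X) (f : X → ℝ) : ℝ :=
  (∫ x, f x ^ 2 ∂μ) - (∫ x, f x ∂μ) ^ 2

lemma ab_integrable_bdd {X : Type*} [MeasurableSpace X] {μ : Measure X} [IsFiniteMeasure μ]
    {f : X → ℝ} (hf : Measurable f) {C : ℝ} (hC : ∀ x, |f x| ≤ C) : Integrable f μ :=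
  Integrable.of_bound hf.aestronglyMeasurable C (Filter.Eventually.of_forall hC)

lemma ab_meas_fst {X Y : Type*} [MeasurableSpace X] [MeasurableSpace Y]
    (μ : Measure X) [IsProbabilityMeasure μ]
    {f : X × Y → ℝ} (hf : Measurable f) : Measurable (fun y => ∫ x, f (x, y) ∂μ) :=
  (hf.stronglyMeasurable.integral_prod_left' (μ := μ)).measurable

lemma ab_meas_snd {X Y : Type*} [MeasurableSpace X] [MeasurableSpace Y]
    (ν : Measure Y) [IsProbabilityMeasure ν]
    {f : X × Y → ℝ} (hf : Measurable f) : Measurable (fun x => ∫ y, f (x, y) ∂ν) :=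
  (hf.stronglyMeasurable.integral_prod_right' (ν := ν)).measurable

lemma ab_bdd_int {X : Type*} [MeasurableSpace X]
    (μ : Measure X) [IsProbabilityMeasure μ]
    {f : X → ℝ} {C : ℝ} (hC : ∀ x, |f x| ≤ C) : |∫ x, f x ∂μ| ≤ C := by
  have := norm_integral_le_of_norm_le_const (μ := μ) (f := f) (C := C)
    (Filter.Eventually.of_forall hC)
  simpa using this

lemma ab_expand {Z : Type*} [MeasurableSpace Z] (μ : Measure Z) [IsProbabilityMeasure μ]
    (f a b : Z → ℝ) (M : ℝ) (h1 : Integrable (fun z => f z ^ 2) μ)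
    (h2 : Integrable (fun z => a z ^ 2) μ) (h3 : Integrable (fun z => b z ^ 2) μ)
    (h4 : Integrable (fun z => f z * a z) μ) (h5 : Integrable (fun z => f z * b z) μ)
    (h6 : Integrable (fun z => b z * a z) μ) (h7 : Integrable f μ) (h8 : Integrable a μ)
    (h9 : Integrable b μ) :
    ∫ z, (f z - a z - b z + M) ^ 2 ∂μ =
      ∫ z, f z ^ 2 ∂μ + ∫ z, a z ^ 2 ∂μ + ∫ z, b z ^ 2 ∂μ + M ^ 2 - 2 * (∫ z, f z * a z ∂μ)
      - 2 * (∫ z, f z * b z ∂μ) + 2 * (∫ z, b z * a z ∂μ) + (2 * M) * (∫ z, f z ∂μ)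
      - (2 * M) * (∫ z, a z ∂μ) - (2 * M) * (∫ z, b z ∂μ) := by
  have hexp : ∀ z, (f z - a z - b z + M) ^ 2 =
      f z ^ 2 + a z ^ 2 + b z ^ 2 + M ^ 2 - 2 * (f z * a z) - 2 * (f z * b z)
       + 2 * (b z * a z) + (2 * M) * f z - (2 * M) * a z - (2 * M) * b z :=
    fun z => by ring
  simp_rw [hexp]
  rw [integral_sub (by fun_prop) (by fun_prop), integral_sub (by fun_prop) (by fun_prop),
    integral_add (by fun_prop) (by fun_prop), integral_add (by fun_prop) (by fun_prop),
    integral_sub (by fun_prop) (by fun_prop), integral_sub (by fun_prop) (by fun_prop),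
    integral_add (by fun_prop) (by fun_prop), integral_add (by fun_prop) (by fun_prop),
    integral_add (by fun_prop) (by fun_prop)]
  simp only [integral_const_mul, integral_const, probReal_univ, one_smul]

lemma ab_var_prod {X Y : Type*} [MeasurableSpace X] [MeasurableSpace Y]
    (μ : Measure X) (ν : Measure Y) [IsProbabilityMeasure μ] [IsProbabilityMeasure ν]
    (f : X × Y → ℝ) (hf : Measurable f) (C : ℝ) (hC : ∀ x, |f x| ≤ C) :
    abVar (μ.prod ν) f ≤ (∫ y, abVar μ (fun x => f (x, y)) ∂ν)
      + ∫ x, abVar ν (fun y => f (x, y)) ∂μ := by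
  let A : Y → ℝ := fun y => ∫ x, f (x, y) ∂μ
  let B : X → ℝ := fun x => ∫ y, f (x, y) ∂ν
  have hA : Measurable A := ab_meas_fst μ hf
  have hB : Measurable B := ab_meas_snd ν hf
  have hAC : ∀ y, |A y| ≤ C := fun y => ab_bdd_int μ fun x => hC _
  have hBC : ∀ y, |B y| ≤ C := fun y => ab_bdd_int ν fun x => hC _
  set M := ∫ z, f z ∂(μ.prod ν) with hM
  set P := ∫ z, f z ^ 2 ∂(μ.prod ν) with hP
  have hC0 : 0 ≤ C := by
    have := ab_bdd_int (μ.prod ν) hC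
    exact (abs_nonneg _).trans this
  have hmul : ∀ {a b : ℝ}, |a| ≤ C → |b| ≤ C → |a * b| ≤ C * C := fun {a b} ha hb => by
    rw [abs_mul]; exact mul_le_mul ha hb (abs_nonneg _) hC0
  have hsq : ∀ {a : ℝ}, |a| ≤ C → |a ^ 2| ≤ C * C := fun {a} ha => by
    rw [pow_two]; exact hmul ha ha
  have iF : Integrable f (μ.prod ν) := ab_integrable_bdd hf hC
  have iF2 : Integrable (fun z => f z ^ 2) (μ.prod ν) :=
    ab_integrable_bdd (hf.pow_const 2) fun z => hsq (hC z)
  have mA : Measurable (fun z : X × Y => A z.2) := hA.comp measurable_snd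
  have mB : Measurable (fun z : X × Y => B z.1) := hB.comp measurable_fst
  have iA : Integrable (fun z : X × Y => A z.2) (μ.prod ν) := ab_integrable_bdd mA fun z => hAC _
  have iB : Integrable (fun z : X × Y => B z.1) (μ.prod ν) := ab_integrable_bdd mB fun z => hBC _
  have iA2 : Integrable (fun z : X × Y => A z.2 ^ 2) (μ.prod ν) :=
    ab_integrable_bdd (mA.pow_const 2) fun z => hsq (hAC _)
  have iB2 : Integrable (fun z : X × Y => B z.1 ^ 2) (μ.prod ν) :=
    ab_integrable_bdd (mB.pow_const 2) fun z => hsq (hBC _)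
  have ifA : Integrable (fun z : X × Y => f z * A z.2) (μ.prod ν) :=
    ab_integrable_bdd (hf.mul mA) fun z => hmul (hC _) (hAC _)
  have ifB : Integrable (fun z : X × Y => f z * B z.1) (μ.prod ν) :=
    ab_integrable_bdd (hf.mul mB) fun z => hmul (hC _) (hBC _)
  have iAB : Integrable (fun z : X × Y => B z.1 * A z.2) (μ.prod ν) :=
    ab_integrable_bdd (mB.mul mA) fun z => hmul (hBC _) (hAC _)
  have jA : ∫ y, A y ∂ν = M := by
    rw [hM, integral_prod_symm _ iF]
  have jB : ∫ x, B x ∂μ = M := by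
    rw [hM, integral_prod _ iF]
  have eA : ∫ z, A z.2 ∂(μ.prod ν) = M := by
    rw [integral_prod_symm _ iA]; simpa using jA
  have eB : ∫ z, B z.1 ∂(μ.prod ν) = M := by
    rw [integral_prod _ iB]; simpa using jB
  have eA2 : ∫ z, A z.2 ^ 2 ∂(μ.prod ν) = ∫ y, A y ^ 2 ∂ν := by
    rw [integral_prod_symm _ iA2]; simp
  have eB2 : ∫ z, B z.1 ^ 2 ∂(μ.prod ν) = ∫ x, B x ^ 2 ∂μ := by
    rw [integral_prod _ iB2]; simp
  have efA : ∫ z, f z * A z.2 ∂(μ.prod ν) = ∫ y, A y ^ 2 ∂ν := by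
    rw [integral_prod_symm _ ifA]
    congr 1; ext y
    simp only
    rw [integral_mul_const, pow_two]
  have efB : ∫ z, f z * B z.1 ∂(μ.prod ν) = ∫ x, B x ^ 2 ∂μ := by
    rw [integral_prod _ ifB]
    congr 1; ext y
    simp only
    rw [integral_mul_const, pow_two]
  have eAB : ∫ z, B z.1 * A z.2 ∂(μ.prod ν) = M * M := by
    rw [integral_prod_mul, jA, jB]
  have hpos : 0 ≤ ∫ z, (f z - A z.2 - B z.1 + M) ^ 2 ∂(μ.prod ν) :=
    integral_nonneg fun z => sq_nonneg _
  rw [ab_expand (μ.prod ν) f (fun z => A z.2) (fun z => B z.1) M iF2 iA2 iB2 ifA ifB iAB iF iA iB]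
    at hpos
  simp only [integral_const_mul, eA, eB, eA2, eB2, efA, efB, eAB, ← hM, ← hP] at hpos
  have r1 : ∫ y, abVar μ (fun x => f (x, y)) ∂ν = P - ∫ y, A y ^ 2 ∂ν := by
    simp only [abVar]
    rw [integral_sub, hP, integral_prod_symm _ iF2]
    · exact iF2.integral_prod_right
    · exact ab_integrable_bdd (hA.pow_const 2) fun z => hsq (hAC _)
  have r2 : ∫ x, abVar ν (fun y => f (x, y)) ∂μ = P - ∫ x, B x ^ 2 ∂μ := by
    simp only [abVar]
    rw [integral_sub, hP, integral_prod _ iF2]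
    · exact iF2.integral_prod_left
    · exact ab_integrable_bdd (hB.pow_const 2) fun z => hsq (hBC _)
  rw [r1, r2]
  simp only [abVar, ← hM, ← hP]
  nlinarith

lemma ab_var_meas_fst {X Y : Type*} [MeasurableSpace X] [MeasurableSpace Y]
    (μ : Measure X) [IsProbabilityMeasure μ]
    {f : X × Y → ℝ} (hf : Measurable f) : Measurable (fun y => abVar μ (fun x => f (x, y))) :=
  (ab_meas_fst μ (hf.pow_const 2)).sub ((ab_meas_fst μ hf).pow_const 2)

lemma ab_var_bdd {X : Type*} [MeasurableSpace X]
    (μ : Measure X) [IsProbabilityMeasure μ]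
    {f : X → ℝ} {C : ℝ} (hC : ∀ x, |f x| ≤ C) : |abVar μ f| ≤ C ^ 2 + C ^ 2 := by
  have h1 := ab_bdd_int μ (f := fun x => f x ^ 2) (C := C ^ 2) (fun x => by
    rw [abs_pow]; exact pow_le_pow_left₀ (abs_nonneg _) (hC x) 2)
  have h2 : |(∫ x, f x ∂μ) ^ 2| ≤ C ^ 2 := by
    rw [abs_pow]; exact pow_le_pow_left₀ (abs_nonneg _) (ab_bdd_int μ hC) 2
  exact (abs_sub _ _).trans (add_le_add h1 h2)

theorem ab_poincare_pi {X : Type*} [MeasurableSpace X] (μ : Measure X) [IsProbabilityMeasure μ]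
    (n : ℕ) : ∀ (f : (Fin n → X) → ℝ) (G : Fin n → (Fin n → X) → ℝ) (C : ℝ),
    Measurable f → (∀ x, |f x| ≤ C) → (∀ i, Measurable (G i)) → (∀ i x, |G i x| ≤ C) →
    (∀ i x, abVar μ (fun t => f (Function.update x i t)) ≤
      ∫ t, G i (Function.update x i t) ∂μ) →
    abVar (Measure.pi fun _ : Fin n => μ) f ≤ ∑ i, ∫ x, G i x ∂(Measure.pi fun _ : Fin n => μ) := by
  induction n with
  | zero =>
    intro f G C _ _ _ _ _
    simp [abVar, integral_unique]
  | succ n ih =>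
    intro f G C hf hfC hG hGC h
    have mp := (measurePreserving_piFinSuccAbove (fun _ : Fin (n+1) => μ) 0).symm
    have me : ∀ z : X × (Fin n → X),
      (MeasurableEquiv.piFinSuccAbove (fun _ : Fin (n+1) => X) 0).symm z
        = (Fin.cons z.1 z.2 : Fin (n+1) → X) := fun z => by
      simp [MeasurableEquiv.piFinSuccAbove, Fin.insertNthEquiv]
    have mcons : Measurable (fun z : X × (Fin n → X) => (Fin.cons z.1 z.2 : Fin (n+1) → X)) := by
      have := (MeasurableEquiv.piFinSuccAbove (fun _ : Fin (n+1) => X) 0).symm.measurable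
      rwa [funext me] at this
    have tr : ∀ F : (Fin (n+1) → X) → ℝ, ∫ x, F x ∂(Measure.pi fun _ : Fin (n+1) => μ)
        = ∫ z : X × (Fin n → X), F (Fin.cons z.1 z.2) ∂(μ.prod (Measure.pi fun _ : Fin n => μ)) := by
      intro F
      rw [← mp.integral_comp']
      simp_rw [me]
    have hv : abVar (Measure.pi fun _ : Fin (n+1) => μ) f
        = abVar (μ.prod (Measure.pi fun _ : Fin n => μ)) (fun z => f (Fin.cons z.1 z.2)) := by
      simp only [abVar, tr]
    have mf : Measurable (fun z : X × (Fin n → X) => f (Fin.cons z.1 z.2)) := hf.comp mcons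
    have mG : ∀ i, Measurable (fun z : X × (Fin n → X) => G i (Fin.cons z.1 z.2)) :=
      fun i => (hG i).comp mcons
    have iG : ∀ i, Integrable (fun z : X × (Fin n → X) => G i (Fin.cons z.1 z.2))
      (μ.prod (Measure.pi fun _ : Fin n => μ)) := fun i => ab_integrable_bdd (mG i) fun z => hGC _ _
    rw [hv, Fin.sum_univ_succ]
    refine (ab_var_prod μ (Measure.pi fun _ : Fin n => μ) _ mf C (fun z => hfC _)).trans ?_
    refine add_le_add ?_ ?_
    · rw [tr, integral_prod_symm _ (iG 0)]
      refine integral_mono ?_ (iG 0).integral_prod_right ?_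
      · exact ab_integrable_bdd (ab_var_meas_fst μ mf) (C := C ^ 2 + C ^ 2)
          fun y => ab_var_bdd μ fun x => hfC _
      · intro y
        have : Nonempty X := μ.nonempty_of_neZero
        have := h 0 (Fin.cons (Classical.arbitrary X) y)
        simpa only [Fin.update_cons_zero] using this
    · have e : ∀ i : Fin n, ∫ x, G i.succ x ∂(Measure.pi fun _ : Fin (n+1) => μ)
        = ∫ x, ∫ y, G i.succ (Fin.cons x y) ∂(Measure.pi fun _ : Fin n => μ) ∂μ := by
        intro i
        rw [tr, integral_prod _ (iG i.succ)]
      simp_rw [e]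
      rw [← integral_finsetSum _ (fun i _ => (iG i.succ).integral_prod_left)]
      refine integral_mono ?_ (integrable_finsetSum _ fun i _ =>
        (iG i.succ).integral_prod_left) ?_
      · refine ab_integrable_bdd (C := C ^ 2 + C ^ 2) ?_ fun y => ab_var_bdd _ fun x => hfC _
        exact (ab_meas_snd _ (mf.pow_const 2)).sub ((ab_meas_snd _ mf).pow_const 2)
      · intro x
        refine ih (fun y => f (Fin.cons x y)) (fun i y => G i.succ (Fin.cons x y)) C
          (mf.comp measurable_prodMk_left) (fun _ => hfC _)
          (fun i => (mG i.succ).comp measurable_prodMk_left) (fun _ _ => hGC _ _) ?_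
        intro i y
        have := h i.succ (Fin.cons x y)
        simpa only [Fin.cons_update] using this

lemma ab_isOpen_Q0 : IsOpen Q0 := isOpen_Ioo.prod isOpen_Ioo

lemma ab_isOpen_cube (N : ℕ) {Ω : Set Plane} (h : IsOpen Ω) : IsOpen (cube N Ω) :=
  isOpen_set_pi Set.finite_univ fun _ _ => h

lemma ab_cube_subset (N : ℕ) : ∃ K : Set (Config N), IsCompact K ∧ cube N Q0 ⊆ K := by
  refine ⟨Set.univ.pi fun _ => Set.Icc (0:ℝ) 1 ×ˢ Set.Icc (0:ℝ) 1,
    isCompact_univ_pi fun _ => isCompact_Icc.prod isCompact_Icc, ?_⟩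
  exact Set.pi_mono fun _ _ => Set.prod_mono Ioo_subset_Icc_self Ioo_subset_Icc_self

lemma ab_Q0_subset : ∃ K : Set Plane, IsCompact K ∧ Q0 ⊆ K :=
  ⟨_, isCompact_Icc.prod isCompact_Icc,
    Set.prod_mono Ioo_subset_Icc_self Ioo_subset_Icc_self⟩

lemma ab_restrict_Q0 : (volume : Measure Plane).restrict Q0
    = ((volume : Measure ℝ).restrict (Ioo 0 1)).prod ((volume : Measure ℝ).restrict (Ioo 0 1)) := by
  rw [Measure.prod_restrict]; rfl

lemma ab_restrict_cube (N : ℕ) : (volume : Measure (Config N)).restrict (cube N Q0)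
    = Measure.pi fun _ : Fin N => (volume : Measure Plane).restrict Q0 := by
  rw [← Measure.restrict_pi_pi]; rfl

instance ab_prob_Ioo : IsProbabilityMeasure ((volume : Measure ℝ).restrict (Ioo 0 1)) :=
  ⟨by simp⟩

instance ab_prob_Q0 : IsProbabilityMeasure ((volume : Measure Plane).restrict Q0) := by
  rw [ab_restrict_Q0]; infer_instance

instance ab_prob_cube (N : ℕ) :
    IsProbabilityMeasure ((volume : Measure (Config N)).restrict (cube N Q0)) := by
  rw [ab_restrict_cube]; infer_instance

lemma ab_integrableOn {X E : Type*} [TopologicalSpace X] [MeasurableSpace X] [OpensMeasurableSpace X]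
    [T2Space X] [NormedAddCommGroup E] [SecondCountableTopologyEither X E]
    {μ : Measure X} [IsFiniteMeasureOnCompacts μ] {f : X → E} (hf : Continuous f) {s : Set X}
    (hs : ∃ K : Set X, IsCompact K ∧ s ⊆ K) : IntegrableOn f s μ := by
  obtain ⟨K, hK, hsK⟩ := hs
  exact (hf.continuousOn.integrableOn_compact hK).mono_set hsK

lemma ab_bdd_on {X : Type*} [TopologicalSpace X] {f : X → ℝ} (hf : Continuous f) {s : Set X}
    (hs : ∃ K : Set X, IsCompact K ∧ s ⊆ K) : ∃ C, 0 ≤ C ∧ ∀ x ∈ s, |f x| ≤ C := by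
  obtain ⟨K, hK, hsK⟩ := hs
  obtain ⟨C, hC⟩ := hK.exists_bound_of_continuousOn hf.continuousOn
  exact ⟨max C 0, le_max_right _ _, fun x hx => (hC x (hsK hx)).trans (le_max_left _ _)⟩

lemma ab_abVar_congr {X : Type*} [MeasurableSpace X] {μ : Measure X} {f g : X → ℝ}
    (h : f =ᵐ[μ] g) : abVar μ f = abVar μ g := by
  unfold abVar
  rw [integral_congr_ae h]
  congr 1
  apply integral_congr_ae
  filter_upwards [h] with x hx
  rw [hx]

lemma ab_abVar_zero {X : Type*} [MeasurableSpace X] {μ : Measure X} :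
    abVar μ (fun _ => (0:ℝ)) = 0 := by simp [abVar]

lemma ab_wirtinger_Ioo (f f' : ℝ → ℝ)
    (hf : ∀ t, HasDerivAt f (f' t) t) (hf' : Continuous f') :
    abVar ((volume : Measure ℝ).restrict (Ioo 0 1)) f
      ≤ ∫ t in Ioo (0:ℝ) 1, f' t ^ 2 / π ^ 2 := by
  have := ab_wirtinger f f' hf hf'
  simp only [intervalIntegral.integral_of_le zero_le_one, integral_Ioc_eq_integral_Ioo] at this
  rw [integral_div, le_div_iff₀ (by positivity), mul_comm]
  exact this

lemma ab_poincare_plane (g : Plane → ℝ) (hg : ContDiff ℝ 1 g) :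
    abVar ((volume : Measure Plane).restrict Q0) g
      ≤ ∫ p in Q0, ((fderiv ℝ g p (1, 0)) ^ 2 + (fderiv ℝ g p (0, 1)) ^ 2) / π ^ 2 := by
  obtain ⟨C, hC0, hC⟩ := ab_bdd_on hg.continuous ab_Q0_subset
  have hfc : Continuous (fderiv ℝ g) := hg.continuous_fderiv one_ne_zero
  let f : Plane → ℝ := Q0.indicator g
  have hfm : Measurable f := hg.continuous.measurable.indicator ab_isOpen_Q0.measurableSet
  have hfC : ∀ x, |f x| ≤ C := by
    intro x
    by_cases hx : x ∈ Q0
    · simp only [f, Set.indicator_of_mem hx]; exact hC x hx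
    · simp only [f, Set.indicator_of_notMem hx]; simpa using hC0
  have e1 : abVar ((volume : Measure Plane).restrict Q0) g
      = abVar ((volume : Measure Plane).restrict Q0) f := by
    apply ab_abVar_congr
    exact (indicator_ae_eq_restrict ab_isOpen_Q0.measurableSet).symm
  set μ := (volume : Measure ℝ).restrict (Ioo 0 1) with hμ
  have i1 : Integrable (fun p : Plane => (fderiv ℝ g p (1, 0)) ^ 2 / π ^ 2) (μ.prod μ) := by
    rw [← ab_restrict_Q0]
    exact ab_integrableOn (by fun_prop) ab_Q0_subset
  have i2 : Integrable (fun p : Plane => (fderiv ℝ g p (0, 1)) ^ 2 / π ^ 2) (μ.prod μ) := by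
    rw [← ab_restrict_Q0]
    exact ab_integrableOn (by fun_prop) ab_Q0_subset
  have hd : ∀ p : Plane, HasFDerivAt g (fderiv ℝ g p) p := fun p =>
    (hg.differentiable one_ne_zero p).hasFDerivAt
  rw [e1, ab_restrict_Q0]
  refine (ab_var_prod μ μ f hfm C hfC).trans ?_
  simp_rw [add_div]
  rw [integral_add i1 i2]
  refine add_le_add ?_ ?_
  · rw [integral_prod_symm _ i1]
    refine integral_mono_ae ?_ i1.integral_prod_right ?_
    · exact ab_integrable_bdd (ab_var_meas_fst μ hfm) fun y => ab_var_bdd μ fun x => hfC _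
    · filter_upwards [ae_restrict_mem measurableSet_Ioo] with y hy
      have : abVar μ (fun x => f (x, y)) = abVar μ (fun x => g (x, y)) := by
        apply ab_abVar_congr
        filter_upwards [ae_restrict_mem measurableSet_Ioo] with x hx
        exact Set.indicator_of_mem (show (x, y) ∈ Q0 from ⟨hx, hy⟩) _
      rw [this]
      refine ab_wirtinger_Ioo (fun x => g (x, y)) (fun x => fderiv ℝ g (x, y) (1, 0)) ?_ ?_
      · intro t
        exact (hd (t, y)).comp_hasDerivAt t ((hasDerivAt_id t).prodMk (hasDerivAt_const t y))
      · fun_prop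
  · rw [integral_prod _ i2]
    refine integral_mono_ae ?_ i2.integral_prod_left ?_
    · refine ab_integrable_bdd (C := C ^ 2 + C ^ 2) ?_ fun y => ab_var_bdd _ fun x => hfC _
      exact (ab_meas_snd _ (hfm.pow_const 2)).sub ((ab_meas_snd _ hfm).pow_const 2)
    · filter_upwards [ae_restrict_mem measurableSet_Ioo] with x hx
      have : abVar μ (fun y => f (x, y)) = abVar μ (fun y => g (x, y)) := by
        apply ab_abVar_congr
        filter_upwards [ae_restrict_mem measurableSet_Ioo] with y hy
        exact Set.indicator_of_mem (show (x, y) ∈ Q0 from ⟨hx, hy⟩) _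
      rw [this]
      refine ab_wirtinger_Ioo (fun y => g (x, y)) (fun y => fderiv ℝ g (x, y) (0, 1)) ?_ ?_
      · intro t
        exact (hd (x, t)).comp_hasDerivAt t ((hasDerivAt_const t x).prodMk (hasDerivAt_id t))
      · fun_prop

lemma ab_perpInv_cont {v : Plane} (hv : v ≠ 0) : ContinuousAt perpInv v := by
  have h : v.1 ^ 2 + v.2 ^ 2 ≠ 0 := by
    intro h
    apply hv
    have h1 : v.1 = 0 := by nlinarith [sq_nonneg v.1, sq_nonneg v.2]
    have h2 : v.2 = 0 := by nlinarith [sq_nonneg v.1, sq_nonneg v.2]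
    exact Prod.ext h1 h2
  unfold perpInv
  apply ContinuousAt.prodMk
  · exact ContinuousAt.div (by fun_prop) (by fun_prop) h
  · exact ContinuousAt.div (by fun_prop) (by fun_prop) h

lemma ab_DSq_cont {N : ℕ} (α : ℝ) {Ψ : Config N → ℂ} (h : Admissible N Ψ) (j : Fin N) :
    Continuous (DSq N α j Ψ) := by
  rw [continuous_iff_continuousAt]
  intro x
  obtain ⟨U, hU, hdU, hz⟩ := h.vanishes
  have hfc : Continuous (fderiv ℝ Ψ) := h.smooth.continuous_fderiv (by simp)
  have hΨc : Continuous Ψ := h.smooth.continuous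
  by_cases hx : x ∈ diagSet N
  · have hxU : U ∈ 𝓝 x := hU.mem_nhds (hdU hx)
    have : DSq N α j Ψ =ᶠ[𝓝 x] fun _ => 0 := by
      filter_upwards [hxU] with y hy
      have e : Ψ =ᶠ[𝓝 y] fun _ => 0 := by
        filter_upwards [hU.mem_nhds hy] with z hz'
        exact hz z hz'
      have e2 : fderiv ℝ Ψ y = 0 := by
        rw [e.fderiv_eq]; simp
      simp [DSq, DOp, pder, e2, hz y hy]
    exact continuousAt_const.congr this.symm
  · have hA : ContinuousAt (abPot N j) x := by
      unfold abPot
      have : ∀ k ∈ Finset.univ.erase j, ContinuousAt (fun y : Config N => perpInv (y j - y k)) x := by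
        intro k hk
        have hne : x j - x k ≠ 0 := by
          intro h0
          exact hx ⟨j, k, (Finset.ne_of_mem_erase hk).symm, sub_eq_zero.1 h0⟩
        exact ContinuousAt.comp (f := fun y : Config N => y j - y k) (ab_perpInv_cont hne)
          (by fun_prop)
      exact tendsto_finsetSum _ this
    have hof : Continuous Complex.ofReal := Complex.continuous_ofReal
    have h1 : ContinuousAt (fun y => Complex.ofReal (α * (abPot N j y).1)) x :=
      hof.continuousAt.comp (continuousAt_const.mul hA.fst)
    have h2 : ContinuousAt (fun y => Complex.ofReal (α * (abPot N j y).2)) x :=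
      hof.continuousAt.comp (continuousAt_const.mul hA.snd)
    have h3 : ∀ v, ContinuousAt (fun y => -Complex.I * pder N j v Ψ y) x := by
      intro v
      unfold pder
      fun_prop
    unfold DSq DOp
    exact (((h3 _).add (h1.mul hΨc.continuousAt)).norm.pow 2).add
      (((h3 _).add (h2.mul hΨc.continuousAt)).norm.pow 2)

lemma ab_DSq_nonneg {N : ℕ} (α : ℝ) (Ψ : Config N → ℂ) (j : Fin N) (x : Config N) :
    0 ≤ DSq N α j Ψ x := by unfold DSq; positivity

lemma ab_diamag_alg (ψ d : ℂ) (a u : ℝ) (hu : ‖ψ‖ ≤ u) (hu0 : 0 < u) :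
    (((starRingEnd ℂ) ψ * d).re / u) ^ 2 ≤ ‖-Complex.I * d + (a : ℂ) * ψ‖ ^ 2 := by
  have e : ((starRingEnd ℂ) ψ * d).re
      = ((starRingEnd ℂ) ψ * (Complex.I * (-Complex.I * d + (a : ℂ) * ψ))).re := by
    simp [Complex.mul_re, Complex.mul_im, Complex.add_re, Complex.add_im]
    ring
  have h1 : |((starRingEnd ℂ) ψ * d).re| ≤ ‖ψ‖ * ‖-Complex.I * d + (a : ℂ) * ψ‖ := by
    rw [e]
    refine (Complex.abs_re_le_norm _).trans ?_
    rw [norm_mul, norm_mul]; simp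
  rw [← sq_abs, abs_div, abs_of_pos hu0]
  apply pow_le_pow_left₀ (by positivity)
  rw [div_le_iff₀ hu0]
  refine h1.trans ?_
  rw [mul_comm]
  exact mul_le_mul_of_nonneg_left hu (norm_nonneg _)

lemma ab_fderiv_u {N : ℕ} (Ψ : Config N → ℂ) (h : Differentiable ℝ Ψ) (ε : ℝ) (hε : 0 < ε)
    (x w : Config N) :
    fderiv ℝ (fun x => √(‖Ψ x‖ ^ 2 + ε ^ 2)) x w
      = ((starRingEnd ℂ) (Ψ x) * fderiv ℝ Ψ x w).re / √(‖Ψ x‖ ^ 2 + ε ^ 2) := by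
  have h1 := ((h x).hasFDerivAt.norm_sq.add_const (ε ^ 2)).sqrt (by positivity)
  rw [h1.fderiv]
  simp [Complex.inner]
  field_simp

lemma ab_diamag_eps {N : ℕ} (α : ℝ) {Ψ : Config N → ℂ} (h : Admissible N Ψ) (ε : ℝ) (hε : 0 < ε) :
    abVar ((volume : Measure (Config N)).restrict (cube N Q0)) (fun x => √(‖Ψ x‖ ^ 2 + ε ^ 2))
      ≤ kinE N α Q0 Ψ / π ^ 2 := by
  set u : Config N → ℝ := fun x => √(‖Ψ x‖ ^ 2 + ε ^ 2) with hu
  have hΨ1 : ContDiff ℝ 1 Ψ := h.smooth.of_le (by simp)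
  have hΨd : Differentiable ℝ Ψ := hΨ1.differentiable one_ne_zero
  have hu1 : ContDiff ℝ 1 u := by
    apply ContDiff.sqrt
    · exact (hΨ1.norm_sq ℝ).add contDiff_const
    · intro x; positivity
  have hpos : ∀ x, 0 < u x := fun x => Real.sqrt_pos.2 (by positivity)
  have hle : ∀ x, ‖Ψ x‖ ≤ u x := fun x => Real.le_sqrt_of_sq_le (by nlinarith)
  have hcm : MeasurableSet (cube N Q0) := (ab_isOpen_cube N ab_isOpen_Q0).measurableSet
  let f := (cube N Q0).indicator u
  let G : Fin N → Config N → ℝ := fun i => (cube N Q0).indicator fun x => DSq N α i Ψ x / π ^ 2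
  obtain ⟨C0, hC00, hC0⟩ := ab_bdd_on hu1.continuous (ab_cube_subset N)
  have hb : ∀ i : Fin N, ∃ C, 0 ≤ C ∧ ∀ x ∈ cube N Q0, |DSq N α i Ψ x / π ^ 2| ≤ C := fun i =>
    ab_bdd_on ((ab_DSq_cont α h i).div_const _) (ab_cube_subset N)
  choose C1 hC10 hC1 using hb
  let C := C0 + ∑ i, C1 i
  have hCC0 : C0 ≤ C := by
    have : 0 ≤ ∑ i, C1 i := Finset.sum_nonneg fun i _ => hC10 i
    simp only [C]; linarith
  have hCC1 : ∀ i, C1 i ≤ C := by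
    intro i
    have : C1 i ≤ ∑ i, C1 i := Finset.single_le_sum (fun i _ => hC10 i) (Finset.mem_univ i)
    simp only [C]; linarith
  have key := ab_poincare_pi ((volume : Measure Plane).restrict Q0) N f G C
    (hu1.continuous.measurable.indicator hcm) ?_
    (fun i => ((ab_DSq_cont α h i).div_const _).measurable.indicator hcm) ?_ ?_
  · rw [← ab_restrict_cube] at key
    have e1 : abVar ((volume : Measure (Config N)).restrict (cube N Q0)) u
      = abVar ((volume : Measure (Config N)).restrict (cube N Q0)) f :=
      ab_abVar_congr (indicator_ae_eq_restrict hcm).symm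
    rw [e1]
    refine key.trans (le_of_eq ?_)
    unfold kinE
    rw [Finset.sum_div]
    apply Finset.sum_congr rfl
    intro i _
    rw [← integral_div]
    exact integral_congr_ae (indicator_ae_eq_restrict hcm)
  · intro x
    by_cases hx : x ∈ cube N Q0
    · simp only [f, Set.indicator_of_mem hx]; exact (hC0 x hx).trans hCC0
    · simp only [f, Set.indicator_of_notMem hx, abs_zero]; exact hC00.trans hCC0
  · intro i x
    by_cases hx : x ∈ cube N Q0
    · simp only [G, Set.indicator_of_mem hx]; exact (hC1 i x hx).trans (hCC1 i)
    · simp only [G, Set.indicator_of_notMem hx, abs_zero]; exact hC00.trans hCC0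
  · intro i x
    by_cases hx : ∀ j, j ≠ i → x j ∈ Q0
    · have hmem : ∀ t ∈ Q0, Function.update x i t ∈ cube N Q0 := by
        intro t ht j _
        by_cases hj : j = i
        · subst hj; simpa using ht
        · simpa [hj] using hx j hj
      have ef : abVar ((volume : Measure Plane).restrict Q0) (fun t => f (Function.update x i t))
          = abVar ((volume : Measure Plane).restrict Q0) (fun t => u (Function.update x i t)) := by
        apply ab_abVar_congr
        filter_upwards [ae_restrict_mem ab_isOpen_Q0.measurableSet] with t ht
        exact Set.indicator_of_mem (hmem t ht) _
      have eG : ∫ t in Q0, G i (Function.update x i t)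
          = ∫ t in Q0, DSq N α i Ψ (Function.update x i t) / π ^ 2 := by
        apply integral_congr_ae
        filter_upwards [ae_restrict_mem ab_isOpen_Q0.measurableSet] with t ht
        exact Set.indicator_of_mem (hmem t ht) _
      rw [ef, eG]
      have hupd : ContDiff ℝ 1 (fun t : Plane => Function.update x i t) := contDiff_update 1 x i
      refine (ab_poincare_plane _ (hu1.comp hupd)).trans ?_
      have hder : ∀ t v : Plane, fderiv ℝ (u ∘ fun t : Plane => Function.update x i t) t v
          = fderiv ℝ u (Function.update x i t) (Pi.single i v) := by
        intro t v
        have h1 := (hu1.differentiable one_ne_zero (Function.update x i t)).hasFDerivAt.comp t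
          (hasFDerivAt_update x t)
        have h2 : fderiv ℝ (u ∘ fun t : Plane => Function.update x i t) t = _ := h1.fderiv
        rw [h2, ContinuousLinearMap.comp_apply]
        congr 1
        ext1 l
        by_cases hl : l = i
        · subst hl; simp
        · simp [hl]
      have hcup : Continuous (fun t : Plane => Function.update x i t) := hupd.continuous
      refine integral_mono_ae ?_ ?_ ?_
      · have hc := (hu1.comp hupd).continuous_fderiv one_ne_zero
        exact ab_integrableOn (by fun_prop) ab_Q0_subset
      · exact ab_integrableOn (((ab_DSq_cont α h i).comp hcup).div_const _) ab_Q0_subset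
      · refine Filter.Eventually.of_forall fun t => ?_
        simp only [hder]
        apply div_le_div_of_nonneg_right _ (by positivity)
        simp only [hu]
        rw [ab_fderiv_u Ψ hΨd ε hε, ab_fderiv_u Ψ hΨd ε hε]
        unfold DSq DOp pder
        exact add_le_add (ab_diamag_alg _ _ _ _ (hle _) (hpos _))
          (ab_diamag_alg _ _ _ _ (hle _) (hpos _))
    · push Not at hx
      obtain ⟨j, hj, hxj⟩ := hx
      have hnm : ∀ t, Function.update x i t ∉ cube N Q0 := by
        intro t ht
        have := ht j (Set.mem_univ j)
        rw [Function.update_of_ne hj] at this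
        exact hxj this
      simp only [f, G, Set.indicator_of_notMem (hnm _)]
      simp [ab_abVar_zero]

theorem ab_diamag {N : ℕ} (α : ℝ) {Ψ : Config N → ℂ} (h : Admissible N Ψ) :
    normSq N Q0 Ψ - (∫ x in cube N Q0, ‖Ψ x‖) ^ 2 ≤ kinE N α Q0 Ψ / π ^ 2 := by
  set m := ∫ x in cube N Q0, ‖Ψ x‖ with hm
  have hΨc : Continuous Ψ := h.smooth.continuous
  have hm0 : 0 ≤ m := integral_nonneg fun x => norm_nonneg _
  have key : ∀ ε : ℝ, 0 < ε → normSq N Q0 Ψ + ε ^ 2 - (m + ε) ^ 2 ≤ kinE N α Q0 Ψ / π ^ 2 := by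
    intro ε hε
    refine le_trans ?_ (ab_diamag_eps α h ε hε)
    have i1 : IntegrableOn (fun x => ‖Ψ x‖) (cube N Q0) :=
      ab_integrableOn hΨc.norm (ab_cube_subset N)
    have i2 : IntegrableOn (fun x => ‖Ψ x‖ ^ 2) (cube N Q0) :=
      ab_integrableOn (hΨc.norm.pow 2) (ab_cube_subset N)
    have i3 : IntegrableOn (fun x => √(‖Ψ x‖ ^ 2 + ε ^ 2)) (cube N Q0) :=
      ab_integrableOn (by fun_prop) (ab_cube_subset N)
    unfold abVar
    have e1 : ∫ x in cube N Q0, √(‖Ψ x‖ ^ 2 + ε ^ 2) ^ 2 = normSq N Q0 Ψ + ε ^ 2 := by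
      have : ∀ x, √(‖Ψ x‖ ^ 2 + ε ^ 2) ^ 2 = ‖Ψ x‖ ^ 2 + ε ^ 2 :=
        fun x => Real.sq_sqrt (by positivity)
      simp_rw [this]
      rw [integral_add i2 (integrable_const _), normSq, integral_const, probReal_univ, one_smul]
    have e2 : ∫ x in cube N Q0, √(‖Ψ x‖ ^ 2 + ε ^ 2) ≤ m + ε := by
      have : m + ε = ∫ x in cube N Q0, (‖Ψ x‖ + ε) := by
        rw [integral_add i1 (integrable_const _), integral_const, probReal_univ, one_smul]
      rw [this]
      apply integral_mono i3 (i1.add (integrable_const _))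
      intro x
      show √(‖Ψ x‖ ^ 2 + ε ^ 2) ≤ ‖Ψ x‖ + ε
      apply Real.sqrt_le_iff.2
      constructor
      · positivity
      · nlinarith [norm_nonneg (Ψ x)]
    have e3 : 0 ≤ ∫ x in cube N Q0, √(‖Ψ x‖ ^ 2 + ε ^ 2) :=
      integral_nonneg fun x => Real.sqrt_nonneg _
    rw [e1]
    have := pow_le_pow_left₀ e3 e2 2
    linarith
  have hcont : Filter.Tendsto (fun ε : ℝ => normSq N Q0 Ψ + ε ^ 2 - (m + ε) ^ 2)
      (𝓝[>] 0) (𝓝 (normSq N Q0 Ψ + (0:ℝ) ^ 2 - (m + 0) ^ 2)) := by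
    apply Filter.Tendsto.mono_left _ nhdsWithin_le_nhds
    apply Continuous.tendsto (f := fun ε : ℝ => normSq N Q0 Ψ + ε ^ 2 - (m + ε) ^ 2)
    fun_prop
  have := le_of_tendsto hcont (by
    filter_upwards [self_mem_nhdsWithin] with ε hε
    exact key ε hε)
  simpa using this

/-! ### gauge functions -/

lemma ab_gauge1 (z : Plane) (δ : ℝ) (hδ : 0 < δ) : ∃ φ : Plane → ℝ, ContDiff ℝ (⊤ : ℕ∞) φ ∧
    ∀ p : Plane, δ ≤ |p.1 - z.1| → ∀ v : Plane,
      fderiv ℝ φ p v = v.1 * (perpInv (p - z)).1 + v.2 * (perpInv (p - z)).2 := by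
  let ζ : Plane → ℝ := fun p => Real.smoothTransition (4 * (p.1 - z.1) ^ 2 / δ ^ 2 - 2)
  let θ : Plane → ℝ := fun p => Real.arctan ((p.2 - z.2) / (p.1 - z.1))
  have hζ : ContDiff ℝ (⊤ : ℕ∞) ζ := Real.smoothTransition.contDiff.comp (by fun_prop)
  refine ⟨fun p => ζ p * θ p, ?_, ?_⟩
  · rw [contDiff_iff_contDiffAt]
    intro p
    by_cases hp : p.1 - z.1 = 0
    · have hev : ∀ᶠ q : Plane in 𝓝 p, 4 * (q.1 - z.1) ^ 2 / δ ^ 2 - 2 < 0 := by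
        have hc : Continuous fun q : Plane => 4 * (q.1 - z.1) ^ 2 / δ ^ 2 - 2 := by fun_prop
        apply hc.continuousAt.eventually_lt continuousAt_const
        simp [hp]
      have : (fun p => ζ p * θ p) =ᶠ[𝓝 p] fun _ => 0 := by
        filter_upwards [hev] with q hq
        simp only [ζ]
        rw [Real.smoothTransition.zero_of_nonpos hq.le, zero_mul]
      exact contDiffAt_const.congr_of_eventuallyEq this
    · refine hζ.contDiffAt.mul ?_
      apply ContDiffAt.arctan
      exact ContDiffAt.div (by fun_prop) (by fun_prop) hp
  · intro p hp v
    have hsq : δ ^ 2 ≤ (p.1 - z.1) ^ 2 := by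
      rw [← sq_abs (p.1 - z.1)]; exact pow_le_pow_left₀ hδ.le hp 2
    have hne : p.1 - z.1 ≠ 0 := by
      intro h0; rw [h0] at hsq; nlinarith [pow_pos hδ 2]
    have hev : ∀ᶠ q : Plane in 𝓝 p, 1 < 4 * (q.1 - z.1) ^ 2 / δ ^ 2 - 2 := by
      have hc : Continuous fun q : Plane => 4 * (q.1 - z.1) ^ 2 / δ ^ 2 - 2 := by fun_prop
      apply continuousAt_const.eventually_lt hc.continuousAt
      have : 4 ≤ 4 * (p.1 - z.1) ^ 2 / δ ^ 2 := by
        rw [le_div_iff₀ (by positivity)]; linarith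
      linarith
    have : (fun p => ζ p * θ p) =ᶠ[𝓝 p] θ := by
      filter_upwards [hev] with q hq
      simp only [ζ]
      rw [Real.smoothTransition.one_of_one_le hq.le, one_mul]
    rw [this.fderiv_eq]
    have hd' : DifferentiableAt ℝ θ p := by
      have : ContDiffAt ℝ 1 θ p := by
        apply ContDiffAt.arctan
        exact ContDiffAt.div (by fun_prop) (by fun_prop) hne
      exact this.differentiableAt one_ne_zero
    have hpos : (p.1 - z.1) ^ 2 + (p.2 - z.2) ^ 2 ≠ 0 := by
      nlinarith [sq_nonneg (p.2 - z.2), pow_pos hδ 2]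
    have l1 : HasDerivAt (fun t : ℝ => p.1 + t * v.1 - z.1) v.1 0 := by
      simpa using (((hasDerivAt_id (0:ℝ)).mul_const v.1).const_add p.1).sub_const z.1
    have l2 : HasDerivAt (fun t : ℝ => p.2 + t * v.2 - z.2) v.2 0 := by
      simpa using (((hasDerivAt_id (0:ℝ)).mul_const v.2).const_add p.2).sub_const z.2
    have l3 := (l2.fun_div l1 (by simpa using hne)).arctan
    have l4 : HasDerivAt (fun t : ℝ => θ (p + t • v)) (fderiv ℝ θ p v) 0 :=
      hd'.hasFDerivAt.hasLineDerivAt v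
    rw [l4.unique l3]
    have h3 : 1 + ((p.2 - z.2) / (p.1 - z.1)) ^ 2
        = ((p.1 - z.1) ^ 2 + (p.2 - z.2) ^ 2) / (p.1 - z.1) ^ 2 := by
      field_simp
    simp only [zero_mul, add_zero, perpInv, Prod.fst_sub, Prod.snd_sub, h3]
    field_simp
    ring

/-- open square with lower-left corner `c` and side `1/2` -/
def abSq (c : Plane) : Set Plane := Ioo c.1 (c.1 + 1 / 2) ×ˢ Ioo c.2 (c.2 + 1 / 2)

/-- closed square with lower-left corner `c` and side `1/2` -/
def abSqc (c : Plane) : Set Plane := Icc c.1 (c.1 + 1 / 2) ×ˢ Icc c.2 (c.2 + 1 / 2)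

lemma ab_gauge (c z : Plane) (hz : z ∉ abSqc c) : ∃ φ : Plane → ℝ, ContDiff ℝ (⊤ : ℕ∞) φ ∧
    ∀ p ∈ abSq c, ∀ v : Plane,
      fderiv ℝ φ p v = v.1 * (perpInv (p - z)).1 + v.2 * (perpInv (p - z)).2 := by
  have key : (∃ δ > 0, ∀ p ∈ abSq c, δ ≤ |p.1 - z.1|) ∨ (∃ δ > 0, ∀ p ∈ abSq c, δ ≤ |p.2 - z.2|) := by
    by_contra hcon
    push Not at hcon
    obtain ⟨hA, hB⟩ := hcon
    apply hz
    refine ⟨⟨?_, ?_⟩, ?_, ?_⟩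
    · by_contra! h
      obtain ⟨p, hp, h'⟩ := hA (c.1 - z.1) (by linarith)
      have := hp.1.1
      linarith [le_abs_self (p.1 - z.1)]
    · by_contra! h
      obtain ⟨p, hp, h'⟩ := hA (z.1 - (c.1 + 1/2)) (by linarith)
      have := hp.1.2
      linarith [neg_le_abs (p.1 - z.1)]
    · by_contra! h
      obtain ⟨p, hp, h'⟩ := hB (c.2 - z.2) (by linarith)
      have := hp.2.1
      linarith [le_abs_self (p.2 - z.2)]
    · by_contra! h
      obtain ⟨p, hp, h'⟩ := hB (z.2 - (c.2 + 1/2)) (by linarith)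
      have := hp.2.2
      linarith [neg_le_abs (p.2 - z.2)]
  rcases key with ⟨δ, hδ, h⟩ | ⟨δ, hδ, h⟩
  · obtain ⟨φ, h1, h2⟩ := ab_gauge1 z δ hδ
    exact ⟨φ, h1, fun p hp => h2 p (h p hp)⟩
  · obtain ⟨φ, h1, h2⟩ := ab_gauge1 (z.2, z.1) δ hδ
    refine ⟨fun p => - φ (p.2, p.1), (h1.comp (by fun_prop)).neg, fun p hp v => ?_⟩
    have h3 := h2 (p.2, p.1) (h p hp) (v.2, v.1)
    have hs : HasFDerivAt (fun p : Plane => ((p.2, p.1) : Plane))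
      ((ContinuousLinearMap.snd ℝ ℝ ℝ).prod (ContinuousLinearMap.fst ℝ ℝ ℝ)) p :=
      hasFDerivAt_snd.prodMk hasFDerivAt_fst
    have hφ : HasFDerivAt φ (fderiv ℝ φ (p.2, p.1)) (p.2, p.1) :=
      (h1.differentiable (by simp) _).hasFDerivAt
    have h4 := (hφ.comp p hs).neg
    have h5 : fderiv ℝ (fun p : Plane => - φ (p.2, p.1)) p = _ := h4.fderiv
    rw [h5]
    simp only [neg_apply, ContinuousLinearMap.comp_apply,
      ContinuousLinearMap.prod_apply, ContinuousLinearMap.coe_snd', ContinuousLinearMap.coe_fst']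
    rw [h3]
    simp [perpInv]
    rw [add_comm ((p.2 - z.2) ^ 2)]
    ring

lemma ab_gauge_sum {ι : Type*} (s : Finset ι) (c : Plane) (x : ι → Plane)
    (hz : ∀ l ∈ s, x l ∉ abSqc c) :
    ∃ φ : Plane → ℝ, ContDiff ℝ (⊤ : ℕ∞) φ ∧
    ∀ p ∈ abSq c, ∀ v : Plane, fderiv ℝ φ p v
      = v.1 * (∑ l ∈ s, perpInv (p - x l)).1 + v.2 * (∑ l ∈ s, perpInv (p - x l)).2 := by
  classical
  induction s using Finset.induction_on with
  | empty => exact ⟨fun _ => 0, contDiff_const, fun p _ v => by simp⟩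
  | insert a s ha ih =>
    obtain ⟨φ, h1, h2⟩ := ih fun l hl => hz l (Finset.mem_insert_of_mem hl)
    obtain ⟨φ', h1', h2'⟩ := ab_gauge c (x a) (hz a (Finset.mem_insert_self a s))
    refine ⟨fun p => φ' p + φ p, h1'.add h1, fun p hp v => ?_⟩
    rw [fderiv_fun_add (h1'.differentiable (by simp) p) (h1.differentiable (by simp) p)]
    rw [add_apply, h2 p hp, h2' p hp, Finset.sum_insert ha]
    simp
    ring

lemma ab_perpInv_half (v : Plane) : perpInv ((1 / 2 : ℝ) • v) = (2 : ℝ) • perpInv v := by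
  by_cases h : v.1 ^ 2 + v.2 ^ 2 = 0
  · have h1 : v.1 = 0 := by nlinarith [sq_nonneg v.1, sq_nonneg v.2]
    have h2 : v.2 = 0 := by nlinarith [sq_nonneg v.1, sq_nonneg v.2]
    simp [perpInv, h1, h2]
  · have h' : (1 / 2 * v.1) ^ 2 + (1 / 2 * v.2) ^ 2 = (v.1 ^ 2 + v.2 ^ 2) / 4 := by ring
    simp only [perpInv, Prod.smul_fst, Prod.smul_snd, smul_eq_mul, h', Prod.smul_mk]
    ext <;> simp only <;> field_simp <;> norm_num <;> ring

lemma ab_kinE_nonneg (N : ℕ) (α : ℝ) (Ω : Set Plane) (Ψ : Config N → ℂ) : 0 ≤ kinE N α Ω Ψ :=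
  Finset.sum_nonneg fun j _ => integral_nonneg fun x => ab_DSq_nonneg α Ψ j x

lemma ab_EN_nonneg (N : ℕ) (α : ℝ) : 0 ≤ EN N α := by
  unfold EN neumannE
  split_ifs
  · exact le_rfl
  · apply Real.sInf_nonneg
    rintro E ⟨Ψ, _, _, rfl⟩
    exact ab_kinE_nonneg _ _ _ _

lemma ab_DSq_smul {N : ℕ} (α : ℝ) {Ψ : Config N → ℂ} (h : Differentiable ℝ Ψ) (r : ℂ) (j : Fin N)
    (x : Config N) : DSq N α j (fun x => r * Ψ x) x = ‖r‖ ^ 2 * DSq N α j Ψ x := by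
  have hd : fderiv ℝ (fun x => r * Ψ x) x = r • fderiv ℝ Ψ x := fderiv_const_mul (h x) r
  have e : ∀ (d p : ℂ) (a : ℝ), -Complex.I * (r * d) + (a : ℂ) * (r * p)
      = r * (-Complex.I * d + (a : ℂ) * p) := fun d p a => by ring
  simp only [DSq, DOp, pder, hd, smul_apply, smul_eq_mul, e, norm_mul, mul_pow]
  ring

lemma ab_EN_le {n : ℕ} (hn : n ≠ 0) (α : ℝ) {Ψ : Config n → ℂ} (h : Admissible n Ψ) :
    EN n α * normSq n Q0 Ψ ≤ kinE n α Q0 Ψ := by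
  have h0 : 0 ≤ normSq n Q0 Ψ := integral_nonneg fun x => by positivity
  rcases h0.eq_or_lt with h0 | h0
  · rw [← h0, mul_zero]; exact ab_kinE_nonneg _ _ _ _
  · set s := normSq n Q0 Ψ with hs
    let r : ℂ := ((√s)⁻¹ : ℝ)
    have hr : ‖r‖ ^ 2 = s⁻¹ := by
      simp only [r, Complex.norm_real, Real.norm_eq_abs, sq_abs, inv_pow, Real.sq_sqrt h0.le]
    have hadm : Admissible n (fun x => r * Ψ x) := by
      refine ⟨contDiff_const.mul h.smooth, fun σ x => by rw [h.symm], ?_⟩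
      obtain ⟨U, h1, h2, h3⟩ := h.vanishes
      exact ⟨U, h1, h2, fun x hx => by rw [h3 x hx, mul_zero]⟩
    have hd : Differentiable ℝ Ψ := h.smooth.differentiable (by simp)
    have hn1 : normSq n Q0 (fun x => r * Ψ x) = 1 := by
      unfold normSq
      simp only [norm_mul, mul_pow, hr]
      rw [integral_const_mul]
      exact inv_mul_cancel₀ h0.ne'
    have hk : kinE n α Q0 (fun x => r * Ψ x) = s⁻¹ * kinE n α Q0 Ψ := by
      unfold kinE
      simp only [ab_DSq_smul α hd, hr, integral_const_mul, Finset.mul_sum]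
    have : EN n α ≤ kinE n α Q0 (fun x => r * Ψ x) := by
      unfold EN neumannE
      rw [if_neg hn]
      apply csInf_le
      · refine ⟨0, ?_⟩
        rintro E ⟨Φ, _, _, rfl⟩
        exact ab_kinE_nonneg _ _ _ _
      · exact ⟨_, hadm, hn1, rfl⟩
    rw [hk] at this
    calc EN n α * s ≤ (s⁻¹ * kinE n α Q0 Ψ) * s := mul_le_mul_of_nonneg_right this h0.le
      _ = kinE n α Q0 Ψ := by field_simp

/-- Rescaled embedding of the `n`-particle configuration into the `N`-particle one. -/
def abW {n N : ℕ} (e : Fin n → Fin N) (x : Config N) (c : Plane) (y : Config n) : Config N :=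
  Function.extend e (fun i => c + (1 / 2 : ℝ) • y i) x

lemma abExt_contDiff {n N : ℕ} {e : Fin n → Fin N} (he : Function.Injective e) (x : Config N) :
    ContDiff ℝ (⊤ : ℕ∞) (fun z : Config n => (Function.extend e z x : Config N)) := by
  rw [contDiff_pi]
  intro l
  by_cases hl : ∃ i, e i = l
  · obtain ⟨i, rfl⟩ := hl
    simp only [he.extend_apply]
    fun_prop
  · simp only [Function.extend_apply' _ _ _ hl]
    fun_prop

lemma abW_contDiff {n N : ℕ} {e : Fin n → Fin N} (he : Function.Injective e) (x : Config N)
    (c : Plane) : ContDiff ℝ (⊤ : ℕ∞) (abW e x c) :=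
  (abExt_contDiff he x).comp (f := fun y : Config n => fun i => c + (1 / 2 : ℝ) • y i) (by fun_prop)

lemma abW_line {n N : ℕ} {e : Fin n → Fin N} (he : Function.Injective e) (x : Config N)
    (c : Plane) (y : Config n) (i : Fin n) (v : Plane) (t : ℝ) :
    abW e x c (y + t • (Pi.single i v : Config n)) = abW e x c y + t • (Pi.single (e i) ((1 / 2 : ℝ) • v) : Config N) := by
  funext l
  by_cases hl : ∃ i, e i = l
  · obtain ⟨i', rfl⟩ := hl
    simp only [abW, Pi.add_apply, Pi.smul_apply, he.extend_apply]
    by_cases hi : i' = i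
    · subst hi; simp only [Pi.single_eq_same]; module
    · rw [Pi.single_eq_of_ne hi, Pi.single_eq_of_ne (fun h => hi (he h))]; module
  · have : l ≠ e i := fun h => hl ⟨i, h.symm⟩
    simp only [abW, Pi.add_apply, Pi.smul_apply, Function.extend_apply' _ _ _ hl]
    rw [Pi.single_eq_of_ne this]; module

/-- The gauge-transformed rescaled wave function. -/
def abG {n N : ℕ} (α : ℝ) (Ψ : Config N → ℂ) (e : Fin n → Fin N) (x : Config N) (c : Plane)
    (φ : Plane → ℝ) (y : Config n) : ℂ :=
  Complex.exp (Complex.I * ((α * ∑ i, φ (c + (1 / 2 : ℝ) • y i) : ℝ) : ℂ)) * Ψ (abW e x c y)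

lemma abG_norm {n N : ℕ} (α : ℝ) (Ψ : Config N → ℂ) (e : Fin n → Fin N) (x : Config N) (c : Plane)
    (φ : Plane → ℝ) (y : Config n) : ‖abG α Ψ e x c φ y‖ = ‖Ψ (abW e x c y)‖ := by
  rw [abG, norm_mul, mul_comm Complex.I, Complex.norm_exp_ofReal_mul_I, one_mul]

lemma abG_adm {n N : ℕ} (α : ℝ) {Ψ : Config N → ℂ} (h : Admissible N Ψ) {e : Fin n → Fin N}
    (he : Function.Injective e) (x : Config N) (c : Plane)
    {φ : Plane → ℝ} (hφ : ContDiff ℝ (⊤ : ℕ∞) φ) : Admissible n (abG α Ψ e x c φ) := by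
  refine ⟨?_, ?_, ?_⟩
  · unfold abG
    refine ContDiff.mul ?_ (h.smooth.comp (abW_contDiff he x c))
    apply ContDiff.cexp
    apply contDiff_const.mul
    refine Complex.ofRealCLM.contDiff.comp (contDiff_const.mul (ContDiff.sum fun i _ => ?_))
    exact hφ.comp (by fun_prop)
  · intro σ y
    unfold abG
    have h1 : ∑ i, φ (c + (1 / 2 : ℝ) • (y ∘ σ) i) = ∑ i, φ (c + (1 / 2 : ℝ) • y i) :=
      Equiv.sum_comp σ (fun i => φ (c + (1 / 2 : ℝ) • y i))
    have h2 : abW e x c (y ∘ σ) = abW e x c y ∘ (Equiv.Perm.viaEmbedding σ ⟨e, he⟩) := by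
      funext l
      by_cases hl : ∃ i, e i = l
      · obtain ⟨i, rfl⟩ := hl
        have := Equiv.Perm.viaEmbedding_apply σ ⟨e, he⟩ i
        simp only [Function.Embedding.coeFn_mk] at this
        simp only [Function.comp_apply, this, abW, he.extend_apply]
      · have := Equiv.Perm.viaEmbedding_apply_of_notMem σ ⟨e, he⟩ l (by simpa using hl)
        simp only [Function.comp_apply, this, abW, Function.extend_apply' _ _ _ hl]
    rw [h1, h2, h.symm]
  · obtain ⟨U, h1, h2, h3⟩ := h.vanishes
    refine ⟨abW e x c ⁻¹' U, h1.preimage (abW_contDiff he x c).continuous, ?_, ?_⟩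
    · rintro y ⟨j, k, hjk, hy⟩
      apply h2
      refine ⟨e j, e k, fun h => hjk (he h), ?_⟩
      simp only [abW, he.extend_apply, hy]
    · intro y hy
      rw [abG, h3 _ hy, mul_zero]

lemma abG_fderiv {n N : ℕ} (α : ℝ) {Ψ : Config N → ℂ} (h : Admissible N Ψ) {e : Fin n → Fin N}
    (he : Function.Injective e) (x : Config N) (c : Plane)
    {φ : Plane → ℝ} (hφ : ContDiff ℝ (⊤ : ℕ∞) φ) (y : Config n) (i : Fin n) (v : Plane) :
    fderiv ℝ (abG α Ψ e x c φ) y (Pi.single i v) =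
      Complex.exp (Complex.I * ((α * ∑ i, φ (c + (1 / 2 : ℝ) • y i) : ℝ) : ℂ)) *
      ((1 / 2 : ℂ) * fderiv ℝ Ψ (abW e x c y) (Pi.single (e i) v)
        + Complex.I * ((α * (1 / 2 * fderiv ℝ φ (c + (1 / 2 : ℝ) • y i) v) : ℝ) : ℂ)
          * Ψ (abW e x c y)) := by
  have hG : Differentiable ℝ (abG α Ψ e x c φ) :=
    (abG_adm α h he x c hφ).smooth.differentiable (by simp)
  have l0 : HasDerivAt (fun t : ℝ => abG α Ψ e x c φ (y + t • (Pi.single i v : Config n)))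
    (fderiv ℝ (abG α Ψ e x c φ) y (Pi.single i v)) 0 := (hG y).hasFDerivAt.hasLineDerivAt _
  have l1 : HasDerivAt (fun t : ℝ => Ψ (abW e x c (y + t • (Pi.single i v : Config n))))
      ((1 / 2 : ℂ) * fderiv ℝ Ψ (abW e x c y) (Pi.single (e i) v)) 0 := by
    simp_rw [abW_line he]
    have := (h.smooth.differentiable (by simp) (abW e x c y)).hasFDerivAt.hasLineDerivAt
      (Pi.single (e i) ((1 / 2 : ℝ) • v))
    rw [Pi.single_smul, map_smul] at this
    have e2 : (1 / 2 : ℝ) • fderiv ℝ Ψ (abW e x c y) (Pi.single (e i) v)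
      = (1 / 2 : ℂ) * fderiv ℝ Ψ (abW e x c y) (Pi.single (e i) v) := by
      rw [Complex.real_smul]; norm_num
    rw [e2] at this
    rw [Pi.single_smul]
    exact this
  have l2 : HasDerivAt (fun t : ℝ => ∑ i', φ (c + (1 / 2 : ℝ) • (y + t • (Pi.single i v : Config n)) i'))
      (1 / 2 * fderiv ℝ φ (c + (1 / 2 : ℝ) • y i) v) 0 := by
    have hs : (1 / 2 * fderiv ℝ φ (c + (1 / 2 : ℝ) • y i) v)
        = ∑ i', if i' = i then (1 / 2 * fderiv ℝ φ (c + (1 / 2 : ℝ) • y i) v) else 0 := by simp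
    rw [hs]
    apply HasDerivAt.fun_sum
    intro i' _
    by_cases hi : i' = i
    · subst hi
      rw [if_pos rfl]
      have := (hφ.differentiable (by simp) (c + (1 / 2 : ℝ) • y i')).hasFDerivAt.hasLineDerivAt
        ((1 / 2 : ℝ) • v)
      rw [map_smul, smul_eq_mul] at this
      refine HasDerivAt.congr_of_eventuallyEq this (Filter.Eventually.of_forall fun t => ?_)
      simp only [Pi.add_apply, Pi.smul_apply, Pi.single_eq_same]
      congr 1
      module
    · rw [if_neg hi]
      simp only [Pi.add_apply, Pi.smul_apply, Pi.single_eq_of_ne hi]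
      simpa using hasDerivAt_const (0:ℝ) (φ (c + (1 / 2 : ℝ) • y i'))
  have l3 := (((l2.const_mul α).ofReal_comp).const_mul Complex.I).cexp.fun_mul l1
  have := l0.unique l3
  rw [this]
  simp only [zero_smul, add_zero]
  ring

lemma ab_abPot_W {n N : ℕ} {e : Fin n → Fin N} (he : Function.Injective e) (x : Config N)
    (c : Plane) (y : Config n) (i : Fin n) :
    abPot N (e i) (abW e x c y) = (2 : ℝ) • abPot n i y
      + ∑ l ∈ Finset.univ \ Finset.univ.image e, perpInv (c + (1 / 2 : ℝ) • y i - x l) := by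
  have hset : (Finset.univ.erase (e i) : Finset (Fin N))
      = (Finset.univ.erase i).image e ∪ (Finset.univ \ Finset.univ.image e) := by
    ext l
    simp only [Finset.mem_erase, Finset.mem_univ, and_true, Finset.mem_union, Finset.mem_image,
      Finset.mem_sdiff, true_and]
    constructor
    · intro hl
      by_cases h : ∃ a, e a = l
      · left
        obtain ⟨a, rfl⟩ := h
        exact ⟨a, fun h => hl (by rw [h]), rfl⟩
      · exact Or.inr h
    · rintro (⟨a, ha, rfl⟩ | h)
      · exact fun h => ha (he h)
      · rintro rfl; exact h ⟨i, rfl⟩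
  have hdis : Disjoint ((Finset.univ.erase i).image e) (Finset.univ \ Finset.univ.image e) := by
    rw [Finset.disjoint_left]
    intro a ha hb
    simp only [Finset.mem_image, Finset.mem_sdiff, Finset.mem_univ, true_and] at ha hb
    obtain ⟨a', _, rfl⟩ := ha
    exact hb ⟨a', rfl⟩
  unfold abPot
  rw [hset, Finset.sum_union hdis, Finset.sum_image (fun a _ b _ h => he h), Finset.smul_sum]
  congr 1
  · apply Finset.sum_congr rfl
    intro k _
    simp only [abW, he.extend_apply]
    rw [← ab_perpInv_half]
    congr 1
    module
  · apply Finset.sum_congr rfl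
    intro l hl
    have hl' : ¬ ∃ a, e a = l := by simpa using hl
    simp only [abW, he.extend_apply, Function.extend_apply' _ _ _ hl']

lemma abG_DSq {n N : ℕ} (α : ℝ) {Ψ : Config N → ℂ} (h : Admissible N Ψ) {e : Fin n → Fin N}
    (he : Function.Injective e) (x : Config N) (c : Plane)
    {φ : Plane → ℝ} (hφ : ContDiff ℝ (⊤ : ℕ∞) φ)
    (hφ' : ∀ p ∈ abSq c, ∀ v : Plane, fderiv ℝ φ p v
      = v.1 * (∑ l ∈ Finset.univ \ Finset.univ.image e, perpInv (p - x l)).1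
        + v.2 * (∑ l ∈ Finset.univ \ Finset.univ.image e, perpInv (p - x l)).2)
    (y : Config n) (hy : ∀ i, c + (1 / 2 : ℝ) • y i ∈ abSq c) (i : Fin n) :
    DSq n α i (abG α Ψ e x c φ) y = 1 / 4 * DSq N α (e i) Ψ (abW e x c y) := by
  set E := Complex.exp (Complex.I * ((α * ∑ i, φ (c + (1 / 2 : ℝ) • y i) : ℝ) : ℂ)) with hE
  have hEn : ‖E‖ = 1 := by rw [hE, mul_comm Complex.I, Complex.norm_exp_ofReal_mul_I]
  have hG : abG α Ψ e x c φ y = E * Ψ (abW e x c y) := rfl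
  have e1 : (DOp n α i (abG α Ψ e x c φ) y).1
      = (1 / 2 : ℂ) * E * (DOp N α (e i) Ψ (abW e x c y)).1 := by
    simp only [DOp, pder, abG_fderiv α h he x c hφ, hG, ab_abPot_W he, hφ' _ (hy i), ← hE]
    push_cast
    simp only [Prod.fst_add, Prod.smul_fst, smul_eq_mul, one_mul, zero_mul, add_zero]
    push_cast
    linear_combination (-(1/2) * E * α * ((∑ l ∈ Finset.univ \ Finset.univ.image e, perpInv (c + (1 / 2 : ℝ) • y i - x l)).1 : ℂ) * Ψ (abW e x c y)) * Complex.I_mul_I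
  have e2 : (DOp n α i (abG α Ψ e x c φ) y).2
      = (1 / 2 : ℂ) * E * (DOp N α (e i) Ψ (abW e x c y)).2 := by
    simp only [DOp, pder, abG_fderiv α h he x c hφ, hG, ab_abPot_W he, hφ' _ (hy i), ← hE]
    push_cast
    simp only [Prod.snd_add, Prod.smul_snd, smul_eq_mul, one_mul, zero_mul, zero_add]
    push_cast
    linear_combination (-(1/2) * E * α * ((∑ l ∈ Finset.univ \ Finset.univ.image e, perpInv (c + (1 / 2 : ℝ) • y i - x l)).2 : ℂ) * Ψ (abW e x c y)) * Complex.I_mul_I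
  unfold DSq
  rw [e1, e2]
  simp only [norm_mul, hEn]
  norm_num
  ring

lemma ab_mem_abSq (c p : Plane) : c + (1 / 2 : ℝ) • p ∈ abSq c ↔ p ∈ Q0 := by
  simp only [abSq, Q0, Set.mem_prod, Set.mem_Ioo, Prod.fst_add, Prod.snd_add, Prod.smul_fst,
    Prod.smul_snd, smul_eq_mul]
  constructor
  · rintro ⟨⟨h1, h2⟩, h3, h4⟩
    refine ⟨⟨?_, ?_⟩, ?_, ?_⟩ <;> linarith
  · rintro ⟨⟨h1, h2⟩, h3, h4⟩
    refine ⟨⟨?_, ?_⟩, ?_, ?_⟩ <;> linarith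

lemma ab_scale (n : ℕ) (c : Plane) : ∃ κ : ℝ, 0 < κ ∧ ∀ F : Config n → ℝ,
    ∫ y in cube n Q0, F (fun i => c + (1 / 2 : ℝ) • y i) = κ * ∫ z in cube n (abSq c), F z := by
  refine ⟨|((1 / 2 : ℝ) ^ Module.finrank ℝ (Config n))⁻¹|, by positivity, fun F => ?_⟩
  have m1 : MeasurableSet (cube n Q0) := (ab_isOpen_cube n ab_isOpen_Q0).measurableSet
  have m2 : MeasurableSet (cube n (abSq c)) :=
    (ab_isOpen_cube n (isOpen_Ioo.prod isOpen_Ioo)).measurableSet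
  rw [← integral_indicator m1, ← integral_indicator m2]
  have h1 : ∀ y : Config n, (cube n Q0).indicator (fun y => F (fun i => c + (1 / 2 : ℝ) • y i)) y
      = (fun z : Config n => (cube n (abSq c)).indicator F ((fun _ => c) + z)) ((1 / 2 : ℝ) • y) := by
    intro y
    have hiff : ((fun _ => c) + (1 / 2 : ℝ) • y ∈ cube n (abSq c)) ↔ y ∈ cube n Q0 := by
      simp only [cube, Set.mem_univ_pi, Pi.add_apply, Pi.smul_apply, ab_mem_abSq]
    by_cases hy : y ∈ cube n Q0
    · simp only
      rw [Set.indicator_of_mem hy, Set.indicator_of_mem (hiff.2 hy)]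
      rfl
    · simp only
      rw [Set.indicator_of_notMem hy, Set.indicator_of_notMem (fun h => hy (hiff.1 h))]
  simp_rw [h1]
  rw [Measure.integral_comp_smul volume
    (fun z : Config n => (cube n (abSq c)).indicator F ((fun _ => c) + z)) (1 / 2 : ℝ),
    integral_add_left_eq_self, smul_eq_mul]

lemma ab_pair_fiber {n N : ℕ} (hn : n ≠ 0) (α : ℝ) {Ψ : Config N → ℂ} (h : Admissible N Ψ)
    {e : Fin n → Fin N} (he : Function.Injective e) (x : Config N) (c : Plane)
    (hx : ∀ l, (¬ ∃ i, e i = l) → x l ∉ abSqc c) :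
    4 * EN n α * ∫ z in cube n (abSq c), ‖Ψ (Function.extend e z x)‖ ^ 2
      ≤ ∑ i, ∫ z in cube n (abSq c), DSq N α (e i) Ψ (Function.extend e z x) := by
  obtain ⟨φ, hφ, hφ'⟩ := ab_gauge_sum (Finset.univ \ Finset.univ.image e) c x
    (fun l hl => hx l (by simpa using hl))
  have hadm := abG_adm α h he x c hφ
  have key := ab_EN_le hn α hadm
  obtain ⟨κ, hκ, hs⟩ := ab_scale n c
  have e1 : normSq n Q0 (abG α Ψ e x c φ)
      = κ * ∫ z in cube n (abSq c), ‖Ψ (Function.extend e z x)‖ ^ 2 := by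
    rw [← hs]
    unfold normSq
    simp_rw [abG_norm]
    rfl
  have e2 : kinE n α Q0 (abG α Ψ e x c φ)
      = κ * (1 / 4 * ∑ i, ∫ z in cube n (abSq c), DSq N α (e i) Ψ (Function.extend e z x)) := by
    unfold kinE
    rw [Finset.mul_sum, Finset.mul_sum]
    apply Finset.sum_congr rfl
    intro i _
    rw [mul_left_comm, ← hs, ← integral_const_mul]
    apply setIntegral_congr_fun (ab_isOpen_cube n ab_isOpen_Q0).measurableSet
    intro y hy
    exact abG_DSq α h he x c hφ hφ' y (fun i => (ab_mem_abSq c _).2 (hy i (Set.mem_univ i))) i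
  rw [e1, e2] at key
  have : EN n α * ∫ z in cube n (abSq c), ‖Ψ (Function.extend e z x)‖ ^ 2
    ≤ 1 / 4 * ∑ i, ∫ z in cube n (abSq c), DSq N α (e i) Ψ (Function.extend e z x) := by
    apply le_of_mul_le_mul_left _ hκ
    linarith
  linarith

lemma ab_mp_extend {n N : ℕ} {e : Fin n → Fin N} (he : Function.Injective e)
    {X : Type*} [MeasurableSpace X] (μ : Measure X) [IsProbabilityMeasure μ] :
    MeasurePreserving (fun w : (Fin N → X) × (Fin n → X) => (Function.extend e w.2 w.1 : Fin N → X))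
      ((Measure.pi fun _ : Fin N => μ).prod (Measure.pi fun _ : Fin n => μ))
      (Measure.pi fun _ : Fin N => μ) := by
  classical
  have hm : Measurable
      (fun w : (Fin N → X) × (Fin n → X) => (Function.extend e w.2 w.1 : Fin N → X)) := by
    rw [measurable_pi_iff]
    intro l
    by_cases hl : ∃ i, e i = l
    · obtain ⟨i, rfl⟩ := hl
      simp only [he.extend_apply]
      fun_prop
    · simp only [Function.extend_apply' _ _ _ hl]
      fun_prop
  refine ⟨hm, ?_⟩
  symm
  apply Measure.pi_eq
  intro s hs
  rw [Measure.map_apply hm (MeasurableSet.univ_pi hs)]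
  have hpre : (fun w : (Fin N → X) × (Fin n → X) => (Function.extend e w.2 w.1 : Fin N → X)) ⁻¹'
      (Set.univ.pi s) = (Set.univ.pi fun l => if l ∈ Finset.univ.image e then Set.univ else s l) ×ˢ
        (Set.univ.pi fun i => s (e i)) := by
    ext w
    simp only [Set.mem_preimage, Set.mem_univ_pi, Set.mem_prod]
    constructor
    · intro hw
      refine ⟨fun l => ?_, fun i => ?_⟩
      · split_ifs with hl
        · trivial
        · have := hw l
          rwa [Function.extend_apply' _ _ _ (by simpa using hl)] at this
      · have := hw (e i)
        rwa [he.extend_apply] at this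
    · rintro ⟨h1, h2⟩ l
      by_cases hl : ∃ i, e i = l
      · obtain ⟨i, rfl⟩ := hl
        rw [he.extend_apply]; exact h2 i
      · have := h1 l
        rw [if_neg (by simpa using hl)] at this
        rwa [Function.extend_apply' _ _ _ hl]
  rw [hpre, Measure.prod_prod, Measure.pi_pi, Measure.pi_pi]
  rw [← Finset.prod_mul_prod_compl (Finset.univ.image e) (fun i => μ (s i)),
    Finset.prod_image (fun a _ b _ h => he h), mul_comm]
  congr 1
  rw [← Finset.prod_mul_prod_compl (Finset.univ.image e)]
  have h1 : ∏ i ∈ Finset.univ.image e,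
      μ (if i ∈ Finset.univ.image e then Set.univ else s i) = 1 := by
    apply Finset.prod_eq_one
    intro i hi
    rw [if_pos hi, measure_univ]
  rw [h1, one_mul]
  apply Finset.prod_congr rfl
  intro i hi
  rw [if_neg (Finset.mem_compl.1 hi)]

/-- particles `e i` in the open square, the others outside the closed one -/
def abB {n N : ℕ} (e : Fin n → Fin N) (c : Plane) : Set (Config N) :=
  {w | (∀ i, w (e i) ∈ abSq c) ∧ ∀ l, (¬ ∃ i, e i = l) → w l ∉ abSqc c}

open Classical in
lemma abB_eq {n N : ℕ} (e : Fin n → Fin N) (c : Plane) :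
    abB e c = Set.univ.pi fun l => if l ∈ Finset.univ.image e then abSq c else (abSqc c)ᶜ := by
  ext w
  simp only [abB, Set.mem_ofPred_eq, Set.mem_univ_pi]
  constructor
  · rintro ⟨h1, h2⟩ l
    split_ifs with hl
    · obtain ⟨i, _, rfl⟩ := Finset.mem_image.1 hl
      exact h1 i
    · exact h2 l (by simpa using hl)
  · intro h
    refine ⟨fun i => ?_, fun l hl => ?_⟩
    · have := h (e i)
      rwa [if_pos (Finset.mem_image_of_mem e (Finset.mem_univ i))] at this
    · have := h l
      rwa [if_neg (by simpa using hl)] at this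

lemma abSq_meas (c : Plane) : MeasurableSet (abSq c) := measurableSet_Ioo.prod measurableSet_Ioo
lemma abSqc_meas (c : Plane) : MeasurableSet (abSqc c) := measurableSet_Icc.prod measurableSet_Icc

lemma abB_meas {n N : ℕ} (e : Fin n → Fin N) (c : Plane) : MeasurableSet (abB e c) := by
  classical
  rw [abB_eq]
  apply MeasurableSet.univ_pi
  intro l
  split_ifs
  · exact abSq_meas c
  · exact (abSqc_meas c).compl

/-- corners of the four squares -/
def abCorner (q : Fin 2 × Fin 2) : Plane := ((q.1 : ℕ) / 2, (q.2 : ℕ) / 2)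

lemma ab_corner_sub (q : Fin 2 × Fin 2) : abSq (abCorner q) ⊆ Q0 := by
  rintro p ⟨⟨h1, h2⟩, h3, h4⟩
  have a1 : ((q.1 : ℕ) : ℝ) ≤ 1 := by exact_mod_cast Nat.lt_succ_iff.1 q.1.2
  have a2 : ((q.2 : ℕ) : ℝ) ≤ 1 := by exact_mod_cast Nat.lt_succ_iff.1 q.2.2
  have b1 : (0:ℝ) ≤ ((q.1 : ℕ) : ℝ) := by positivity
  have b2 : (0:ℝ) ≤ ((q.2 : ℕ) : ℝ) := by positivity
  simp only [abCorner] at h1 h2 h3 h4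
  refine ⟨⟨?_, ?_⟩, ?_, ?_⟩ <;> linarith

lemma ab_corner_subc (q : Fin 2 × Fin 2) : abSqc (abCorner q) ⊆ Icc (0:ℝ) 1 ×ˢ Icc (0:ℝ) 1 := by
  rintro p ⟨⟨h1, h2⟩, h3, h4⟩
  have a1 : ((q.1 : ℕ) : ℝ) ≤ 1 := by exact_mod_cast Nat.lt_succ_iff.1 q.1.2
  have a2 : ((q.2 : ℕ) : ℝ) ≤ 1 := by exact_mod_cast Nat.lt_succ_iff.1 q.2.2
  have b1 : (0:ℝ) ≤ ((q.1 : ℕ) : ℝ) := by positivity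
  have b2 : (0:ℝ) ≤ ((q.2 : ℕ) : ℝ) := by positivity
  simp only [abCorner] at h1 h2 h3 h4
  refine ⟨⟨?_, ?_⟩, ?_, ?_⟩ <;> linarith

lemma ab_corner_inj {q q' : Fin 2 × Fin 2} {p : Plane} (h : p ∈ abSq (abCorner q))
    (h' : p ∈ abSq (abCorner q')) : q = q' := by
  obtain ⟨⟨h1, h2⟩, h3, h4⟩ := h
  obtain ⟨⟨h1', h2'⟩, h3', h4'⟩ := h'
  simp only [abCorner] at h1 h2 h3 h4 h1' h2' h3' h4'
  have a1 : ((q.1 : ℕ) : ℝ) < (q'.1 : ℕ) + 1 := by linarith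
  have a2 : ((q'.1 : ℕ) : ℝ) < (q.1 : ℕ) + 1 := by linarith
  have a3 : ((q.2 : ℕ) : ℝ) < (q'.2 : ℕ) + 1 := by linarith
  have a4 : ((q'.2 : ℕ) : ℝ) < (q.2 : ℕ) + 1 := by linarith
  norm_cast at a1 a2 a3 a4
  ext <;> omega

lemma ab_vol_Sq (q : Fin 2 × Fin 2) :
    ((volume : Measure Plane).restrict Q0).real (abSq (abCorner q)) = 1 / 4 := by
  rw [measureReal_restrict_apply (abSq_meas _),
    Set.inter_eq_left.2 (ab_corner_sub q), abSq, Measure.volume_eq_prod, measureReal_prod_prod]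
  simp [measureReal_def, Real.volume_Ioo]
  norm_num

lemma ab_vol_Sqc (q : Fin 2 × Fin 2) :
    ((volume : Measure Plane).restrict Q0).real (abSqc (abCorner q))ᶜ = 3 / 4 := by
  rw [probReal_compl_eq_one_sub (abSqc_meas _)]
  have h : Q0 =ᵐ[(volume : Measure Plane)] (Icc (0:ℝ) 1 ×ˢ Icc (0:ℝ) 1 : Set Plane) := by
    rw [Q0, Measure.volume_eq_prod]
    exact Measure.set_prod_ae_eq Ioo_ae_eq_Icc Ioo_ae_eq_Icc
  rw [Measure.restrict_congr_set h, measureReal_restrict_apply (abSqc_meas _),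
    Set.inter_eq_left.2 (ab_corner_subc q), abSqc, Measure.volume_eq_prod, measureReal_prod_prod]
  simp [measureReal_def, Real.volume_Icc]
  norm_num

lemma abB_vol {n N : ℕ} {e : Fin n → Fin N} (he : Function.Injective e) (q : Fin 2 × Fin 2) :
    ∫ x in cube N Q0, (abB e (abCorner q)).indicator (fun _ => (1:ℝ)) x
      = (1 / 4) ^ n * (3 / 4) ^ (N - n) := by
  classical
  rw [integral_indicator_const _ (abB_meas _ _), smul_eq_mul, mul_one, ab_restrict_cube, abB_eq,
    measureReal_def, Measure.pi_pi, ENNReal.toReal_prod,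
    ← Finset.prod_mul_prod_compl (Finset.univ.image e)]
  congr 1
  · rw [Finset.prod_congr rfl (g := fun _ => (1 / 4 : ℝ))]
    · rw [Finset.prod_const, Finset.card_image_of_injective _ he]; simp
    · intro l hl
      rw [if_pos hl]; exact ab_vol_Sq q
  · rw [Finset.prod_congr rfl (g := fun _ => (3 / 4 : ℝ))]
    · rw [Finset.prod_const, Finset.card_compl, Finset.card_image_of_injective _ he]; simp
    · intro l hl
      rw [if_neg (Finset.mem_compl.1 hl)]; exact ab_vol_Sqc q

lemma abB_fiber {n N : ℕ} {e : Fin n → Fin N} (he : Function.Injective e) (q : Fin 2 × Fin 2)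
    (F : Config N → ℝ) (hF : Continuous F) :
    (∫ w in cube N Q0, (abB e (abCorner q)).indicator F w
      = ∫ x in cube N Q0, {x : Config N | ∀ l, (¬ ∃ i, e i = l) → x l ∉ abSqc (abCorner q)}.indicator
        (fun x => ∫ z in cube n (abSq (abCorner q)), F (Function.extend e z x)) x) ∧
    IntegrableOn ({x : Config N | ∀ l, (¬ ∃ i, e i = l) → x l ∉ abSqc (abCorner q)}.indicator
        (fun x => ∫ z in cube n (abSq (abCorner q)), F (Function.extend e z x))) (cube N Q0) := by
  set c := abCorner q
  have mp := ab_mp_extend he ((volume : Measure Plane).restrict Q0)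
  rw [← ab_restrict_cube, ← ab_restrict_cube] at mp
  have iF : IntegrableOn ((abB e c).indicator F) (cube N Q0) :=
    (ab_integrableOn hF (ab_cube_subset N)).indicator (abB_meas e c)
  have iF2 := mp.integrable_comp_of_integrable iF
  have hin : ∀ x : Config N, ∫ z in cube n Q0, (abB e c).indicator F (Function.extend e z x)
      = {x : Config N | ∀ l, (¬ ∃ i, e i = l) → x l ∉ abSqc c}.indicator
        (fun x => ∫ z in cube n (abSq c), F (Function.extend e z x)) x := by
    intro x
    by_cases hx : x ∈ {x : Config N | ∀ l, (¬ ∃ i, e i = l) → x l ∉ abSqc c}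
    · rw [Set.indicator_of_mem hx]
      have m2 : MeasurableSet (cube n (abSq c)) :=
        (ab_isOpen_cube n (isOpen_Ioo.prod isOpen_Ioo)).measurableSet
      have : ∀ z : Config n, (abB e c).indicator F (Function.extend e z x)
          = (cube n (abSq c)).indicator (fun z => F (Function.extend e z x)) z := by
        intro z
        have hiff : (Function.extend e z x : Config N) ∈ abB e c ↔ z ∈ cube n (abSq c) := by
          simp only [abB, cube, Set.mem_ofPred_eq, Set.mem_univ_pi, he.extend_apply]
          refine ⟨fun h => h.1, fun h => ⟨h, fun l hl => ?_⟩⟩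
          rw [Function.extend_apply' _ _ _ hl]
          exact hx l hl
        by_cases hz : z ∈ cube n (abSq c)
        · rw [Set.indicator_of_mem hz, Set.indicator_of_mem (hiff.2 hz)]
        · rw [Set.indicator_of_notMem hz, Set.indicator_of_notMem fun h => hz (hiff.1 h)]
      simp_rw [this]
      rw [integral_indicator m2, Measure.restrict_restrict m2]
      have hsub : cube n (abSq c) ⊆ cube n Q0 := Set.pi_mono fun _ _ => ab_corner_sub q
      rw [Set.inter_eq_left.2 hsub]
    · rw [Set.indicator_of_notMem hx]
      have : ∀ z : Config n, (abB e c).indicator F (Function.extend e z x) = 0 := by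
        intro z
        apply Set.indicator_of_notMem
        intro h
        apply hx
        intro l hl
        have := h.2 l hl
        rwa [Function.extend_apply' _ _ _ hl] at this
      simp [this]
  constructor
  · have h1 := integral_map mp.measurable.aemeasurable
      (f := (abB e c).indicator F) (by rw [mp.map_eq]; exact iF.aestronglyMeasurable)
    rw [mp.map_eq] at h1
    rw [h1]
    refine (integral_prod _ iF2).trans ?_
    exact integral_congr_ae (Filter.Eventually.of_forall hin)
  · exact iF2.integral_prod_left.congr (Filter.Eventually.of_forall hin)

theorem ab_pair {n N : ℕ} (hn : n ≠ 0) (α : ℝ) {Ψ : Config N → ℂ} (h : Admissible N Ψ)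
    {e : Fin n → Fin N} (he : Function.Injective e) (q : Fin 2 × Fin 2) :
    4 * EN n α * ∫ w in cube N Q0, (abB e (abCorner q)).indicator (fun w => ‖Ψ w‖ ^ 2) w
      ≤ ∑ i, ∫ w in cube N Q0, (abB e (abCorner q)).indicator (DSq N α (e i) Ψ) w := by
  have hΨc : Continuous Ψ := h.smooth.continuous
  have f1 := abB_fiber he q (fun w => ‖Ψ w‖ ^ 2) (by fun_prop)
  have f2 := fun i => abB_fiber he q (DSq N α (e i) Ψ) (ab_DSq_cont α h _)
  rw [f1.1, Finset.sum_congr rfl (fun i _ => (f2 i).1), ← integral_const_mul,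
    ← integral_finsetSum _ (fun i _ => (f2 i).2)]
  refine integral_mono (f1.2.const_mul _) (integrable_finsetSum _ fun i _ => (f2 i).2) ?_
  intro x
  by_cases hx : x ∈ {x : Config N | ∀ l, (¬ ∃ i, e i = l) → x l ∉ abSqc (abCorner q)}
  · simp only [Set.indicator_of_mem hx]
    exact ab_pair_fiber hn α h he x _ hx
  · simp only [Set.indicator_of_notMem hx]
    simp

/-- index set: a sub-square together with an ordered pair of distinct particles -/
def abI (N : ℕ) : Finset ((Fin 2 × Fin 2) × (Fin N × Fin N)) :=
  Finset.univ ×ˢ (Finset.univ : Finset (Fin N)).offDiag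

/-- the event that exactly the given pair sits in the given square -/
def abE {N : ℕ} (r : (Fin 2 × Fin 2) × (Fin N × Fin N)) : Set (Config N) :=
  abB ![r.2.1, r.2.2] (abCorner r.1)

lemma abE_mem {N : ℕ} {r : (Fin 2 × Fin 2) × (Fin N × Fin N)} {x : Config N} (h : x ∈ abE r) :
    x r.2.1 ∈ abSq (abCorner r.1) ∧ x r.2.2 ∈ abSq (abCorner r.1) ∧
      ∀ l, x l ∈ abSq (abCorner r.1) → l = r.2.1 ∨ l = r.2.2 := by
  obtain ⟨h1, h2⟩ := h
  refine ⟨h1 0, h1 1, fun l hl => ?_⟩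
  by_contra hne
  push Not at hne
  refine h2 l ?_ (Set.prod_mono Ioo_subset_Icc_self Ioo_subset_Icc_self hl)
  rintro ⟨i, hi⟩
  fin_cases i
  · exact hne.1 hi.symm
  · exact hne.2 hi.symm

lemma abI_mem {N : ℕ} {r : (Fin 2 × Fin 2) × (Fin N × Fin N)} : r ∈ abI N ↔ r.2.1 ≠ r.2.2 := by
  simp [abI, Finset.mem_product, Finset.mem_offDiag]

lemma abI_card (N : ℕ) : ((abI N).card : ℝ) = 8 * (N.choose 2 : ℝ) := by
  rw [abI, Finset.card_product, Finset.offDiag_card, Nat.cast_choose_two]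
  have : N ≤ N * N := Nat.le_mul_self N
  simp only [Finset.card_univ, Fintype.card_prod, Fintype.card_fin]
  push_cast [Nat.cast_sub this]
  ring

lemma abE_inj {N : ℕ} (r : (Fin 2 × Fin 2) × (Fin N × Fin N)) (hr : r ∈ abI N) :
    Function.Injective ![r.2.1, r.2.2] := by
  have h := abI_mem.1 hr
  intro i j hij
  fin_cases i <;> fin_cases j <;> simp_all

open Classical in
lemma abE_card {N : ℕ} (x : Config N) : ((abI N).filter (fun r => x ∈ abE r)).card ≤ 8 := by
  have : (Finset.univ : Finset ((Fin 2 × Fin 2) × Bool)).card = 8 := by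
    simp
  rw [← this]
  apply Finset.card_le_card_of_injOn (fun r => (r.1, decide (r.2.1 < r.2.2)))
    (fun _ _ => Finset.mem_coe.2 (Finset.mem_univ _))
  intro r hr r' hr' hrr
  simp only [Finset.coe_filter, Set.mem_ofPred_eq, abI_mem] at hr hr'
  simp only [Prod.mk.injEq] at hrr
  obtain ⟨q, j, k⟩ := r
  obtain ⟨q', j', k'⟩ := r'
  obtain ⟨rfl, h2⟩ := hrr
  obtain ⟨hjk, hx⟩ := hr
  obtain ⟨hjk', hx'⟩ := hr'
  have m := abE_mem hx
  have m' := abE_mem hx'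
  simp only at m m' h2 hjk hjk'
  have a1 := m.2.2 _ m'.1
  have a2 := m.2.2 _ m'.2.1
  simp only [decide_eq_decide] at h2
  have : j = j' ∧ k = k' := by omega
  rw [this.1, this.2]

open Classical in
lemma abE_sum1 {N : ℕ} (x : Config N) (a : Fin N → ℝ) (ha : ∀ j, 0 ≤ a j) :
    ∑ r ∈ (abI N).filter (fun r => x ∈ abE r), a r.2.1 ≤ ∑ j, a j := by
  rw [← Finset.sum_image (f := a) (g := fun r : (Fin 2 × Fin 2) × (Fin N × Fin N) => r.2.1)]
  · exact Finset.sum_le_sum_of_subset_of_nonneg (Finset.subset_univ _) fun j _ _ => ha j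
  intro r hr r' hr' hrr
  simp only [Finset.coe_filter, Set.mem_ofPred_eq, abI_mem] at hr hr'
  obtain ⟨q, j, k⟩ := r
  obtain ⟨q', j', k'⟩ := r'
  obtain ⟨hjk, hx⟩ := hr
  obtain ⟨hjk', hx'⟩ := hr'
  have m := abE_mem hx
  have m' := abE_mem hx'
  simp only at m m' hrr hjk hjk'
  subst hrr
  have hq := ab_corner_inj m.1 m'.1
  subst hq
  have a2 := m.2.2 _ m'.2.1
  have : k = k' := by omega
  rw [this]

open Classical in
lemma abE_sum2 {N : ℕ} (x : Config N) (a : Fin N → ℝ) (ha : ∀ j, 0 ≤ a j) :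
    ∑ r ∈ (abI N).filter (fun r => x ∈ abE r), a r.2.2 ≤ ∑ j, a j := by
  rw [← Finset.sum_image (f := a) (g := fun r : (Fin 2 × Fin 2) × (Fin N × Fin N) => r.2.2)]
  · exact Finset.sum_le_sum_of_subset_of_nonneg (Finset.subset_univ _) fun j _ _ => ha j
  intro r hr r' hr' hrr
  simp only [Finset.coe_filter, Set.mem_ofPred_eq, abI_mem] at hr hr'
  obtain ⟨q, j, k⟩ := r
  obtain ⟨q', j', k'⟩ := r'
  obtain ⟨hjk, hx⟩ := hr
  obtain ⟨hjk', hx'⟩ := hr'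
  have m := abE_mem hx
  have m' := abE_mem hx'
  simp only at m m' hrr hjk hjk'
  subst hrr
  have hq := ab_corner_inj m.2.1 m'.2.1
  subst hq
  have a2 := m.2.2 _ m'.1
  have : j = j' := by omega
  rw [this]

/-- the counting function -/
def abS {N : ℕ} (x : Config N) : ℝ := ∑ r ∈ abI N, (abE r).indicator (fun _ => (1:ℝ)) x

lemma ab_sum_ind {N : ℕ} (x : Config N) (g : (Fin 2 × Fin 2) × (Fin N × Fin N) → Config N → ℝ) :
    open Classical in
    ∑ r ∈ abI N, (abE r).indicator (g r) x
      = ∑ r ∈ (abI N).filter (fun r => x ∈ abE r), g r x := by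
  classical
  rw [Finset.sum_filter]
  exact Finset.sum_congr rfl fun r _ => by rw [Set.indicator_apply]

lemma abS_nonneg {N : ℕ} (x : Config N) : 0 ≤ abS x :=
  Finset.sum_nonneg fun _ _ => Set.indicator_nonneg (fun _ _ => zero_le_one) _

lemma abS_le {N : ℕ} (x : Config N) : abS x ≤ 8 := by
  classical
  rw [abS, ab_sum_ind x (fun _ _ => 1), Finset.sum_const, nsmul_eq_mul, mul_one]
  exact_mod_cast abE_card x

lemma abS_meas (N : ℕ) : Measurable (abS : Config N → ℝ) := by
  unfold abS
  exact Finset.measurable_sum _ fun r _ => measurable_const.indicator (abB_meas _ _)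

lemma abS_int (N : ℕ) : ∫ x in cube N Q0, abS x
    = ((N.choose 2 : ℝ) * (3 / 4) ^ (N - 2)) / 2 := by
  unfold abS
  rw [integral_finsetSum _ fun r _ => (integrable_const _).indicator (abB_meas _ _)]
  have e : ∀ r ∈ abI N, ∫ x in cube N Q0, (abE r).indicator (fun _ => (1:ℝ)) x
      = (1 / 4) ^ 2 * (3 / 4) ^ (N - 2) := fun r hr => abB_vol (abE_inj r hr) r.1
  rw [Finset.sum_congr rfl e, Finset.sum_const, nsmul_eq_mul, abI_card]
  ring

lemma abE_meas {N : ℕ} (r : (Fin 2 × Fin 2) × (Fin N × Fin N)) : MeasurableSet (abE r) :=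
  abB_meas _ _

theorem ab_pairs {N : ℕ} (α : ℝ) {Ψ : Config N → ℂ} (h : Admissible N Ψ) :
    2 * EN 2 α * ∫ x in cube N Q0, abS x * ‖Ψ x‖ ^ 2 ≤ kinE N α Q0 Ψ := by
  classical
  have hΨc : Continuous Ψ := h.smooth.continuous
  have iD : ∀ j, IntegrableOn (DSq N α j Ψ) (cube N Q0) := fun j => ab_integrableOn (ab_DSq_cont α h j) (ab_cube_subset N)
  have iP : IntegrableOn (fun x => ‖Ψ x‖ ^ 2) (cube N Q0) :=
    ab_integrableOn (by fun_prop) (ab_cube_subset N)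
  have e1 : ∫ x in cube N Q0, abS x * ‖Ψ x‖ ^ 2
      = ∑ r ∈ abI N, ∫ x in cube N Q0, (abE r).indicator (fun x => ‖Ψ x‖ ^ 2) x := by
    rw [← integral_finsetSum _ fun r _ => iP.indicator (abE_meas r)]
    congr 1
    funext x
    rw [abS, Finset.sum_mul]
    refine Finset.sum_congr rfl fun r _ => ?_
    simp only [Set.indicator_apply]
    split_ifs <;> simp
  have e2 : 4 * EN 2 α * ∫ x in cube N Q0, abS x * ‖Ψ x‖ ^ 2 ≤
      ∑ r ∈ abI N, ((∫ x in cube N Q0, (abE r).indicator (DSq N α r.2.1 Ψ) x)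
        + ∫ x in cube N Q0, (abE r).indicator (DSq N α r.2.2 Ψ) x) := by
    rw [e1, Finset.mul_sum]
    refine Finset.sum_le_sum fun r hr => ?_
    have := ab_pair two_ne_zero α h (abE_inj r hr) r.1
    rw [Fin.sum_univ_two] at this
    exact this
  have key : ∀ f : (Fin 2 × Fin 2) × (Fin N × Fin N) → Fin N,
      (∀ (x : Config N) (a : Fin N → ℝ), (∀ j, 0 ≤ a j) →
        ∑ r ∈ (abI N).filter (fun r => x ∈ abE r), a (f r) ≤ ∑ j, a j) →
      ∑ r ∈ abI N, (∫ x in cube N Q0, (abE r).indicator (DSq N α (f r) Ψ) x)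
        ≤ kinE N α Q0 Ψ := by
    intro f hf
    unfold kinE
    rw [← integral_finsetSum _ fun r _ => (iD (f r)).indicator (abE_meas r),
      ← integral_finsetSum _ fun j _ => iD j]
    refine integral_mono (integrable_finsetSum _ fun r _ => (iD (f r)).indicator (abE_meas r))
      (integrable_finsetSum _ fun j _ => iD j) fun x => ?_
    simp only
    rw [ab_sum_ind x (fun r => DSq N α (f r) Ψ)]
    exact hf x (fun j => DSq N α j Ψ x) (fun j => ab_DSq_nonneg α Ψ j x)
  rw [Finset.sum_add_distrib] at e2
  have k1 := key (fun r => r.2.1) abE_sum1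
  have k2 := key (fun r => r.2.2) abE_sum2
  linarith

theorem ab_final {N : ℕ} (α : ℝ) {Ψ : Config N → ℂ} (h : Admissible N Ψ)
    (hn : normSq N Q0 Ψ = 1) (he : 0 < EN 2 α) :
    π ^ 2 * ((N.choose 2 : ℝ) * (3 / 4) ^ (N - 2)) * EN 2 α ≤
      kinE N α Q0 Ψ * ((π + 4 * √(EN 2 α)) ^ 2 +
          EN 2 α * ((N.choose 2 : ℝ) * (3 / 4) ^ (N - 2))) := by
  have hΨc : Continuous Ψ := h.smooth.continuous
  set b := (N.choose 2 : ℝ) * (3 / 4) ^ (N - 2) with hb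
  have hb0 : 0 ≤ b := by positivity
  set T := kinE N α Q0 Ψ with hT
  set s := √(EN 2 α) with hs
  have hs0 : 0 < s := Real.sqrt_pos.2 he
  have hss : EN 2 α = s ^ 2 := (Real.sq_sqrt he.le).symm
  have hp := ab_pairs α h
  have hd := ab_diamag α h
  rw [hn] at hd
  set m := ∫ x in cube N Q0, ‖Ψ x‖ with hm
  have iS : IntegrableOn (abS : Config N → ℝ) (cube N Q0) := by
    unfold abS
    exact integrable_finsetSum _ fun r _ => (integrable_const _).indicator (abE_meas r)
  have iP : IntegrableOn (fun x => ‖Ψ x‖ ^ 2) (cube N Q0) :=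
    ab_integrableOn (by fun_prop) (ab_cube_subset N)
  have iP1 : IntegrableOn (fun x => ‖Ψ x‖) (cube N Q0) :=
    ab_integrableOn (by fun_prop) (ab_cube_subset N)
  have iV : IntegrableOn (fun x => (m - ‖Ψ x‖) ^ 2) (cube N Q0) :=
    ab_integrableOn (by fun_prop) (ab_cube_subset N)
  have iSP : IntegrableOn (fun x => abS x * ‖Ψ x‖ ^ 2) (cube N Q0) := by
    refine iP.bdd_mul (c := 8) (abS_meas N).aestronglyMeasurable
      (Filter.Eventually.of_forall fun x => ?_)
    rw [Real.norm_eq_abs, abs_of_nonneg (abS_nonneg x)]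
    exact abS_le x
  have hV : ∫ x in cube N Q0, (m - ‖Ψ x‖) ^ 2 = 1 - m ^ 2 := by
    have : ∀ x, (m - ‖Ψ x‖) ^ 2 = (m ^ 2 - 2 * m * ‖Ψ x‖) + ‖Ψ x‖ ^ 2 := fun x => by ring
    simp_rw [this]
    have i0 : IntegrableOn (fun x : Config N => m ^ 2 - 2 * m * ‖Ψ x‖) (cube N Q0) :=
      ab_integrableOn (by fun_prop) (ab_cube_subset N)
    rw [integral_add i0 iP,
      integral_sub (integrable_const _) (iP1.const_mul _), integral_const_mul, ← hm]
    have : ∫ x in cube N Q0, ‖Ψ x‖ ^ 2 = 1 := hn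
    rw [this]
    simp
    ring
  have hpi := Real.pi_pos
  have pt : ∀ x, π * m ^ 2 * abS x ≤ (π + 4 * s) * (abS x * ‖Ψ x‖ ^ 2 +
      (2 * π / s) * (m - ‖Ψ x‖) ^ 2) := by
    intro x
    have hS0 := abS_nonneg x
    have hS8 := abS_le x
    set u := ‖Ψ x‖
    have c1 : π * m ^ 2 ≤ (π + 4 * s) * (u ^ 2 + π / (4 * s) * (m - u) ^ 2) := by
      have : (π + 4 * s) * (u ^ 2 + π / (4 * s) * (m - u) ^ 2) - π * m ^ 2
          = (4 * s * u - π * (m - u)) ^ 2 / (4 * s) := by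
        field_simp
        ring
      have h0 : 0 ≤ (4 * s * u - π * (m - u)) ^ 2 / (4 * s) := by positivity
      linarith
    calc π * m ^ 2 * abS x ≤ (π + 4 * s) * (u ^ 2 + π / (4 * s) * (m - u) ^ 2) * abS x :=
          mul_le_mul_of_nonneg_right c1 hS0
      _ = (π + 4 * s) * (abS x * u ^ 2 + abS x * (π / (4 * s) * (m - u) ^ 2)) := by ring
      _ ≤ (π + 4 * s) * (abS x * u ^ 2 + 8 * (π / (4 * s) * (m - u) ^ 2)) := by gcongr
      _ = _ := by field_simp; ring
  have I := integral_mono (iS.const_mul (π * m ^ 2))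
    ((iSP.add (iV.const_mul (2 * π / s))).const_mul (π + 4 * s)) pt
  simp only [Pi.add_apply] at I
  rw [integral_const_mul, integral_const_mul, integral_add iSP (iV.const_mul _),
    integral_const_mul, hV, abS_int, ← hb] at I
  rw [hss] at hp ⊢
  set J := ∫ x in cube N Q0, abS x * ‖Ψ x‖ ^ 2
  have hd' : π ^ 2 * (1 - m ^ 2) ≤ T := by
    rw [le_div_iff₀ (by positivity)] at hd; linarith
  have i1 : π * m ^ 2 * b * s ^ 2 ≤ (π + 4 * s) * (T + 4 * π * s * (1 - m ^ 2)) := by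
    calc π * m ^ 2 * b * s ^ 2 = (π * m ^ 2 * (b / 2)) * (2 * s ^ 2) := by ring
      _ ≤ ((π + 4 * s) * (J + 2 * π / s * (1 - m ^ 2))) * (2 * s ^ 2) := by gcongr
      _ = (π + 4 * s) * (2 * s ^ 2 * J + 4 * π * s * (1 - m ^ 2)) := by field_simp; ring
      _ ≤ _ := by gcongr
  have i2 : π ^ 2 * m ^ 2 * b * s ^ 2 ≤ (π + 4 * s) ^ 2 * T := by
    calc π ^ 2 * m ^ 2 * b * s ^ 2 = π * (π * m ^ 2 * b * s ^ 2) := by ring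
      _ ≤ π * ((π + 4 * s) * (T + 4 * π * s * (1 - m ^ 2))) := by gcongr
      _ = (π + 4 * s) * (π * T + 4 * s * (π ^ 2 * (1 - m ^ 2))) := by ring
      _ ≤ (π + 4 * s) * (π * T + 4 * s * T) := by gcongr
      _ = _ := by ring
  have i3 : s ^ 2 * b * (π ^ 2 * (1 - m ^ 2)) ≤ s ^ 2 * b * T := by gcongr
  nlinarith [i2, i3]

/-- squared Euclidean length -/
def abLen (v : Plane) : ℝ := v.1 ^ 2 + v.2 ^ 2

/-- a smooth symmetric function vanishing near the diagonals -/
def abTest (N : ℕ) (M : ℝ) (x : Config N) : ℝ :=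
  ∏ j, ∏ k, if j = k then 1 else Real.smoothTransition (M * abLen (x j - x k) - 1)

lemma abTest_adm (N : ℕ) (M : ℝ) : Admissible N (fun x => (abTest N M x : ℂ)) := by
  refine ⟨?_, ?_, ?_⟩
  · have h1 : ContDiff ℝ (⊤ : ℕ∞) (abTest N M) := ?_
    · exact Complex.ofRealCLM.contDiff.comp h1
    unfold abTest
    refine contDiff_prod fun j _ => contDiff_prod fun k _ => ?_
    split_ifs
    · exact contDiff_const
    · refine Real.smoothTransition.contDiff.comp ?_
      unfold abLen
      fun_prop
  · intro σ x
    congr 1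
    unfold abTest
    rw [← Equiv.prod_comp σ (fun j => ∏ k, if j = k then (1 : ℝ)
      else Real.smoothTransition (M * abLen (x j - x k) - 1))]
    refine Finset.prod_congr rfl fun j _ => ?_
    rw [← Equiv.prod_comp σ (fun k => if σ j = k then (1 : ℝ)
      else Real.smoothTransition (M * abLen (x (σ j) - x k) - 1))]
    refine Finset.prod_congr rfl fun k _ => ?_
    simp [Function.comp_apply]
  · refine ⟨⋃ j : Fin N, ⋃ k : Fin N, ⋃ _ : j ≠ k, {x | M * abLen (x j - x k) < 1}, ?_, ?_, ?_⟩
    · refine isOpen_iUnion fun j => isOpen_iUnion fun k => isOpen_iUnion fun _ => ?_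
      refine isOpen_lt ?_ continuous_const
      unfold abLen
      fun_prop
    · rintro x ⟨j, k, hjk, hx⟩
      simp only [Set.mem_iUnion]
      refine ⟨j, k, hjk, ?_⟩
      simp [hx, abLen]
    · intro x hx
      simp only [Set.mem_iUnion] at hx
      obtain ⟨j, k, hjk, hx⟩ := hx
      have hx : M * abLen (x j - x k) < 1 := hx
      have : abTest N M x = 0 := by
        unfold abTest
        refine Finset.prod_eq_zero (Finset.mem_univ j) (Finset.prod_eq_zero (Finset.mem_univ k) ?_)
        rw [if_neg hjk]
        exact Real.smoothTransition.zero_of_nonpos (by linarith)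
      simp [this]

lemma abTest_pos (N : ℕ) : ∃ M, ∃ x ∈ cube N Q0, abTest N M x ≠ 0 := by
  refine ⟨2 * (N + 1) ^ 2, fun j => (((j : ℕ) + 1) / (N + 1), 1 / 2), ?_, ?_⟩
  · intro j _
    have hj : ((j : ℕ) : ℝ) < N := by exact_mod_cast j.2
    refine ⟨⟨by positivity, ?_⟩, by norm_num, by norm_num⟩
    simp only
    rw [div_lt_one (by positivity)]
    linarith
  · unfold abTest
    refine Finset.prod_ne_zero_iff.2 fun j _ => Finset.prod_ne_zero_iff.2 fun k _ => ?_
    split_ifs with hjk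
    · exact one_ne_zero
    · refine (Real.smoothTransition.pos_of_pos ?_).ne'
      have e : 2 * ((N:ℝ) + 1) ^ 2 * abLen (((((j : ℕ) : ℝ) + 1) / ((N : ℝ) + 1), (1 / 2 : ℝ))
          - ((((k : ℕ) : ℝ) + 1) / ((N : ℝ) + 1), (1 / 2 : ℝ))) = 2 * (((j : ℕ) : ℝ) - (k : ℕ)) ^ 2 := by
        simp only [abLen, Prod.mk_sub_mk]
        field_simp
        ring
      rw [e]
      have h1 : (1:ℤ) ≤ (((j : ℕ) : ℤ) - (k : ℕ)) ^ 2 := by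
        have : ((j : ℕ) : ℤ) - (k : ℕ) ≠ 0 := by omega
        have := sq_pos_of_ne_zero this
        omega
      have h2 : (1:ℝ) ≤ (((j : ℕ) : ℝ) - (k : ℕ)) ^ 2 := by exact_mod_cast h1
      linarith

lemma ab_nonempty (N : ℕ) : ∃ Ψ : Config N → ℂ, Admissible N Ψ ∧ normSq N Q0 Ψ = 1 := by
  obtain ⟨M, x₀, hx₀, hne⟩ := abTest_pos N
  have h := abTest_adm N M
  set Ψ : Config N → ℂ := fun x => (abTest N M x : ℂ) with hΨ
  have hΨc : Continuous Ψ := h.smooth.continuous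
  have iP : IntegrableOn (fun x => ‖Ψ x‖ ^ 2) (cube N Q0) :=
    ab_integrableOn (by fun_prop) (ab_cube_subset N)
  have h0 : 0 < normSq N Q0 Ψ := by
    unfold normSq
    rw [setIntegral_pos_iff_support_of_nonneg_ae
      (Filter.Eventually.of_forall fun x => by positivity) iP]
    refine IsOpen.measure_pos _ (IsOpen.inter ?_ (ab_isOpen_cube N ab_isOpen_Q0)) ⟨x₀, ?_, hx₀⟩
    · exact (by fun_prop : Continuous fun x => ‖Ψ x‖ ^ 2).isOpen_support
    · simpa [hΨ] using hne
  set s := normSq N Q0 Ψ with hs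
  let r : ℂ := ((√s)⁻¹ : ℝ)
  have hr : ‖r‖ ^ 2 = s⁻¹ := by
    simp only [r, Complex.norm_real, Real.norm_eq_abs, sq_abs, inv_pow, Real.sq_sqrt h0.le]
  refine ⟨fun x => r * Ψ x, ?_, ?_⟩
  · refine ⟨contDiff_const.mul h.smooth, fun σ x => by rw [h.symm], ?_⟩
    obtain ⟨U, h1, h2, h3⟩ := h.vanishes
    exact ⟨U, h1, h2, fun x hx => by rw [h3 x hx, mul_zero]⟩
  · unfold normSq
    simp only [norm_mul, mul_pow, hr]
    rw [integral_const_mul]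
    exact inv_mul_cancel₀ h0.ne'

/-- A priori bound in terms of the two-particle energy: for `α ∈ [0,1]`
and `N ≥ 3`, with `e₂ := E^N_2(α)` and `b_N := binom(N,2)(3/4)^{N−2}`,
`E^N_N(α) ≥ π² b_N e₂ / ((π + 4√e₂)² + e₂ b_N)`. -/
theorem apriori_bound_two_particle (α : ℝ) (hα : α ∈ Set.Icc (0 : ℝ) 1)
    (N : ℕ) (hN : 3 ≤ N) :
    π ^ 2 * ((N.choose 2 : ℝ) * (3 / 4) ^ (N - 2)) * EN 2 α /
        ((π + 4 * Real.sqrt (EN 2 α)) ^ 2 +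
          EN 2 α * ((N.choose 2 : ℝ) * (3 / 4) ^ (N - 2))) ≤
      EN N α := by
  rcases (ab_EN_nonneg 2 α).eq_or_lt with he | he
  · rw [← he, mul_zero, zero_div]
    exact ab_EN_nonneg N α
  · have hN0 : N ≠ 0 := by omega
    have hpos : 0 < (π + 4 * Real.sqrt (EN 2 α)) ^ 2 +
          EN 2 α * ((N.choose 2 : ℝ) * (3 / 4) ^ (N - 2)) := by
      have := Real.pi_pos
      positivity
    have key : ∀ Ψ : Config N → ℂ, Admissible N Ψ → normSq N Q0 Ψ = 1 →
        π ^ 2 * ((N.choose 2 : ℝ) * (3 / 4) ^ (N - 2)) * EN 2 α /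
        ((π + 4 * Real.sqrt (EN 2 α)) ^ 2 +
          EN 2 α * ((N.choose 2 : ℝ) * (3 / 4) ^ (N - 2))) ≤ kinE N α Q0 Ψ := by
      intro Ψ h hn
      rw [div_le_iff₀ hpos]
      exact ab_final α h hn he
    have hset : EN N α = sInf {E | ∃ Ψ : Config N → ℂ, Admissible N Ψ ∧ normSq N Q0 Ψ = 1 ∧
        E = kinE N α Q0 Ψ} := by
      rw [EN, neumannE, if_neg hN0]
    rw [hset]
    apply le_csInf
    · obtain ⟨Ψ, h, hn⟩ := ab_nonempty N
      exact ⟨_, Ψ, h, hn, rfl⟩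
    · rintro E ⟨Ψ, h, hn, rfl⟩
      exact key Ψ h hn
end
end
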